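/- Let k ≥ 3 and let G be a graph containing no two vertex-disjoint triangles. If |H_k(G)| − |L_k(G)| ≥ 2k, then G contains k vertex-disjoint cycles. -/

import Mathlib

/-- `G` contains `k` pairwise vertex-disjoint cycles. -/
def HasDisjointCycles {V : Type*} (G : SimpleGraph V) (k : ℕ) : Prop :=
  ∃ c : Fin k → (v : V) × G.Walk v v,
    (∀ i, (c i).2.IsCycle) ∧
    ∀ i j, i ≠ j → List.Disjoint (c i).2.support (c j).2.support

/-- `H_k(G)`: the set of vertices of degree at least `2k`. -/
def highSet {V : Type*} [Fintype V] (G : SimpleGraph V) [DecidableRel G.Adj] (k : ℕ) :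
    Finset V :=
  Finset.univ.filter fun v => 2 * k ≤ G.degree v

/-- `L_k(G)`: the set of vertices of degree at most `2k - 2`. -/
def lowSet {V : Type*} [Fintype V] (G : SimpleGraph V) [DecidableRel G.Adj] (k : ℕ) :
    Finset V :=
  Finset.univ.filter fun v => G.degree v ≤ 2 * k - 2

/-- `t` is (the vertex set of) a triangle in `G`. -/
def IsTriangle {V : Type*} [DecidableEq V] (G : SimpleGraph V) (t : Finset V) : Prop :=
  ∃ a b c : V, t = {a, b, c} ∧ G.Adj a b ∧ G.Adj a c ∧ G.Adj b c

namespace DisjointCycles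

noncomputable section

open Finset
open scoped Classical

variable {V : Type*} {G : SimpleGraph V} {S T X Y Z F : Finset V} {k : ℕ}

/-- The number of neighbours of `v` in `S`. -/
def dg (G : SimpleGraph V) (S : Finset V) (v : V) : ℕ := (S.filter (G.Adj v)).card

/-- The number of ordered adjacent pairs in `A × B`. -/
def ee (G : SimpleGraph V) (A B : Finset V) : ℕ := ∑ v ∈ A, dg G B v

/-- A nonempty set in which every vertex has at least two neighbours; it contains a cycle. -/
def Cyc (G : SimpleGraph V) (Z : Finset V) : Prop := Z.Nonempty ∧ ∀ v ∈ Z, 2 ≤ dg G Z v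

/-- `S` contains `k` disjoint sets of minimum inner degree at least two. -/
def DC (G : SimpleGraph V) : ℕ → Finset V → Prop
  | 0, _ => True
  | k + 1, S => ∃ Z ⊆ S, Cyc G Z ∧ DC G k (S \ Z)

/-- No cycle inside `F`. -/
def Acyc (G : SimpleGraph V) (F : Finset V) : Prop := ∀ Z ⊆ F, ¬ Cyc G Z

lemma dg_mono (h : S ⊆ T) (v : V) : dg G S v ≤ dg G T v :=
  card_le_card (filter_subset_filter _ h)

@[simp] lemma dg_empty (v : V) : dg G ∅ v = 0 := by simp [dg]

lemma dg_insert {a : V} (h : a ∉ S) (v : V) :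
    dg G (insert a S) v = (if G.Adj v a then 1 else 0) + dg G S v := by
  unfold dg
  rw [filter_insert]
  split_ifs with h1
  · rw [card_insert_of_notMem (by simp [h])]; omega
  · simp

lemma dg_singleton (a v : V) : dg G {a} v = (if G.Adj v a then 1 else 0) := by
  have := dg_insert (G := G) (S := ∅) (a := a) (by simp) v
  simpa using this

lemma dg_erase {a : V} (h : a ∈ S) (v : V) :
    dg G S v = dg G (S.erase a) v + (if G.Adj v a then 1 else 0) := by
  conv_lhs => rw [← insert_erase h]
  rw [dg_insert (notMem_erase a S)]; omega

lemma dg_union (h : Disjoint X Y) (v : V) : dg G (X ∪ Y) v = dg G X v + dg G Y v := by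
  unfold dg
  rw [filter_union, card_union_of_disjoint (disjoint_filter_filter h)]

lemma dg_sdiff (h : Z ⊆ S) (v : V) : dg G S v = dg G (S \ Z) v + dg G Z v := by
  conv_lhs => rw [← sdiff_union_of_subset h]
  exact dg_union sdiff_disjoint v

lemma dg_pos_iff {v : V} : 1 ≤ dg G S v ↔ ∃ u ∈ S, G.Adj v u := by
  unfold dg
  rw [Nat.one_le_iff_ne_zero, Ne, card_eq_zero, ← Ne, ← nonempty_iff_ne_empty]
  simp [Finset.Nonempty]

lemma dg_zero_iff {v : V} : dg G S v = 0 ↔ ∀ u ∈ S, ¬ G.Adj v u := by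
  unfold dg
  rw [card_eq_zero, filter_eq_empty_iff]

lemma two_le_dg_iff {v : V} :
    2 ≤ dg G S v ↔ ∃ u ∈ S, ∃ w ∈ S, u ≠ w ∧ G.Adj v u ∧ G.Adj v w := by
  unfold dg
  rw [← Nat.lt_iff_add_one_le, one_lt_card]
  simp only [mem_filter]
  constructor
  · rintro ⟨a, ⟨h1, h2⟩, b, ⟨h3, h4⟩, h5⟩
    exact ⟨a, h1, b, h3, h5, h2, h4⟩
  · rintro ⟨a, h1, b, h3, h5, h2, h4⟩
    exact ⟨a, ⟨h1, h2⟩, b, ⟨h3, h4⟩, h5⟩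

lemma dg_le_one_iff {v : V} :
    dg G S v ≤ 1 ↔ ∀ u ∈ S, ∀ w ∈ S, G.Adj v u → G.Adj v w → u = w := by
  have := two_le_dg_iff (G := G) (S := S) (v := v)
  constructor
  · intro h u hu w hw h1 h2
    by_contra hne
    have := this.2 ⟨u, hu, w, hw, hne, h1, h2⟩
    omega
  · intro h
    by_contra h2
    obtain ⟨u, hu, w, hw, hne, h1, h2⟩ := this.1 (by omega)
    exact hne (h u hu w hw h1 h2)

lemma exists_adj_ne {v a : V} (h : 2 ≤ dg G S v) : ∃ u ∈ S, u ≠ a ∧ G.Adj v u := by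
  obtain ⟨u, hu, w, hw, hne, h1, h2⟩ := two_le_dg_iff.1 h
  by_cases hua : u = a
  · exact ⟨w, hw, by rintro rfl; exact hne hua, h2⟩
  · exact ⟨u, hu, hua, h1⟩

lemma exists_adj_ne_ne {v a b : V} (h : 3 ≤ dg G S v) :
    ∃ u ∈ S, u ≠ a ∧ u ≠ b ∧ G.Adj v u := by
  by_cases ha : a ∈ S
  · have h1 := dg_erase (G := G) ha v
    obtain ⟨u, hu, hub, huv⟩ := exists_adj_ne (G := G) (S := S.erase a) (v := v) (a := b)
      (by split_ifs at h1 <;> omega)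
    exact ⟨u, mem_of_mem_erase hu, ne_of_mem_erase hu, hub, huv⟩
  · obtain ⟨u, hu, hub, huv⟩ := exists_adj_ne (a := b) (by omega : 2 ≤ dg G S v)
    exact ⟨u, hu, by rintro rfl; exact ha hu, hub, huv⟩

lemma dg_le_card (S : Finset V) (v : V) : dg G S v ≤ S.card := card_filter_le _ _

lemma dg_lt_card {v : V} (h : v ∈ S) : dg G S v + 1 ≤ S.card := by
  have h1 := dg_erase (G := G) h v
  have h2 := dg_le_card (G := G) (S.erase v) v
  rw [card_erase_of_mem h] at h2
  have : 0 < S.card := card_pos.2 ⟨v, h⟩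
  simp at h1
  omega

lemma dg_congr {G' : SimpleGraph V} {v : V} (h : ∀ u ∈ S, G.Adj v u ↔ G'.Adj v u) :
    dg G S v = dg G' S v := by
  unfold dg
  congr 1
  exact filter_congr h

lemma sum_ite_adj (S : Finset V) (v : V) :
    ∑ u ∈ S, (if G.Adj u v then 1 else 0) = dg G S v := by
  unfold dg
  rw [card_filter]
  exact sum_congr rfl fun u _ => by simp [G.adj_comm]

lemma ee_comm (A B : Finset V) : ee G A B = ee G B A := by
  unfold ee
  simp_rw [← sum_ite_adj]
  rw [sum_comm]
  exact sum_congr rfl fun u _ => sum_congr rfl fun w _ => by simp [G.adj_comm]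

lemma ee_union_right (A : Finset V) (h : Disjoint X Y) :
    ee G A (X ∪ Y) = ee G A X + ee G A Y := by
  unfold ee
  rw [← sum_add_distrib]
  exact sum_congr rfl fun v _ => dg_union h v

lemma ee_union_left (A : Finset V) (h : Disjoint X Y) :
    ee G (X ∪ Y) A = ee G X A + ee G Y A := by
  rw [ee_comm, ee_union_right A h, ee_comm A, ee_comm A]

lemma ee_singleton_left (v : V) (A : Finset V) : ee G {v} A = dg G A v := by simp [ee]

lemma ee_insert_self {v : V} (h : v ∉ S) :
    ee G (insert v S) (insert v S) = ee G S S + 2 * dg G S v := by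
  have hd : Disjoint {v} S := by simpa using h
  rw [insert_eq, ee_union_left _ hd, ee_union_right _ hd, ee_union_right _ hd,
    ee_comm S {v}, ee_singleton_left, ee_singleton_left, dg_singleton]
  simp
  omega

lemma Acyc.subset (h : Acyc G T) (hs : S ⊆ T) : Acyc G S := fun Z hZ => h Z (hZ.trans hs)

lemma Acyc.exists_dg_le_one (h : Acyc G F) (hne : F.Nonempty) : ∃ v ∈ F, dg G F v ≤ 1 := by
  by_contra hc
  push Not at hc
  exact h F Subset.rfl ⟨hne, fun v hv => hc v hv⟩

lemma Acyc.ee_le (h : Acyc G F) (hne : F.Nonempty) : ee G F F + 2 ≤ 2 * F.card := by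
  induction hn : F.card using Nat.strong_induction_on generalizing F with
  | _ n ih =>
    obtain ⟨v, hv, hd⟩ := h.exists_dg_le_one hne
    have h1 := ee_insert_self (G := G) (notMem_erase v F)
    rw [insert_erase hv] at h1
    have h2 := dg_mono (G := G) (erase_subset v F) v
    have h3 := card_erase_add_one hv
    rcases (F.erase v).eq_empty_or_nonempty with h0 | h0
    · rw [h0, dg_empty] at h1
      rw [h0, card_empty] at h3
      have : ee G ∅ ∅ = 0 := by simp [ee]
      omega
    · have := ih _ (by omega) (h.subset (erase_subset v F)) h0 rfl
      omega

lemma Acyc.exists_two (h : Acyc G F) (hc : 2 ≤ F.card) (a : V) :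
    ∃ v ∈ F, v ≠ a ∧ dg G F v ≤ 1 := by
  obtain ⟨w, hw, hd⟩ := h.exists_dg_le_one (card_pos.1 (by omega))
  by_cases hwa : w = a
  swap
  · exact ⟨w, hw, hwa, hd⟩
  subst hwa
  by_contra hcon
  push Not at hcon
  have h1 := h.ee_le ⟨w, hw⟩
  have h2 : ee G F F = dg G F w + ∑ v ∈ F.erase w, dg G F v := (add_sum_erase F _ hw).symm
  have h3 : ∑ v ∈ F.erase w, 2 ≤ ∑ v ∈ F.erase w, dg G F v :=
    sum_le_sum fun v hv => hcon v (mem_of_mem_erase hv) (ne_of_mem_erase hv)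
  rw [sum_const, smul_eq_mul, card_erase_of_mem hw] at h3
  have h4 : dg G F w = 0 := by omega
  refine h (F.erase w) (erase_subset _ _) ⟨card_pos.1 (by rw [card_erase_of_mem hw]; omega), ?_⟩
  intro v hv
  have h5 := hcon v (mem_of_mem_erase hv) (ne_of_mem_erase hv)
  have h6 := dg_erase (G := G) hw v
  have h7 := dg_zero_iff.1 h4 v (mem_of_mem_erase hv)
  rw [if_neg (fun h => h7 h.symm)] at h6
  omega

lemma cyc_triangle {a b c : V} (h1 : G.Adj a b) (h2 : G.Adj a c) (h3 : G.Adj b c) :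
    Cyc G {a, b, c} := by
  refine ⟨by simp, ?_⟩
  intro v hv
  simp only [mem_insert, mem_singleton] at hv
  rw [two_le_dg_iff]
  rcases hv with rfl | rfl | rfl
  · exact ⟨b, by simp, c, by simp, h3.ne, h1, h2⟩
  · exact ⟨a, by simp, c, by simp, h2.ne, h1.symm, h3⟩
  · exact ⟨a, by simp, b, by simp, h1.ne, h2.symm, h3.symm⟩

lemma cyc_square {a b c d : V} (h1 : G.Adj a b) (h2 : G.Adj b c) (h3 : G.Adj c d)
    (h4 : G.Adj d a) (hac : a ≠ c) (hbd : b ≠ d) : Cyc G {a, b, c, d} := by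
  refine ⟨by simp, ?_⟩
  intro v hv
  simp only [mem_insert, mem_singleton] at hv
  rw [two_le_dg_iff]
  rcases hv with rfl | rfl | rfl | rfl
  · exact ⟨b, by simp, d, by simp, hbd, h1, h4.symm⟩
  · exact ⟨a, by simp, c, by simp, hac, h1.symm, h2⟩
  · exact ⟨b, by simp, d, by simp, hbd, h2.symm, h3⟩
  · exact ⟨a, by simp, c, by simp, hac, h4, h3.symm⟩

lemma DC.mono (h : S ⊆ T) : DC G k S → DC G k T := by
  induction k generalizing S T with
  | zero => exact fun _ => trivial
  | succ k ih =>
    rintro ⟨Z, hZ, hc, hd⟩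
    exact ⟨Z, hZ.trans h, hc, ih (sdiff_subset_sdiff h Subset.rfl) hd⟩

lemma DC.succ (hZ : Cyc G Z) (hs : Z ⊆ S) (h : DC G k (S \ Z)) : DC G (k + 1) S :=
  ⟨Z, hs, hZ, h⟩

lemma DC.one (hZ : Cyc G Z) (hs : Z ⊆ S) : DC G 1 S := ⟨Z, hs, hZ, trivial⟩

lemma DC.two (hX : Cyc G X) (hY : Cyc G Y) (hXS : X ⊆ S) (hYS : Y ⊆ S) (hd : Disjoint X Y) :
    DC G 2 S :=
  DC.succ hX hXS (DC.one hY (subset_sdiff.2 ⟨hYS, hd.symm⟩))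

lemma DC.three (hX : Cyc G X) (hY : Cyc G Y) (hZ : Cyc G Z) (hXS : X ⊆ S) (hYS : Y ⊆ S)
    (hZS : Z ⊆ S) (hd : Disjoint X Y) (hd' : Disjoint X Z) (hd'' : Disjoint Y Z) :
    DC G 3 S :=
  DC.succ hX hXS (DC.two hY hZ (subset_sdiff.2 ⟨hYS, hd.symm⟩)
    (subset_sdiff.2 ⟨hZS, hd'.symm⟩) hd'')

lemma acyc_sdiff (h : ¬ DC G 2 S) (hs : Z ⊆ S) (hZ : Cyc G Z) : Acyc G (S \ Z) :=
  fun _ hY hc => h (DC.succ hZ hs (DC.one hc hY))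

lemma DC.congr {G' : SimpleGraph V} (h : ∀ u ∈ S, ∀ v ∈ S, G.Adj u v ↔ G'.Adj u v) :
    DC G k S → DC G' k S := by
  induction k generalizing S with
  | zero => exact fun _ => trivial
  | succ k ih =>
    rintro ⟨Z, hZ, hc, hd⟩
    refine ⟨Z, hZ, ⟨hc.1, fun v hv => ?_⟩, ih (fun u hu v hv => h u (sdiff_subset hu) v
      (sdiff_subset hv)) hd⟩
    rw [← dg_congr fun u hu => h v (hZ hv) u (hZ hu)]
    exact hc.2 v hv

lemma Cyc.exists_isCycle (h : Cyc G Z) :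
    ∃ (v : V) (w : G.Walk v v), w.IsCycle ∧ ∀ u ∈ w.support, u ∈ Z := by
  by_cases hac : (G.induce (Z : Set V)).IsAcyclic
  · exfalso
    obtain ⟨z, hz⟩ := h.1
    set H := G.induce (Z : Set V) with hH
    have hdeg : ∀ v : (Z : Set V), ∃ a b : (Z : Set V), a ≠ b ∧ H.Adj v a ∧ H.Adj v b := by
      intro v
      obtain ⟨u, hu, w, hw, hne, h1, h2⟩ := two_le_dg_iff.1 (h.2 v v.2)
      exact ⟨⟨u, hu⟩, ⟨w, hw⟩, by simpa using hne, h1, h2⟩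
    let c := H.connectedComponentMk ⟨z, hz⟩
    have htree := hac.isTree_connectedComponent c
    have hdeg' : ∀ v : c, ∃ a b : c, a ≠ b ∧ c.toSimpleGraph.Adj v a ∧
        c.toSimpleGraph.Adj v b := by
      intro v
      obtain ⟨a, b, hab, ha, hb⟩ := hdeg v
      have hv : H.connectedComponentMk v.1 = c := v.2
      have ha' : a ∈ c := by
        refine Eq.trans ?_ hv
        exact SimpleGraph.ConnectedComponent.sound ha.symm.reachable
      have hb' : b ∈ c := by
        refine Eq.trans ?_ hv
        exact SimpleGraph.ConnectedComponent.sound hb.symm.reachable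
      exact ⟨⟨a, ha'⟩, ⟨b, hb'⟩, by simpa using hab, ha, hb⟩
    have hnt : Nontrivial c := by
      obtain ⟨a, b, hab, -, -⟩ := hdeg' ⟨⟨z, hz⟩, rfl⟩
      exact ⟨a, b, hab⟩
    have : Fintype c := Fintype.ofFinite _
    obtain ⟨v, hv⟩ := htree.exists_vert_degree_one_of_nontrivial
    obtain ⟨a, b, hab, ha, hb⟩ := hdeg' v
    have h2 := SimpleGraph.degree_eq_one_iff_existsUnique_adj.1 hv
    exact hab (h2.unique ha hb)
  · unfold SimpleGraph.IsAcyclic at hac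
    push Not at hac
    obtain ⟨v, p, hp⟩ := hac
    refine ⟨_, p.map (SimpleGraph.Embedding.induce (Z : Set V)).toHom,
      hp.map Subtype.val_injective, ?_⟩
    intro u hu
    rw [SimpleGraph.Walk.support_map, List.mem_map] at hu
    obtain ⟨x, -, rfl⟩ := hu
    exact x.2

lemma DC.exists_cycles (h : DC G k S) :
    ∃ c : Fin k → (v : V) × G.Walk v v,
    (∀ i, (c i).2.IsCycle) ∧ (∀ i, ∀ u ∈ (c i).2.support, u ∈ S) ∧
    ∀ i j, i ≠ j → List.Disjoint (c i).2.support (c j).2.support := by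
  induction k generalizing S with
  | zero => exact ⟨fun i => i.elim0, fun i => i.elim0, fun i => i.elim0, fun i => i.elim0⟩
  | succ k ih =>
    obtain ⟨Z, hZ, hc, hd⟩ := h
    obtain ⟨c, h1, h2, h3⟩ := ih hd
    obtain ⟨v, w, hw, hwZ⟩ := hc.exists_isCycle
    refine ⟨Fin.cons ⟨v, w⟩ c, ?_, ?_, ?_⟩
    · intro i
      cases i using Fin.cases with
      | zero => exact hw
      | succ i => exact h1 i
    · intro i u hu
      cases i using Fin.cases with
      | zero => exact hZ (hwZ u hu)
      | succ i => exact sdiff_subset (h2 i u hu)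
    · intro i j hij
      cases i using Fin.cases with
      | zero =>
        cases j using Fin.cases with
        | zero => exact absurd rfl hij
        | succ j =>
          intro u hu hu'
          exact (mem_sdiff.1 (h2 j u hu')).2 (hwZ u hu)
      | succ i =>
        cases j using Fin.cases with
        | zero =>
          intro u hu hu'
          exact (mem_sdiff.1 (h2 i u hu)).2 (hwZ u hu')
        | succ j => exact h3 i j (by rintro rfl; exact hij rfl)

lemma DC.hasDisjointCycles (h : DC G k S) : HasDisjointCycles G k := by
  obtain ⟨c, h1, -, h3⟩ := h.exists_cycles
  exact ⟨c, h1, h3⟩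

/-- The weight of a degree: `1` if high, `-1` if low, `0` if it equals `2 * k - 1`. -/
def wt (k d : ℕ) : ℤ := if 2 * k ≤ d then 1 else if d + 2 ≤ 2 * k then -1 else 0

/-- The total weight of the vertices of `S` in the graph induced on `S`. -/
def W (G : SimpleGraph V) (S : Finset V) (k : ℕ) : ℤ := ∑ v ∈ S, wt k (dg G S v)

lemma wt_eq_one {d : ℕ} (h : 2 * k ≤ d) : wt k d = 1 := by simp [wt, h]

lemma wt_eq_neg {d : ℕ} (h : d + 2 ≤ 2 * k) : wt k d = -1 := by
  unfold wt; rw [if_neg (by omega), if_pos h]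

lemma wt_eq_zero {d : ℕ} (h : d + 1 = 2 * k) : wt k d = 0 := by
  unfold wt; rw [if_neg (by omega), if_neg (by omega)]

lemma wt_mono {d e : ℕ} (h : d ≤ e) : wt k d ≤ wt k e := by
  unfold wt; split_ifs <;> omega

lemma wt_le_one (k d : ℕ) : wt k d ≤ 1 := by unfold wt; split_ifs <;> omega

lemma W_le_card : W G S k ≤ S.card := by
  have : W G S k ≤ ∑ v ∈ S, (1 : ℤ) := sum_le_sum fun v _ => wt_le_one k _
  simpa using this

/-- Contract the edge `x y`, keeping the name `y` for the new vertex. -/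
def con (G : SimpleGraph V) (x y : V) : SimpleGraph V where
  Adj a b := a ≠ b ∧ (G.Adj a b ∨ (a = y ∧ G.Adj x b) ∨ (b = y ∧ G.Adj x a))
  symm := ⟨by
    rintro a b ⟨h1, h2⟩
    refine ⟨h1.symm, ?_⟩
    rw [G.adj_comm b a]
    tauto⟩
  loopless := ⟨fun a h => h.1 rfl⟩

lemma con_adj {x y a b : V} : (con G x y).Adj a b ↔
    a ≠ b ∧ (G.Adj a b ∨ (a = y ∧ G.Adj x b) ∨ (b = y ∧ G.Adj x a)) := Iff.rfl

lemma con_adj_of_ne {x y a b : V} (ha : a ≠ y) (hb : b ≠ y) :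
    (con G x y).Adj a b ↔ G.Adj a b := by
  rw [con_adj]
  constructor
  · rintro ⟨-, h | h | h⟩
    · exact h
    · exact absurd h.1 ha
    · exact absurd h.1 hb
  · exact fun h => ⟨h.ne, Or.inl h⟩

lemma dg_con_of_notMem {x y v : V} (hy : y ∉ S) (hv : v ≠ y) :
    dg (con G x y) S v = dg G S v :=
  dg_congr fun u hu => con_adj_of_ne hv (by rintro rfl; exact hy hu)

lemma dg_con_of_ne {x y v : V} (hx : x ∈ S) (hy : y ∈ S) (hxy : G.Adj x y)
    (hc : ∀ u ∈ S, G.Adj x u → ¬ G.Adj y u) (hv : v ∈ S) (hvy : v ≠ y) :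
    dg (con G x y) (S.erase x) v = dg G S v := by
  have hyx : y ∈ S.erase x := mem_erase.2 ⟨hxy.ne', hy⟩
  rw [dg_erase hx, dg_erase hyx, dg_erase hyx, dg_con_of_notMem (notMem_erase _ _) hvy]
  have h1 : (con G x y).Adj v y ↔ G.Adj v y ∨ G.Adj x v := by
    rw [con_adj]
    constructor
    · rintro ⟨-, h | h | h⟩
      · exact Or.inl h
      · exact absurd h.1 hvy
      · exact Or.inr h.2
    · rintro (h | h)
      · exact ⟨hvy, Or.inl h⟩
      · exact ⟨hvy, Or.inr (Or.inr ⟨rfl, h⟩)⟩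
  have h2 := hc v hv
  rw [G.adj_comm y v] at h2
  simp only [h1, G.adj_comm v x]
  split_ifs <;> simp_all

lemma dg_con_self {x y : V} (hx : x ∈ S) (hy : y ∈ S) (hxy : G.Adj x y)
    (hc : ∀ u ∈ S, G.Adj x u → ¬ G.Adj y u) :
    dg (con G x y) (S.erase x) y + 2 = dg G S x + dg G S y := by
  have hyx : y ∈ S.erase x := mem_erase.2 ⟨hxy.ne', hy⟩
  set R := (S.erase x).erase y with hR
  have hyR : y ∉ R := notMem_erase _ _
  have hRS : R ⊆ S := (erase_subset _ _).trans (erase_subset _ _)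
  have h1 := dg_erase (G := con G x y) hyx y
  have h2 := dg_erase (G := G) hx x
  have h3 := dg_erase (G := G) hx y
  have h4 := dg_erase (G := G) hyx x
  have h5 := dg_erase (G := G) hyx y
  rw [← hR] at h1 h4 h5
  simp only [SimpleGraph.irrefl, if_false, if_pos hxy, if_pos hxy.symm] at h1 h2 h3 h4 h5
  have h6 : dg (con G x y) R y = dg G R x + dg G R y := by
    unfold dg
    rw [← card_union_of_disjoint]
    · congr 1
      ext u
      simp only [mem_filter, mem_union, con_adj]
      constructor
      · rintro ⟨hu, -, h | h | h⟩
        · exact Or.inr ⟨hu, h⟩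
        · exact Or.inl ⟨hu, h.2⟩
        · exact absurd hu (h.1 ▸ hyR)
      · rintro (⟨hu, h⟩ | ⟨hu, h⟩)
        · exact ⟨hu, by rintro rfl; exact hyR hu, Or.inr (Or.inl ⟨trivial, h⟩)⟩
        · exact ⟨hu, h.ne, Or.inl h⟩
    · rw [disjoint_left]
      intro u hu hu'
      rw [mem_filter] at hu hu'
      exact hc u (hRS hu.1) hu.2 hu'.2
  omega

lemma W_con {x y : V} (hx : x ∈ S) (hy : y ∈ S) (hxy : G.Adj x y)
    (hc : ∀ u ∈ S, G.Adj x u → ¬ G.Adj y u) (k : ℕ) :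
    W (con G x y) (S.erase x) k = W G S k - wt k (dg G S x) - wt k (dg G S y)
      + wt k (dg G S x + dg G S y - 2) := by
  have hyx : y ∈ S.erase x := mem_erase.2 ⟨hxy.ne', hy⟩
  have h1 : W G S k = wt k (dg G S x) + (wt k (dg G S y) +
      ∑ v ∈ (S.erase x).erase y, wt k (dg G S v)) := by
    unfold W
    rw [← add_sum_erase _ _ hx, ← add_sum_erase _ _ hyx]
  have h2 : W (con G x y) (S.erase x) k = wt k (dg (con G x y) (S.erase x) y) +
      ∑ v ∈ (S.erase x).erase y, wt k (dg G S v) := by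
    unfold W
    rw [← add_sum_erase _ _ hyx]
    congr 1
    refine sum_congr rfl fun v hv => ?_
    rw [dg_con_of_ne hx hy hxy hc (mem_of_mem_erase (mem_of_mem_erase hv)) (ne_of_mem_erase hv)]
  have h3 := dg_con_self hx hy hxy hc
  rw [h2, h1, show dg G S x + dg G S y - 2 = dg (con G x y) (S.erase x) y by omega]
  ring

lemma Cyc.of_con {x y : V} (hx : x ∉ Z) (hxy : G.Adj x y) (h : Cyc (con G x y) Z) :
    ∃ Z' ⊆ insert x Z, Cyc G Z' := by
  by_cases hy : y ∈ Z
  swap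
  · refine ⟨Z, subset_insert _ _, h.1, fun v hv => ?_⟩
    rw [← dg_con_of_notMem (x := x) hy (by rintro rfl; exact hy hv)]
    exact h.2 v hv
  set R := Z.erase y with hR
  have hyR : y ∉ R := notMem_erase _ _
  have hxR : x ∉ R := fun h => hx (mem_of_mem_erase h)
  have hv' : ∀ v ∈ R, 2 ≤ (if G.Adj v y ∨ G.Adj v x then 1 else 0) + dg G R v := by
    intro v hv
    have hvy : v ≠ y := ne_of_mem_erase hv
    have h1 := h.2 v (mem_of_mem_erase hv)
    rw [dg_erase hy, ← hR, dg_con_of_notMem hyR hvy] at h1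
    have h2 : (con G x y).Adj v y → G.Adj v y ∨ G.Adj v x := by
      rintro ⟨-, h | h | h⟩
      · exact Or.inl h
      · exact absurd h.1 hvy
      · exact Or.inr h.2.symm
    split_ifs at h1 ⊢ <;> first | omega | tauto
  have hy' : 2 ≤ dg G R x + dg G R y := by
    have h1 := h.2 y hy
    rw [dg_erase hy, ← hR] at h1
    simp only [SimpleGraph.irrefl, if_false] at h1
    refine h1.trans ?_
    unfold dg
    refine le_trans (card_le_card ?_) (card_union_le _ _)
    intro u hu
    rw [mem_filter, con_adj] at hu
    rw [mem_union, mem_filter, mem_filter]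
    rcases hu with ⟨hu, -, h | h | h⟩
    · exact Or.inr ⟨hu, h⟩
    · exact Or.inl ⟨hu, h.2⟩
    · exact absurd hu (h.1 ▸ hyR)
  have hZ : Z = insert y R := (insert_erase hy).symm
  have hxyR : x ∉ insert y R := by rw [← hZ]; exact hx
  rw [hZ]
  by_cases h1 : dg G R x = 0
  · refine ⟨insert y R, subset_insert _ _, by simp, fun v hv => ?_⟩
    rw [dg_insert hyR]
    rcases mem_insert.1 hv with rfl | hv
    · omega
    · have h2 := hv' v hv
      have h3 := dg_zero_iff.1 h1 v hv
      rw [G.adj_comm x v] at h3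
      simpa [h3] using h2
  by_cases h2 : dg G R y = 0
  · refine ⟨insert x R, insert_subset_insert x (subset_insert _ _), by simp, fun v hv => ?_⟩
    rw [dg_insert hxR]
    rcases mem_insert.1 hv with rfl | hv
    · omega
    · have h4 := hv' v hv
      have h3 := dg_zero_iff.1 h2 v hv
      rw [G.adj_comm y v] at h3
      simpa [h3] using h4
  · refine ⟨insert x (insert y R), Subset.rfl, by simp, fun v hv => ?_⟩
    rw [dg_insert hxyR, dg_insert hyR]
    rcases mem_insert.1 hv with rfl | hv
    · rw [if_pos hxy]; omega
    rcases mem_insert.1 hv with rfl | hv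
    · rw [if_pos hxy.symm]; omega
    · have := hv' v hv
      split_ifs at this ⊢ <;> first | omega | tauto

lemma DC.of_con {x y : V} (hx : x ∉ T) (hxy : G.Adj x y) (h : DC (con G x y) k T) :
    DC G k (insert x T) := by
  induction k generalizing T with
  | zero => trivial
  | succ k ih =>
    obtain ⟨Z, hZ, hc, hd⟩ := h
    by_cases hy : y ∈ Z
    · obtain ⟨Z', hZ', hc'⟩ := hc.of_con (fun h => hx (hZ h)) hxy
      refine ⟨Z', hZ'.trans (insert_subset_insert x hZ), hc', DC.mono (S := T \ Z) ?_ ?_⟩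
      · intro v hv
        rw [mem_sdiff] at hv ⊢
        refine ⟨mem_insert_of_mem hv.1, fun h => ?_⟩
        rcases mem_insert.1 (hZ' h) with rfl | h
        · exact hx hv.1
        · exact hv.2 h
      · refine DC.congr (fun u hu v hv => ?_) hd
        rw [mem_sdiff] at hu hv
        exact con_adj_of_ne (by rintro rfl; exact hu.2 hy) (by rintro rfl; exact hv.2 hy)
    · refine ⟨Z, hZ.trans (subset_insert _ _), ⟨hc.1, fun v hv => ?_⟩, ?_⟩
      · rw [← dg_con_of_notMem (x := x) hy (by rintro rfl; exact hy hv)]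
        exact hc.2 v hv
      · rw [insert_sdiff_of_notMem _ (fun h => hx (hZ h))]
        exact ih (fun h => hx (mem_sdiff.1 h).1) hd

lemma DC.of_con_erase {x y : V} (hx : x ∈ S) (hxy : G.Adj x y)
    (h : DC (con G x y) k (S.erase x)) : DC G k S := by
  have := DC.of_con (notMem_erase x S) hxy h
  rwa [insert_erase hx] at this

/-- Deleting a vertex. -/
lemma W_erase {v : V} (hv : v ∈ S) :
    W G S k = wt k (dg G S v) + ∑ u ∈ S.erase v, wt k (dg G S u) := by
  unfold W; rw [← add_sum_erase _ _ hv]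

lemma W_erase_of_dg_zero {v : V} (hv : v ∈ S) (h : dg G S v = 0) (hk : 1 ≤ k) :
    W G (S.erase v) k = W G S k + 1 := by
  rw [W_erase hv, h, wt_eq_neg (by omega)]
  have : W G (S.erase v) k = ∑ u ∈ S.erase v, wt k (dg G S u) := by
    unfold W
    refine sum_congr rfl fun u hu => ?_
    rw [dg_erase hv u, if_neg (fun h' => dg_zero_iff.1 h u (mem_of_mem_erase hu) h'.symm)]
    rfl
  omega

lemma W_erase_of_dg_one {v y : V} (hv : v ∈ S) (h : dg G S v = 1) (hk : 2 ≤ k) (hy : y ∈ S)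
    (hvy : G.Adj v y) : W G (S.erase v) k = W G S k + 1 - wt k (dg G S y)
      + wt k (dg G S y - 1) := by
  have hyv : y ∈ S.erase v := mem_erase.2 ⟨hvy.ne', hy⟩
  rw [W_erase hv, h, wt_eq_neg (by omega), ← add_sum_erase _ _ hyv]
  have : W G (S.erase v) k = wt k (dg G (S.erase v) y) +
      ∑ u ∈ (S.erase v).erase y, wt k (dg G S u) := by
    rw [W_erase hyv]
    congr 1
    refine sum_congr rfl fun u hu => ?_
    rw [dg_erase hv u, if_neg, add_zero]
    intro h'
    exact ne_of_mem_erase hu (dg_le_one_iff.1 h.le u (mem_of_mem_erase (mem_of_mem_erase hu)) y hy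
      h'.symm hvy)
  have h2 := dg_erase (G := G) hv y
  rw [if_pos hvy.symm] at h2
  rw [this, show dg G S y - 1 = dg G (S.erase v) y by omega]
  ring

/-- Removing a set, with a penalty function bounding the loss of weight. -/
lemma W_sdiff_ge {k' : ℕ} (hZ : Z ⊆ S) (pen : V → ℤ)
    (h : ∀ v ∈ S \ Z, wt k (dg G S v) - pen v ≤ wt k' (dg G (S \ Z) v)) :
    W G S k - ∑ v ∈ Z, wt k (dg G S v) - ∑ v ∈ S \ Z, pen v ≤ W G (S \ Z) k' := by
  have h1 : W G S k = ∑ v ∈ S \ Z, wt k (dg G S v) + ∑ v ∈ Z, wt k (dg G S v) :=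
    (sum_sdiff hZ).symm
  have h2 : ∑ v ∈ S \ Z, (wt k (dg G S v) - pen v) ≤ W G (S \ Z) k' := sum_le_sum h
  rw [sum_sub_distrib] at h2
  linarith

lemma ee_sdiff (A : Finset V) (h : Z ⊆ S) :
    ee G A S = ee G A (S \ Z) + ∑ z ∈ Z, dg G A z := by
  have h1 : ee G A S = ee G A (S \ Z) + ee G A Z := by
    unfold ee
    rw [← sum_add_distrib]
    exact sum_congr rfl fun v _ => dg_sdiff h v
  rw [h1, ee_comm A Z]
  rfl

lemma sum_triple {M : Type*} [AddCommMonoid M] (f : V → M) {a b c : V} (hab : a ≠ b)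
    (hac : a ≠ c) (hbc : b ≠ c) : ∑ v ∈ ({a, b, c} : Finset V), f v = f a + f b + f c := by
  rw [sum_insert (by simp [*]), sum_insert (by simp [*]), sum_singleton, add_assoc]

lemma sum_quad {M : Type*} [AddCommMonoid M] (f : V → M) {a b c d : V} (hab : a ≠ b)
    (hac : a ≠ c) (had : a ≠ d) (hbc : b ≠ c) (hbd : b ≠ d) (hcd : c ≠ d) :
    ∑ v ∈ ({a, b, c, d} : Finset V), f v = f a + f b + f c + f d := by
  rw [sum_insert (by simp [*]), sum_triple f hbc hbd hcd]
  simp only [add_assoc]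

lemma sum_quint {M : Type*} [AddCommMonoid M] (f : V → M) {a b c d e : V} (hab : a ≠ b)
    (hac : a ≠ c) (had : a ≠ d) (hae : a ≠ e) (hbc : b ≠ c) (hbd : b ≠ d) (hbe : b ≠ e)
    (hcd : c ≠ d) (hce : c ≠ e) (hde : d ≠ e) :
    ∑ v ∈ ({a, b, c, d, e} : Finset V), f v = f a + f b + f c + f d + f e := by
  rw [sum_insert (by simp [*]), sum_quad f hbc hbd hbe hcd hce hde]
  simp only [add_assoc]

lemma dg_triple {a b c : V} (hab : a ≠ b) (hac : a ≠ c) (hbc : b ≠ c) (v : V) :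
    dg G {a, b, c} v = (if G.Adj v a then 1 else 0) + (if G.Adj v b then 1 else 0) +
      (if G.Adj v c then 1 else 0) := by
  rw [dg_insert (by simp [*]), dg_insert (by simp [*]), dg_singleton, add_assoc]

lemma dg_quad {a b c d : V} (hab : a ≠ b) (hac : a ≠ c) (had : a ≠ d) (hbc : b ≠ c)
    (hbd : b ≠ d) (hcd : c ≠ d) (v : V) :
    dg G {a, b, c, d} v = (if G.Adj v a then 1 else 0) + (if G.Adj v b then 1 else 0) +
      (if G.Adj v c then 1 else 0) + (if G.Adj v d then 1 else 0) := by
  rw [dg_insert (by simp [*]), dg_triple hbc hbd hcd]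
  simp only [add_assoc]

/-- `v` lies in a triangle inside `S`. -/
def InTri (G : SimpleGraph V) (S : Finset V) (v : V) : Prop :=
  ∃ x ∈ S, ∃ y ∈ S, G.Adj v x ∧ G.Adj v y ∧ G.Adj x y

lemma triple_subset {a b c : V} (ha : a ∈ S) (hb : b ∈ S) (hc : c ∈ S) :
    ({a, b, c} : Finset V) ⊆ S := by
  intro x hx
  simp only [mem_insert, mem_singleton] at hx
  rcases hx with rfl | rfl | rfl <;> assumption

lemma quad_subset {a b c d : V} (ha : a ∈ S) (hb : b ∈ S) (hc : c ∈ S) (hd : d ∈ S) :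
    ({a, b, c, d} : Finset V) ⊆ S := by
  intro x hx
  simp only [mem_insert, mem_singleton] at hx
  rcases hx with rfl | rfl | rfl | rfl <;> assumption

lemma wt_two_le_sub {d : ℕ} (h : 2 ≤ d) : wt 2 d ≤ (d : ℤ) - 3 := by
  unfold wt; split_ifs <;> omega

lemma W_two_le_of_bowtie (hn : ¬ DC G 2 S) (hδ : ∀ u ∈ S, 2 ≤ dg G S u) {v a b l p : V}
    (hv : v ∈ S) (ha : a ∈ S) (hb : b ∈ S) (hl : l ∈ S) (hp : p ∈ S)
    (hva : G.Adj v a) (hvb : G.Adj v b) (hab : G.Adj a b)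
    (hlp : G.Adj l p) (hla : G.Adj l a) (hpa : G.Adj p a)
    (hvl : v ≠ l) (hvp : v ≠ p) (hbl : b ≠ l) (hbp : b ≠ p)
    (hdv : dg G S v ≤ 3) (hdl : dg G S l ≤ 3) : W G S 2 ≤ 3 := by
  set Z : Finset V := {v, a, b, l, p} with hZ
  set R := S \ Z with hR
  have hZS : Z ⊆ S := by
    intro x hx
    simp only [hZ, mem_insert, mem_singleton] at hx
    rcases hx with rfl | rfl | rfl | rfl | rfl <;> assumption
  have hnR : ∀ x ∈ Z, x ∉ R := fun x hx h => (mem_sdiff.1 h).2 hx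
  have hsub : ∀ {x y c d e : V}, x ∈ Z → y ∈ Z → x ≠ c → x ≠ d → x ≠ e → y ≠ c → y ≠ d → y ≠ e →
      c ∈ Z → d ∈ Z → e ∈ Z → insert x (insert y R) ⊆ S \ {c, d, e} := by
    intro x y c d e hx hy h1 h2 h3 h4 h5 h6 hc hd he u hu
    rw [mem_insert, mem_insert] at hu
    rw [mem_sdiff]
    rcases hu with rfl | rfl | hu
    · exact ⟨hZS hx, by simp [*]⟩
    · exact ⟨hZS hy, by simp [*]⟩
    · refine ⟨(mem_sdiff.1 hu).1, fun h => (mem_sdiff.1 hu).2 ?_⟩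
      simp only [mem_insert, mem_singleton] at h
      rcases h with rfl | rfl | rfl <;> assumption
  have key : ∀ {x y c d e : V}, x ∈ Z → y ∈ Z → x ≠ c → x ≠ d → x ≠ e → y ≠ c → y ≠ d → y ≠ e →
      c ∈ Z → d ∈ Z → e ∈ Z → G.Adj c d → G.Adj c e → G.Adj d e → G.Adj x y →
      ee G R R + 2 * dg G R x + 2 * dg G R y ≤ 2 * R.card := by
    intro x y c d e hx hy h1 h2 h3 h4 h5 h6 hc hd he hcd hce hde hxy
    have hac := (acyc_sdiff hn (triple_subset (hZS hc) (hZS hd) (hZS he))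
      (cyc_triangle hcd hce hde)).subset (hsub hx hy h1 h2 h3 h4 h5 h6 hc hd he)
    have hyR : y ∉ R := hnR y hy
    have hxR : x ∉ insert y R := by simp [hxy.ne, hnR x hx]
    have h7 := hac.ee_le (by simp)
    rw [ee_insert_self hxR, ee_insert_self hyR, dg_insert hyR, if_pos hxy,
      card_insert_of_notMem hxR, card_insert_of_notMem hyR] at h7
    omega
  have hvZ : v ∈ Z := by simp [hZ]
  have haZ : a ∈ Z := by simp [hZ]
  have hbZ : b ∈ Z := by simp [hZ]
  have hlZ : l ∈ Z := by simp [hZ]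
  have hpZ : p ∈ Z := by simp [hZ]
  have k1 := key hpZ hlZ hvp.symm hpa.ne hbp.symm hvl.symm hla.ne hbl.symm hvZ haZ hbZ
    hva hvb hab hlp.symm
  have k2 := key hvZ hbZ hvl hvp hva.ne hbl hbp hab.ne' hlZ hpZ haZ hlp hla hpa hvb
  have k3 := dg_le_card (G := G) R a
  have k4 := ee_sdiff (G := G) R hZS
  rw [sum_quint (fun z => dg G R z) hva.ne hvb.ne hvl hvp hab.ne hla.ne' hpa.ne' hbl hbp hlp.ne]
    at k4
  have k5 : ∑ u ∈ R, wt 2 (dg G S u) ≤ ∑ u ∈ R, ((dg G S u : ℤ) - 3) :=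
    sum_le_sum fun u hu => wt_two_le_sub (hδ u (mem_sdiff.1 hu).1)
  rw [sum_sub_distrib, ← Nat.cast_sum] at k5
  have k6 : W G S 2 = ∑ v ∈ R, wt 2 (dg G S v) + ∑ v ∈ Z, wt 2 (dg G S v) :=
    (sum_sdiff hZS).symm
  rw [sum_quint (fun z => wt 2 (dg G S z)) hva.ne hvb.ne hvl hvp hab.ne hla.ne' hpa.ne' hbl hbp
    hlp.ne] at k6
  have k7 : wt 2 (dg G S v) ≤ 0 := by unfold wt; split_ifs <;> omega
  have k8 : wt 2 (dg G S l) ≤ 0 := by unfold wt; split_ifs <;> omega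
  have k9 := wt_le_one 2 (dg G S a)
  have k10 := wt_le_one 2 (dg G S b)
  have k11 := wt_le_one 2 (dg G S p)
  have k12 : ∑ u ∈ R, dg G S u = ee G R S := rfl
  rw [k12] at k5
  simp only [sum_const, nsmul_eq_mul] at k5
  rw [← hR] at k4
  omega

set_option maxHeartbeats 800000 in
lemma W_two_le_of_forall_inTri (hn : ¬ DC G 2 S) (hδ : ∀ u ∈ S, 2 ≤ dg G S u)
    (hT : ∀ u ∈ S, dg G S u ≤ 3 → InTri G S u) {v a b : V}
    (hv : v ∈ S) (ha : a ∈ S) (hb : b ∈ S)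
    (hva : G.Adj v a) (hvb : G.Adj v b) (hab : G.Adj a b)
    (hdv : dg G S v ≤ 3) : W G S 2 ≤ 3 := by
  by_contra hW
  set F := S \ {v, a, b} with hFdef
  have hZS : ({v, a, b} : Finset V) ⊆ S := triple_subset hv ha hb
  have hF : Acyc G F := acyc_sdiff hn hZS (cyc_triangle hva hvb hab)
  have memF : ∀ {g}, g ∈ F ↔ g ∈ S ∧ g ≠ v ∧ g ≠ a ∧ g ≠ b := by
    intro g
    simp [hFdef]
  have degS : ∀ g, dg G S g = dg G F g + ((if G.Adj g v then 1 else 0) +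
      (if G.Adj g a then 1 else 0) + (if G.Adj g b then 1 else 0)) := by
    intro g
    rw [dg_sdiff hZS, dg_triple hva.ne hvb.ne hab.ne]
  have hdvF : dg G F v ≤ 1 := by
    have := degS v
    rw [if_pos hva, if_pos hvb] at this
    omega
  obtain ⟨c, hc⟩ : ∃ c, ∀ u ∈ F, G.Adj v u → u = c := by
    by_cases h : ∃ u ∈ F, G.Adj v u
    · obtain ⟨c, hcF, hvc⟩ := h
      exact ⟨c, fun u hu h => dg_le_one_iff.1 hdvF u hu c hcF h hvc⟩
    · exact ⟨v, fun u hu h' => absurd ⟨u, hu, h'⟩ h⟩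
  have triF : ∀ x ∈ F, ∀ y ∈ F, ∀ z ∈ F, G.Adj x y → G.Adj x z → ¬ G.Adj y z :=
    fun x hx y hy z hz h1 h2 h3 => hF _ (triple_subset hx hy hz) (cyc_triangle h1 h2 h3)
  have claim1 : ∀ g ∈ F, ∀ p ∈ F, G.Adj g p → dg G F g ≤ 1 → ¬ G.Adj v g →
      G.Adj g a ∧ G.Adj g b ∧ ¬ G.Adj p a ∧ ¬ G.Adj p b := by
    intro g hg p hp hgp hd hvg
    obtain ⟨hgS, hgv, hga, hgb⟩ := memF.1 hg
    obtain ⟨hpS, hpv, hpa, hpb⟩ := memF.1 hp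
    have hgv' : ¬ G.Adj g v := fun h => hvg h.symm
    have hdg : dg G S g ≤ 3 := by
      have := degS g
      rw [if_neg hgv'] at this
      split_ifs at this <;> omega
    have h1 : G.Adj g a → ¬ G.Adj p a := fun h h' => hW
      (W_two_le_of_bowtie hn hδ hv ha hb hgS hpS hva hvb hab hgp h h' hgv.symm hpv.symm
        hgb.symm hpb.symm hdv hdg)
    have h2 : G.Adj g b → ¬ G.Adj p b := fun h h' => hW
      (W_two_le_of_bowtie hn hδ hv hb ha hgS hpS hvb hva hab.symm hgp h h' hgv.symm hpv.symm
        hga.symm hpa.symm hdv hdg)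
    obtain ⟨x, hx, y, hy, hgx, hgy, hxy⟩ := hT g hgS hdg
    have hcase : ∀ w ∈ S, G.Adj g w → w = p ∨ w = a ∨ w = b := by
      intro w hw hgw
      by_cases hwF : w ∈ F
      · exact Or.inl (dg_le_one_iff.1 hd w hwF p hp hgw hgp)
      · rw [memF] at hwF
        have : w ≠ v := by rintro rfl; exact hgv' hgw
        tauto
    rcases hcase x hx hgx with rfl | rfl | rfl <;> rcases hcase y hy hgy with rfl | rfl | rfl <;>
      first
      | exact absurd hxy (G.irrefl)
      | exact absurd hxy (h1 hgy)
      | exact absurd hxy (h2 hgy)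
      | exact absurd hxy.symm (h1 hgx)
      | exact absurd hxy.symm (h2 hgx)
      | exact ⟨hgx, hgy, h1 hgx, h2 hgy⟩
      | exact ⟨hgy, hgx, h1 hgy, h2 hgx⟩
  set Fh := F.filter (fun u => 2 ≤ dg G F u) with hFh
  set Fl := F.filter (fun u => ¬ 2 ≤ dg G F u) with hFl
  have hsplit : ∀ p, dg G F p = dg G Fh p + dg G Fl p := by
    intro p
    rw [← dg_union (disjoint_filter_filter_not _ _ _), filter_union_filter_not_eq]
  have claim2 : ∀ p ∈ F, 2 ≤ dg G F p → dg G Fh p ≤ 1 →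
      (∃ l ∈ F, G.Adj p l ∧ dg G F l ≤ 1 ∧ ¬ G.Adj v l) →
      ∃ l ∈ Fl, ∃ l' ∈ Fl, l ≠ l' ∧ G.Adj p l ∧ G.Adj p l' ∧ ¬ G.Adj v l ∧ ¬ G.Adj v l' := by
    rintro p hp hd hdh ⟨l, hl, hpl, hdl, hvl⟩
    obtain ⟨hpS, hpv, hpa, hpb⟩ := memF.1 hp
    obtain ⟨-, -, hpa', hpb'⟩ := claim1 l hl p hp hpl.symm hdl hvl
    have h4 : 4 ≤ dg G S p := by
      by_contra h
      obtain ⟨x, hx, y, hy, hpx, hpy, hxy⟩ := hT p hpS (by omega)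
      have hcase : ∀ w ∈ S, G.Adj p w → w ∈ F ∨ w = v := by
        intro w hw hpw
        rw [memF]
        by_cases h1 : w = a
        · subst h1; exact absurd hpw hpa'
        by_cases h2 : w = b
        · subst h2; exact absurd hpw hpb'
        tauto
      have hbad : ∀ w ∈ F, G.Adj p v → G.Adj v w → ¬ G.Adj p w := by
        intro w hw h1 h2 h3
        rw [hc w hw h2, hc p hp h1.symm] at h3
        exact G.irrefl h3
      rcases hcase x hx hpx with h1 | rfl <;> rcases hcase y hy hpy with h2 | rfl
      · exact triF p hp x h1 y h2 hpx hpy hxy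
      · exact hbad x h1 hpy hxy.symm hpx
      · exact hbad y h2 hpx hxy hpy
      · exact G.irrefl hxy
    have h5 := degS p
    rw [if_neg hpa', if_neg hpb'] at h5
    have h6 := hsplit p
    have hFlF : ∀ {u}, u ∈ Fl → u ∈ F := fun hu => (mem_filter.1 hu).1
    by_cases hpv' : G.Adj p v
    · rw [if_pos hpv'] at h5
      obtain ⟨l, hl, l', hl', hne, h7, h8⟩ := two_le_dg_iff.1 (by omega : 2 ≤ dg G Fl p)
      have hpc := hc p hp hpv'.symm
      refine ⟨l, hl, l', hl', hne, h7, h8, fun h => ?_, fun h => ?_⟩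
      · exact h7.ne (hpc.trans (hc l (hFlF hl) h).symm)
      · exact h8.ne (hpc.trans (hc l' (hFlF hl') h).symm)
    · rw [if_neg hpv'] at h5
      obtain ⟨l, hl, hlc, h7⟩ := exists_adj_ne (a := c) (by omega : 2 ≤ dg G Fl p)
      obtain ⟨l', hl', hlc', hne, h8⟩ := exists_adj_ne_ne (a := c) (b := l)
        (by omega : 3 ≤ dg G Fl p)
      exact ⟨l, hl, l', hl', hne.symm, h7, h8, fun h => hlc (hc l (hFlF hl) h),
        fun h => hlc' (hc l' (hFlF hl') h)⟩
  have memFl : ∀ {u}, u ∈ Fl ↔ u ∈ F ∧ dg G F u ≤ 1 := by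
    intro u
    rw [hFl, mem_filter]
    constructor <;> rintro ⟨h1, h2⟩ <;> exact ⟨h1, by omega⟩
  have memFh : ∀ {u}, u ∈ Fh ↔ u ∈ F ∧ 2 ≤ dg G F u := by
    intro u
    rw [hFh, mem_filter]
  have square : ∀ {p l l' e}, p ∈ F → l ∈ Fl → l' ∈ Fl → l ≠ l' → G.Adj p l → G.Adj p l' →
      ¬ G.Adj v l → ¬ G.Adj v l' → (e = a ∨ e = b) → Cyc G {p, l, e, l'} := by
    intro p l l' e hp hl hl' hne h1 h2 h3 h4 he
    obtain ⟨hlF, hld⟩ := memFl.1 hl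
    obtain ⟨hlF', hld'⟩ := memFl.1 hl'
    obtain ⟨m1, m2, -, -⟩ := claim1 l hlF p hp h1.symm hld h3
    obtain ⟨m3, m4, -, -⟩ := claim1 l' hlF' p hp h2.symm hld' h4
    obtain ⟨-, -, n1, n2⟩ := memF.1 hp
    rcases he with rfl | rfl
    · exact cyc_square h1 m1 m3.symm h2.symm n1 hne
    · exact cyc_square h1 m2 m4.symm h2.symm n2 hne
  have leaf_unique : ∀ {l p q}, l ∈ Fl → p ∈ F → q ∈ F → G.Adj p l → G.Adj q l → p = q :=
    fun hl hp hq h1 h2 => dg_le_one_iff.1 (memFl.1 hl).2 _ hp _ hq h1.symm h2.symm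
  rcases Nat.lt_or_ge 1 Fh.card with hcard | hcard
  · have hFhac : Acyc G Fh := hF.subset (filter_subset _ _)
    obtain ⟨p1, hp1, hd1⟩ := hFhac.exists_dg_le_one (card_pos.1 (by omega))
    obtain ⟨p2, hp2, hp12, hd2⟩ := hFhac.exists_two hcard p1
    have good_or : ∀ p ∈ Fh, dg G Fh p ≤ 1 →
        (∃ l ∈ Fl, ∃ l' ∈ Fl, l ≠ l' ∧ G.Adj p l ∧ G.Adj p l' ∧ ¬ G.Adj v l ∧ ¬ G.Adj v l') ∨
        (∃ l ∈ Fl, G.Adj p l ∧ G.Adj v l) := by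
      intro p hp hd
      obtain ⟨hpF, hdF⟩ := memFh.1 hp
      have := hsplit p
      obtain ⟨l, hl, hpl⟩ := dg_pos_iff.1 (by omega : 1 ≤ dg G Fl p)
      by_cases hvl : G.Adj v l
      · exact Or.inr ⟨l, hl, hpl, hvl⟩
      · exact Or.inl (claim2 p hpF hdF hd ⟨l, (memFl.1 hl).1, hpl, (memFl.1 hl).2, hvl⟩)
    have hmix : ∀ {p q : V}, p ∈ Fh → q ∈ Fh → q ≠ p →
        (∃ l ∈ Fl, G.Adj p l ∧ G.Adj v l) →
        (∃ l ∈ Fl, ∃ l' ∈ Fl, l ≠ l' ∧ G.Adj q l ∧ G.Adj q l' ∧ ¬ G.Adj v l ∧ ¬ G.Adj v l') →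
        False := by
      rintro p q hp hq hqp ⟨d, hd, hpd, hvd⟩ ⟨l, hl, l', hl', hne, h1, h2, h3, h4⟩
      obtain ⟨hdF, hdd⟩ := memFl.1 hd
      obtain ⟨hlF, hld⟩ := memFl.1 hl
      obtain ⟨hlF', hld'⟩ := memFl.1 hl'
      obtain ⟨hpF, hpd'⟩ := memFh.1 hp
      obtain ⟨hqF, hqd'⟩ := memFh.1 hq
      have e1 := memF.1 hdF
      have e2 := memF.1 hlF
      have e3 := memF.1 hlF'
      have e4 := memF.1 hqF
      have dl : d ≠ l := by rintro rfl; exact h3 hvd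
      have dl' : d ≠ l' := by rintro rfl; exact h4 hvd
      have dq : d ≠ q := by rintro rfl; omega
      by_cases hda : G.Adj d a
      · refine hn (DC.two (cyc_triangle hva hvd hda.symm)
          (square hqF hl hl' hne h1 h2 h3 h4 (Or.inr rfl))
          (triple_subset hv ha e1.1) (quad_subset e4.1 e2.1 hb e3.1) ?_)
        have := hab.ne
        have := hvb.ne
        rw [disjoint_left]
        simp only [mem_insert, mem_singleton]
        grind
      by_cases hdb : G.Adj d b
      · refine hn (DC.two (cyc_triangle hvb hvd hdb.symm)
          (square hqF hl hl' hne h1 h2 h3 h4 (Or.inl rfl))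
          (triple_subset hv hb e1.1) (quad_subset e4.1 e2.1 ha e3.1) ?_)
        have := hab.ne
        have := hva.ne
        rw [disjoint_left]
        simp only [mem_insert, mem_singleton]
        grind
      have hdS : dg G S d ≤ 3 := by
        have := degS d
        rw [if_neg hda, if_neg hdb] at this
        split_ifs at this <;> omega
      obtain ⟨x, hx, y, hy, hdx, hdy, hxy⟩ := hT d e1.1 hdS
      have hcase : ∀ w ∈ S, G.Adj d w → w = p ∨ w = v := by
        intro w hw hdw
        by_cases hwF : w ∈ F
        · exact Or.inl (leaf_unique hd hwF hpF hdw.symm hpd)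
        · rw [memF] at hwF
          have h5 : w ≠ a := by rintro rfl; exact hda hdw
          have h6 : w ≠ b := by rintro rfl; exact hdb hdw
          tauto
      have hpv : ¬ G.Adj v p := by
        intro h
        have := hc p hpF h
        rw [← hc d hdF hvd] at this
        rw [this] at hpd
        exact G.irrefl hpd
      rcases hcase x hx hdx with rfl | rfl <;> rcases hcase y hy hdy with rfl | rfl
      · exact G.irrefl hxy
      · exact hpv hxy.symm
      · exact hpv hxy
      · exact G.irrefl hxy
    rcases good_or p1 hp1 hd1 with g1 | g1 <;> rcases good_or p2 hp2 hd2 with g2 | g2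
    · obtain ⟨l, hl, l', hl', hne, h1, h2, h3, h4⟩ := g1
      obtain ⟨m, hm, m', hm', hne', h1', h2', h3', h4'⟩ := g2
      have hp1F := (memFh.1 hp1)
      have hp2F := (memFh.1 hp2)
      have e1 := memF.1 (memFl.1 hl).1
      have e2 := memF.1 (memFl.1 hl').1
      have e3 := memF.1 (memFl.1 hm).1
      have e4 := memF.1 (memFl.1 hm').1
      have e5 := memF.1 hp1F.1
      have e6 := memF.1 hp2F.1
      have hdis : ∀ {x y}, x ∈ Fl → y ∈ Fl → G.Adj p1 x → G.Adj p2 y → x ≠ y := by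
        rintro x y hx hy hx1 hy1 rfl
        exact hp12 (leaf_unique hx hp2F.1 hp1F.1 hy1 hx1)
      have f1 := hdis hl hm h1 h1'
      have f2 := hdis hl hm' h1 h2'
      have f3 := hdis hl' hm h2 h1'
      have f4 := hdis hl' hm' h2 h2'
      have hlh : ∀ {x y}, x ∈ Fl → y ∈ Fh → x ≠ y := by
        rintro x y hx hy rfl
        have := (memFl.1 hx).2
        have := (memFh.1 hy).2
        omega
      have f5 := hlh hl hp2
      have f6 := hlh hl' hp2
      have f7 := hlh hm hp1
      have f8 := hlh hm' hp1
      refine hn (DC.two (square hp1F.1 hl hl' hne h1 h2 h3 h4 (Or.inl rfl))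
          (square hp2F.1 hm hm' hne' h1' h2' h3' h4' (Or.inr rfl))
          (quad_subset e5.1 e1.1 ha e2.1) (quad_subset e6.1 e3.1 hb e4.1) ?_)
      have := hab.ne
      rw [disjoint_left]
      simp only [mem_insert, mem_singleton]
      grind
    · exact hmix hp2 hp1 hp12.symm g2 g1
    · exact hmix hp1 hp2 hp12 g1 g2
    · obtain ⟨d, hd, h1, h2⟩ := g1
      obtain ⟨d', hd', h1', h2'⟩ := g2
      have : d = d' := (hc d (memFl.1 hd).1 h2).trans (hc d' (memFl.1 hd').1 h2').symm
      subst this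
      exact hp12 (leaf_unique hd (memFh.1 hp2).1 (memFh.1 hp1).1 h1' h1)
  · have hsum : W G S 2 = (∑ u ∈ Fh, wt 2 (dg G S u) + ∑ u ∈ Fl, wt 2 (dg G S u)) +
        (wt 2 (dg G S v) + wt 2 (dg G S a) + wt 2 (dg G S b)) := by
      rw [← sum_triple (fun u => wt 2 (dg G S u)) hva.ne hvb.ne hab.ne,
        sum_filter_add_sum_filter_not]
      exact (sum_sdiff hZS).symm
    have hwv : wt 2 (dg G S v) ≤ 0 := by unfold wt; split_ifs <;> omega
    have hwa := wt_le_one 2 (dg G S a)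
    have hwb := wt_le_one 2 (dg G S b)
    have hleaf : ∀ u ∈ Fl, ¬ G.Adj v u → wt 2 (dg G S u) ≤ 0 := by
      intro u hu h
      have h1 := degS u
      have h2 := (memFl.1 hu).2
      rw [if_neg (fun h' => h h'.symm)] at h1
      unfold wt
      split_ifs at h1 ⊢ <;> omega
    have hsl : ∑ u ∈ Fl, wt 2 (dg G S u) ≤ if c ∈ Fl ∧ G.Adj v c ∧ 4 ≤ dg G S c then 1 else 0 := by
      have h0 : ∀ u ∈ Fl, u ≠ c → wt 2 (dg G S u) ≤ 0 := fun u hu hne =>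
        hleaf u hu fun h => hne (hc u (memFl.1 hu).1 h)
      by_cases hcF : c ∈ Fl
      · rw [← add_sum_erase _ _ hcF]
        have h1 : ∑ u ∈ Fl.erase c, wt 2 (dg G S u) ≤ 0 :=
          sum_nonpos fun u hu => h0 u (mem_of_mem_erase hu) (ne_of_mem_erase hu)
        have h2 := wt_le_one 2 (dg G S c)
        split_ifs with h3
        · omega
        · have : wt 2 (dg G S c) ≤ 0 := by
            by_cases h4 : G.Adj v c
            · have : ¬ 4 ≤ dg G S c := fun h => h3 ⟨hcF, h4, h⟩
              unfold wt; split_ifs <;> omega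
            · exact hleaf c hcF h4
          omega
      · rw [if_neg (fun h => hcF h.1)]
        exact sum_nonpos fun u hu => h0 u hu (by rintro rfl; exact hcF hu)
    have hsh : ∑ u ∈ Fh, wt 2 (dg G S u) ≤ Fh.card := by
      have : ∑ u ∈ Fh, wt 2 (dg G S u) ≤ ∑ u ∈ Fh, (1 : ℤ) := sum_le_sum fun u _ => wt_le_one 2 _
      simpa using this
    split_ifs at hsl with h3
    swap
    · omega
    obtain ⟨hcl, hvc, hdc⟩ := h3
    obtain ⟨p, hp⟩ : Fh.Nonempty := card_pos.1 (by omega)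
    obtain ⟨hpF, hpd⟩ := memFh.1 hp
    have hd0 := dg_lt_card (G := G) hp
    have h4 := hsplit p
    have h5 : 2 ≤ dg G Fl p := by omega
    obtain ⟨l0, hl0, hl0c, hpl0⟩ := exists_adj_ne (a := c) h5
    have hvl0 : ¬ G.Adj v l0 := fun h => hl0c (hc l0 (memFl.1 hl0).1 h)
    obtain ⟨l, hl, l', hl', hne, h6, h7, h8, h9⟩ := claim2 p hpF hpd (by omega)
      ⟨l0, (memFl.1 hl0).1, hpl0, (memFl.1 hl0).2, hvl0⟩
    have hcb : G.Adj c b := by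
      by_contra h
      have h1 := degS c
      have h2 := (memFl.1 hcl).2
      rw [if_neg h] at h1
      split_ifs at h1 <;> omega
    have e1 := memF.1 (memFl.1 hl).1
    have e2 := memF.1 (memFl.1 hl').1
    have e3 := memF.1 (memFl.1 hcl).1
    have e4 := memF.1 hpF
    have f1 : c ≠ l := by rintro rfl; exact h8 hvc
    have f2 : c ≠ l' := by rintro rfl; exact h9 hvc
    have f3 : c ≠ p := by
      rintro rfl
      have := (memFl.1 hcl).2
      omega
    refine hn (DC.two (cyc_triangle hvb hvc hcb.symm)
        (square hpF hl hl' hne h6 h7 h8 h9 (Or.inl rfl))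
        (triple_subset hv hb e3.1) (quad_subset e4.1 e1.1 ha e2.1) ?_)
    have := hab.ne
    have := hva.ne
    rw [disjoint_left]
    simp only [mem_insert, mem_singleton]
    grind

lemma not_dc_con {x y : V} (hn : ¬ DC G k S) (hx : x ∈ S) (hxy : G.Adj x y) :
    ¬ DC (con G x y) k (S.erase x) := fun h => hn (h.of_con_erase hx hxy)

lemma adj_con {x y a b : V} (h : G.Adj a b) : (con G x y).Adj a b := ⟨h.ne, Or.inl h⟩

lemma no_common_of_not_inTri {x y : V} (h : ¬ InTri G S x) (hy : y ∈ S) (hxy : G.Adj x y) :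
    ∀ u ∈ S, G.Adj x u → ¬ G.Adj y u :=
  fun u hu h1 h2 => h ⟨y, hy, u, hu, hxy, h1, h2⟩

lemma W_con_ge {x y : V} (hx : x ∈ S) (hy : y ∈ S) (hxy : G.Adj x y)
    (hc : ∀ u ∈ S, G.Adj x u → ¬ G.Adj y u) (k : ℕ) (h2 : 2 ≤ dg G S x) :
    W G S k - wt k (dg G S x) ≤ W (con G x y) (S.erase x) k := by
  rw [W_con hx hy hxy hc]
  have := wt_mono (k := k) (show dg G S y ≤ dg G S x + dg G S y - 2 by omega)
  omega

lemma two_le_dg_con {x y : V} (hx : x ∈ S) (hy : y ∈ S) (hxy : G.Adj x y)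
    (hc : ∀ u ∈ S, G.Adj x u → ¬ G.Adj y u) {m : ℕ} (hm : ∀ u ∈ S, m ≤ dg G S u)
    (h2 : 2 ≤ dg G S x) : ∀ u ∈ S.erase x, m ≤ dg (con G x y) (S.erase x) u := by
  intro u hu
  by_cases huy : u = y
  · subst huy
    have := dg_con_self hx hy hxy hc
    have := hm u hy
    omega
  · rw [dg_con_of_ne hx hy hxy hc (mem_of_mem_erase hu) huy]
    exact hm u (mem_of_mem_erase hu)

lemma W_two_le_of_triangle (hn : ¬ DC G 2 S) (hδ : ∀ u ∈ S, 2 ≤ dg G S u) {v a b : V}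
    (hv : v ∈ S) (ha : a ∈ S) (hb : b ∈ S)
    (hva : G.Adj v a) (hvb : G.Adj v b) (hab : G.Adj a b)
    (hdv : dg G S v ≤ 3) : W G S 2 ≤ 3 := by
  induction hc : S.card generalizing G S with
  | zero => rw [card_eq_zero] at hc; subst hc; simp at hv
  | succ n ih =>
    by_cases hT : ∀ u ∈ S, dg G S u ≤ 3 → InTri G S u
    · exact W_two_le_of_forall_inTri hn hδ hT hv ha hb hva hvb hab hdv
    push Not at hT
    obtain ⟨t, ht, hdt, htri⟩ := hT
    have htv : t ≠ v := by rintro rfl; exact htri ⟨a, ha, b, hb, hva, hvb, hab⟩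
    have hta : t ≠ a := by rintro rfl; exact htri ⟨v, hv, b, hb, hva.symm, hab, hvb⟩
    have htb : t ≠ b := by rintro rfl; exact htri ⟨v, hv, a, ha, hvb.symm, hab.symm, hva⟩
    obtain ⟨u, hu, huv, htu⟩ := exists_adj_ne (a := v) (hδ t ht)
    have hcom := no_common_of_not_inTri htri hu htu
    have h1 := W_con_ge ht hu htu hcom 2 (hδ t ht)
    have h2 : wt 2 (dg G S t) ≤ 0 := by unfold wt; split_ifs <;> omega
    have h3 := ih (not_dc_con hn ht htu) (two_le_dg_con ht hu htu hcom hδ (hδ t ht))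
      (mem_erase.2 ⟨htv.symm, hv⟩) (mem_erase.2 ⟨hta.symm, ha⟩) (mem_erase.2 ⟨htb.symm, hb⟩)
      (adj_con hva) (adj_con hvb) (adj_con hab)
      (by rwa [dg_con_of_ne ht hu htu hcom hv huv.symm])
      (by rw [card_erase_of_mem ht]; omega)
    omega

lemma complete_of_three_le (hn : ¬ DC G 2 S) (hδ : ∀ u ∈ S, 3 ≤ dg G S u) (hW : 4 ≤ W G S 2) :
    S.card = 5 ∧ ∀ u ∈ S, ∀ w ∈ S, u ≠ w → G.Adj u w := by
  have hcard := W_le_card (G := G) (S := S) (k := 2)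
  induction hc : S.card generalizing G S with
  | zero => rw [hc] at hcard; simp at hcard; omega
  | succ n ih =>
    obtain ⟨s, hs⟩ : S.Nonempty := card_pos.1 (by omega)
    by_cases h3 : ∃ t ∈ S, dg G S t = 3
    · exfalso
      obtain ⟨t, ht, hdt⟩ := h3
      have htri : ¬ InTri G S t := by
        rintro ⟨a, ha, b, hb, h1, h2, h3⟩
        have := W_two_le_of_triangle hn (fun u hu => (by omega : 2 ≤ 3).trans (hδ u hu))
          ht ha hb h1 h2 h3 hdt.le
        omega
      obtain ⟨u, hu, htu⟩ := dg_pos_iff.1 (by omega : 1 ≤ dg G S t)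
      obtain ⟨w, hw, hwu, htw⟩ := exists_adj_ne (a := u) (by omega : 2 ≤ dg G S t)
      obtain ⟨z, hz, hzu, hzw, htz⟩ := exists_adj_ne_ne (a := u) (b := w)
        (by omega : 3 ≤ dg G S t)
      have hcom := no_common_of_not_inTri htri hu htu
      have h1 := W_con_ge ht hu htu hcom 2 (by omega)
      have h2 : wt 2 (dg G S t) = 0 := wt_eq_zero (by omega)
      have h4 := ih (not_dc_con hn ht htu) (two_le_dg_con ht hu htu hcom hδ (by omega))
        (by omega) W_le_card (by rw [card_erase_of_mem ht]; omega)
      have h5 := h4.2 w (mem_erase.2 ⟨htw.ne', hw⟩) z (mem_erase.2 ⟨htz.ne', hz⟩) hzw.symm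
      rw [con_adj_of_ne hwu hzu] at h5
      exact htri ⟨w, hw, z, hz, htw, htz, h5⟩
    have h4 : ∀ u ∈ S, 4 ≤ dg G S u := by
      intro u hu
      have := hδ u hu
      have : dg G S u ≠ 3 := fun h => h3 ⟨u, hu, h⟩
      omega
    by_cases htri : ∃ v ∈ S, InTri G S v
    swap
    · exfalso
      obtain ⟨u, hu, hsu⟩ := dg_pos_iff.1 ((by omega : 1 ≤ 4).trans (h4 s hs))
      have hcom := no_common_of_not_inTri (fun h => htri ⟨s, hs, h⟩) hu hsu
      have hds := h4 s hs
      have hdu := h4 u hu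
      have h5 := W_con hs hu hsu hcom 2
      have h6 : W G S 2 = S.card := by
        have : W G S 2 = ∑ v ∈ S, (1 : ℤ) := sum_congr rfl fun v hv => wt_eq_one (h4 v hv)
        simpa using this
      rw [wt_eq_one hds, wt_eq_one hdu, wt_eq_one (by omega)] at h5
      have h7 := dg_lt_card (G := G) hs
      obtain ⟨h8, -⟩ := ih (not_dc_con hn hs hsu) (two_le_dg_con hs hu hsu hcom hδ (by omega))
        (by omega) W_le_card (by rw [card_erase_of_mem hs]; omega)
      have h9 := dg_con_self hs hu hsu hcom
      have h10 := dg_lt_card (G := con G s u) (mem_erase.2 ⟨hsu.ne', hu⟩ : u ∈ S.erase s)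
      rw [card_erase_of_mem hs] at h10
      omega
    obtain ⟨a, ha, b, hb, c, hcS, hab, hac, hbc⟩ := htri
    set F := S \ {a, b, c} with hFdef
    have hZS : ({a, b, c} : Finset V) ⊆ S := triple_subset ha hb hcS
    have hF : Acyc G F := acyc_sdiff hn hZS (cyc_triangle hab hac hbc)
    have memF : ∀ {g}, g ∈ F ↔ g ∈ S ∧ g ≠ a ∧ g ≠ b ∧ g ≠ c := by
      intro g
      simp [hFdef]
    have degS : ∀ g, dg G S g = dg G F g + ((if G.Adj g a then 1 else 0) +
        (if G.Adj g b then 1 else 0) + (if G.Adj g c then 1 else 0)) := by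
      intro g
      rw [dg_sdiff hZS, dg_triple hab.ne hac.ne hbc.ne]
    have leaf : ∀ q ∈ F, dg G F q ≤ 1 →
        dg G F q = 1 ∧ G.Adj q a ∧ G.Adj q b ∧ G.Adj q c := by
      intro q hq hd
      have h1 := degS q
      have h2 := h4 q (memF.1 hq).1
      split_ifs at h1 <;> first | omega | exact ⟨by omega, by assumption, by assumption, by assumption⟩
    have hFcard : F.card + 3 = S.card := by
      have h1 := card_sdiff_add_card_eq_card hZS
      have h2 : ({a, b, c} : Finset V).card = 3 :=
        card_eq_three.2 ⟨a, b, c, hab.ne, hac.ne, hbc.ne, rfl⟩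
      rw [h2] at h1
      exact h1
    have h5 := dg_lt_card (G := G) hs
    have h6 := h4 s hs
    have hstep : ∀ q ∈ F, ∀ p ∈ F, dg G F q ≤ 1 → G.Adj q p → 2 ≤ dg G F p → False := by
      intro q hq p hp hdq hqp hdp
      have key : ∀ {a' b' c'}, a' ∈ S → b' ∈ S → c' ∈ S → a' ∉ F → b' ∉ F → c' ∉ F →
          a' ≠ b' → a' ≠ c' → G.Adj q b' → G.Adj q c' → G.Adj b' c' →
          (∀ g ∈ F, dg G F g ≤ 1 → G.Adj g a') → (3 ≤ dg G F p ∨ G.Adj p a') → False := by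
        intro a' b' c' ha' hb' hc' haF hbF hcF hab' hac' hqb hqc hbc' hl hpa
        set R := F.erase q with hR
        have haR : a' ∉ R := fun h => haF (mem_of_mem_erase h)
        have hRF : R ⊆ F := erase_subset _ _
        have hRdeg : ∀ g ∈ R, dg G R g ≤ 1 → 1 ≤ dg G R g ∧ G.Adj g a' := by
          intro g hg hd
          have h1 := dg_erase (G := G) hq g
          rw [← hR] at h1
          by_cases hgp : g = p
          · subst hgp
            rw [if_pos hqp.symm] at h1
            refine ⟨by omega, hpa.resolve_left (by omega)⟩
          · have h2 : ¬ G.Adj g q := fun h =>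
              hgp (dg_le_one_iff.1 hdq g (hRF hg) p hp h.symm hqp)
            rw [if_neg h2] at h1
            have h3 := leaf g (hRF hg) (by omega)
            exact ⟨by omega, hl g (hRF hg) (by omega)⟩
        have hpR : p ∈ R := mem_erase.2 ⟨hqp.ne', hp⟩
        obtain ⟨r, hr, hrq, hpr⟩ := exists_adj_ne (a := q) hdp
        have hRc : 1 < R.card :=
          one_lt_card.2 ⟨p, hpR, r, mem_erase.2 ⟨hrq, hr⟩, hpr.ne⟩
        have hRac : Acyc G R := hF.subset hRF
        obtain ⟨g1, hg1, hd1⟩ := hRac.exists_dg_le_one ⟨p, hpR⟩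
        obtain ⟨g2, hg2, hne, hd2⟩ := hRac.exists_two hRc g1
        have hcyc : Cyc G (insert a' R) := by
          refine ⟨by simp, fun g hg => ?_⟩
          rw [dg_insert haR]
          rcases mem_insert.1 hg with rfl | hg
          · have := two_le_dg_iff.2 ⟨g1, hg1, g2, hg2, hne.symm, (hRdeg g1 hg1 hd1).2.symm,
              (hRdeg g2 hg2 hd2).2.symm⟩
            omega
          · by_cases hd : dg G R g ≤ 1
            · obtain ⟨h1, h2⟩ := hRdeg g hg hd
              rw [if_pos h2]; omega
            · omega
        refine hn (DC.two hcyc (cyc_triangle hqb hqc hbc')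
          (insert_subset ha' (hRF.trans sdiff_subset))
          (triple_subset (memF.1 hq).1 hb' hc') ?_)
        rw [disjoint_right]
        intro x hx
        simp only [mem_insert, mem_singleton] at hx
        rw [mem_insert]
        rcases hx with rfl | rfl | rfl
        · rintro (rfl | h)
          · exact haF hq
          · exact notMem_erase _ _ h
        · rintro (rfl | h)
          · exact hab' rfl
          · exact hbF (hRF h)
        · rintro (rfl | h)
          · exact hac' rfl
          · exact hcF (hRF h)
      obtain ⟨-, hqa, hqb, hqc⟩ := leaf q hq hdq
      have haF : a ∉ F := fun h => (memF.1 h).2.1 rfl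
      have hbF : b ∉ F := fun h => (memF.1 h).2.2.1 rfl
      have hcF : c ∉ F := fun h => (memF.1 h).2.2.2 rfl
      have h1 := degS p
      have h2 := h4 p (memF.1 hp).1
      by_cases hpa : 3 ≤ dg G F p ∨ G.Adj p a
      · exact key ha hb hcS haF hbF hcF hab.ne hac.ne hqb hqc hbc
          (fun g hg hd => (leaf g hg hd).2.1) hpa
      · push Not at hpa
        rw [if_neg hpa.2] at h1
        have hpb : G.Adj p b := by
          by_contra h
          rw [if_neg h] at h1
          split_ifs at h1 <;> omega
        exact key hb ha hcS hbF haF hcF hab.ne' hbc.ne hqa hqc hac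
          (fun g hg hd => (leaf g hg hd).2.2.1) (Or.inr hpb)
    have hpair : ∀ q ∈ F, dg G F q ≤ 1 → ∃ p ∈ F, dg G F p ≤ 1 ∧ G.Adj q p := by
      intro q hq hd
      obtain ⟨p, hp, hqp⟩ := dg_pos_iff.1 (leaf q hq hd).1.ge
      refine ⟨p, hp, ?_, hqp⟩
      by_contra h
      exact hstep q hq p hp hd hqp (by omega)
    obtain ⟨q, hq, hdq⟩ := hF.exists_dg_le_one (card_pos.1 (by omega))
    obtain ⟨p, hp, hdp, hqp⟩ := hpair q hq hdq
    obtain ⟨-, hqa, hqb, hqc⟩ := leaf q hq hdq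
    obtain ⟨-, hpa, hpb, hpc⟩ := leaf p hp hdp
    have hFqp : F ⊆ {q, p} := by
      by_contra hcon
      rw [← sdiff_nonempty] at hcon
      obtain ⟨r, hr, hdr⟩ := (hF.subset (sdiff_subset (t := {q, p}))).exists_dg_le_one hcon
      rw [mem_sdiff, mem_insert, mem_singleton] at hr
      push Not at hr
      obtain ⟨hrF, hrq, hrp⟩ := hr
      have hnr : ∀ {x y z}, x ∈ F → y ∈ F → z ∈ F → G.Adj x y → dg G F x ≤ 1 → z ≠ y →
          ¬ G.Adj x z :=
        fun hx hy hz hxy hd hne h => hne (dg_le_one_iff.1 hd _ hz _ hy h hxy)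
      have h1 : ¬ G.Adj q r := hnr hq hp hrF hqp hdq hrp
      have h2 : ¬ G.Adj p r := hnr hp hq hrF hqp.symm hdp hrq
      have hdr' : dg G F r ≤ 1 := by
        have h7 := dg_sdiff (G := G) (show ({q, p} : Finset V) ⊆ F by
          intro x hx
          simp only [mem_insert, mem_singleton] at hx
          rcases hx with rfl | rfl <;> assumption) r
        have h8 : dg G {q, p} r = 0 := by
          rw [dg_zero_iff]
          intro u hu
          simp only [mem_insert, mem_singleton] at hu
          rcases hu with rfl | rfl
          · exact fun h => h1 h.symm
          · exact fun h => h2 h.symm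
        omega
      obtain ⟨w, hw, hdw, hrw⟩ := hpair r hrF hdr'
      obtain ⟨-, hra, -, -⟩ := leaf r hrF hdr'
      obtain ⟨-, hwa, -, -⟩ := leaf w hw hdw
      have hwq : w ≠ q := by rintro rfl; exact h1 hrw.symm
      have e1 := memF.1 hrF
      have e2 := memF.1 hw
      have e3 := memF.1 hq
      refine hn (DC.two (cyc_triangle hrw hra hwa) (cyc_triangle hqb hqc hbc)
        (triple_subset e1.1 e2.1 ha) (triple_subset e3.1 hb hcS) ?_)
      rw [disjoint_left]
      have := hab.ne
      have := hac.ne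
      simp only [mem_insert, mem_singleton]
      grind
    have hFc : F.card ≤ 2 := (card_le_card hFqp).trans card_le_two
    refine ⟨by omega, fun u hu w hw hne => ?_⟩
    have hmem : ∀ x ∈ S, x = q ∨ x = p ∨ x = a ∨ x = b ∨ x = c := by
      intro x hx
      by_cases hxF : x ∈ F
      · have := hFqp hxF
        simp only [mem_insert, mem_singleton] at this
        tauto
      · rw [memF] at hxF
        tauto
    have s1 := hqp.symm
    have s2 := hqa.symm
    have s3 := hqb.symm
    have s4 := hqc.symm
    have s5 := hpa.symm
    have s6 := hpb.symm
    have s7 := hpc.symm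
    have s8 := hab.symm
    have s9 := hac.symm
    have s10 := hbc.symm
    rcases hmem u hu with rfl | rfl | rfl | rfl | rfl <;>
      rcases hmem w hw with rfl | rfl | rfl | rfl | rfl <;>
      first | exact absurd rfl hne | assumption

/-- `S` contains a complete graph on five vertices. -/
def HasKFive (G : SimpleGraph V) (S : Finset V) : Prop :=
  ∃ K ⊆ S, K.card = 5 ∧ ∀ x ∈ K, ∀ y ∈ K, x ≠ y → G.Adj x y

/-- `S` contains a complete graph on five vertices with at most one edge `p q` missing, together
with a further common neighbour of `p` and `q`. -/
def HasSubdividedKFive (G : SimpleGraph V) (S : Finset V) : Prop :=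
  ∃ K ⊆ S, K.card = 5 ∧ ∃ p ∈ K, ∃ q ∈ K, p ≠ q ∧ (∃ u ∈ S, u ∉ K ∧ G.Adj u p ∧ G.Adj u q) ∧
    ∀ x ∈ K, ∀ y ∈ K, x ≠ y → ¬ (x = p ∧ y = q) → ¬ (x = q ∧ y = p) → G.Adj x y

lemma HasKFive.mono (hST : S ⊆ T) : HasKFive G S → HasKFive G T := by
  rintro ⟨K, hK, h⟩
  exact ⟨K, hK.trans hST, h⟩

lemma HasSubdividedKFive.mono (hST : S ⊆ T) : HasSubdividedKFive G S → HasSubdividedKFive G T := by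
  rintro ⟨K, hK, h1, p, hp, q, hq, h2, ⟨u, hu, h3⟩, h4⟩
  exact ⟨K, hK.trans hST, h1, p, hp, q, hq, h2, ⟨u, hST hu, h3⟩, h4⟩

lemma structure_of_not_dc_two (hn : ¬ DC G 2 S) (hW : 4 ≤ W G S 2) :
    (HasKFive G S ∨ HasSubdividedKFive G S) ∧ (5 ≤ W G S 2 → HasKFive G S) ∧ W G S 2 ≤ 5 := by
  induction hc : S.card generalizing G S with
  | zero =>
    have := W_le_card (G := G) (S := S) (k := 2)
    omega
  | succ n ih =>
    have herase : ∀ v ∈ S, W G S 2 ≤ W G (S.erase v) 2 →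
        (HasKFive G S ∨ HasSubdividedKFive G S) ∧ (5 ≤ W G S 2 → HasKFive G S) ∧
          W G S 2 ≤ 5 := by
      intro v hv hle
      obtain ⟨h1, h2, h3⟩ := ih (fun h => hn (h.mono (erase_subset v S))) (by omega)
        (by rw [card_erase_of_mem hv]; omega)
      exact ⟨h1.imp (HasKFive.mono (erase_subset v S)) (HasSubdividedKFive.mono (erase_subset v S)),
        fun h => (h2 (by omega)).mono (erase_subset v S), by omega⟩
    by_cases h0 : ∃ v ∈ S, dg G S v = 0
    · obtain ⟨v, hv, h⟩ := h0
      exact herase v hv (by rw [W_erase_of_dg_zero hv h (by omega)]; omega)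
    by_cases h1 : ∃ v ∈ S, dg G S v = 1
    · obtain ⟨v, hv, h⟩ := h1
      obtain ⟨y, hy, hvy⟩ := dg_pos_iff.1 h.ge
      refine herase v hv ?_
      rw [W_erase_of_dg_one hv h (by omega) hy hvy]
      have : wt 2 (dg G S y) ≤ wt 2 (dg G S y - 1) + 1 := by
        unfold wt; split_ifs <;> omega
      omega
    have hδ : ∀ u ∈ S, 2 ≤ dg G S u := by
      intro u hu
      have h2 : dg G S u ≠ 0 := fun h => h0 ⟨u, hu, h⟩
      have h3 : dg G S u ≠ 1 := fun h => h1 ⟨u, hu, h⟩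
      omega
    by_cases h2 : ∃ v ∈ S, dg G S v = 2
    · obtain ⟨t, ht, hdt⟩ := h2
      have htri : ¬ InTri G S t := by
        rintro ⟨a, ha, b, hb, h1, h2, h3⟩
        have := W_two_le_of_triangle hn hδ ht ha hb h1 h2 h3 (by omega)
        omega
      obtain ⟨u, hu, htu⟩ := dg_pos_iff.1 (by omega : 1 ≤ dg G S t)
      have hcom := no_common_of_not_inTri htri hu htu
      have h1 := W_con ht hu htu hcom 2
      rw [hdt, wt_eq_neg (by omega : 2 + 2 ≤ 2 * 2), show 2 + dg G S u - 2 = dg G S u by omega]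
        at h1
      obtain ⟨-, h3, h4⟩ := ih (not_dc_con hn ht htu) (by omega)
        (by rw [card_erase_of_mem ht]; omega)
      obtain ⟨K, hK, hK5, hKadj⟩ := h3 (by omega)
      have hKS : K ⊆ S := hK.trans (erase_subset _ _)
      have htK : t ∉ K := fun h => notMem_erase _ _ (hK h)
      refine ⟨?_, by omega, by omega⟩
      have hnb : ∀ x y, x ∈ K → y ∈ K → (con G t u).Adj x y → ¬ G.Adj x y →
          (x = u ∧ G.Adj t y) ∨ (y = u ∧ G.Adj t x) := by
        rintro x y - - ⟨-, h⟩ h'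
        tauto
      by_cases hall : ∀ x ∈ K, ∀ y ∈ K, x ≠ y → G.Adj x y
      · exact Or.inl ⟨K, hKS, hK5, hall⟩
      right
      push Not at hall
      obtain ⟨x, hx, y, hy, hxy, hnxy⟩ := hall
      have hw : ∃ w ∈ K, u ∈ K ∧ w ≠ u ∧ G.Adj t w := by
        rcases hnb x y hx hy (hKadj x hx y hy hxy) hnxy with ⟨rfl, h⟩ | ⟨rfl, h⟩
        · exact ⟨y, hy, hx, hxy.symm, h⟩
        · exact ⟨x, hx, hy, hxy, h⟩
      obtain ⟨w, hwK, huK, hwu, htw⟩ := hw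
      refine ⟨K, hKS, hK5, u, huK, w, hwK, hwu.symm, ⟨t, ht, htK, htu, htw⟩, ?_⟩
      have huniq : ∀ z ∈ S, G.Adj t z → z ≠ u → z = w := by
        intro z hz htz hzu
        by_contra hne
        have h5 := dg_erase (G := G) hu t
        rw [if_pos htu] at h5
        exact hne (dg_le_one_iff.1 (by omega : dg G (S.erase u) t ≤ 1) z (mem_erase.2 ⟨hzu, hz⟩)
          w (mem_erase.2 ⟨hwu, hKS hwK⟩) htz htw)
      intro x hx y hy hxy h5 h6
      by_contra hn'
      rcases hnb x y hx hy (hKadj x hx y hy hxy) hn' with ⟨rfl, h⟩ | ⟨rfl, h⟩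
      · exact h5 ⟨rfl, huniq y (hKS hy) h hxy.symm⟩
      · exact h6 ⟨huniq x (hKS hx) h hxy, rfl⟩
    · have hδ' : ∀ u ∈ S, 3 ≤ dg G S u := by
        intro u hu
        have h3 := hδ u hu
        have h4 : dg G S u ≠ 2 := fun h => h2 ⟨u, hu, h⟩
        omega
      obtain ⟨h3, h4⟩ := complete_of_three_le hn hδ' hW
      have h5 : HasKFive G S := ⟨S, Subset.rfl, h3, h4⟩
      have h6 := W_le_card (G := G) (S := S) (k := 2)
      exact ⟨Or.inl h5, fun _ => h5, by omega⟩

/-- `a b c` is a triangle inside `S`. -/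
def Tri (G : SimpleGraph V) (S : Finset V) (a b c : V) : Prop :=
  a ∈ S ∧ b ∈ S ∧ c ∈ S ∧ G.Adj a b ∧ G.Adj a c ∧ G.Adj b c

/-- There is no triangle inside `S`. -/
def TF (G : SimpleGraph V) (S : Finset V) : Prop := ∀ a b c, ¬ Tri G S a b c

/-- Every triangle inside `S` contains `c`. -/
def Star (G : SimpleGraph V) (S : Finset V) (c : V) : Prop :=
  ∀ x y z, Tri G S x y z → x = c ∨ y = c ∨ z = c

/-- Any two triangles inside `S` intersect. -/
def NT (G : SimpleGraph V) (S : Finset V) : Prop :=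
  ∀ a b c d e f, Tri G S a b c → Tri G S d e f →
    a = d ∨ a = e ∨ a = f ∨ b = d ∨ b = e ∨ b = f ∨ c = d ∨ c = e ∨ c = f

/-- The weight bound yields `k` cycles in sets whose triangles share a vertex. -/
def StarBound (V : Type*) (k : ℕ) : Prop :=
  ∀ (G : SimpleGraph V) (S : Finset V) (c : V), Star G S c → 2 * (k : ℤ) ≤ W G S k → DC G k S

/-- The weight bound yields `k` cycles in sets without disjoint triangles. -/
def NTBound (V : Type*) (k : ℕ) : Prop :=
  ∀ (G : SimpleGraph V) (S : Finset V), NT G S → 2 * (k : ℤ) ≤ W G S k → DC G k S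

lemma Tri.mono {a b c : V} (h : S ⊆ T) (ht : Tri G S a b c) : Tri G T a b c :=
  ⟨h ht.1, h ht.2.1, h ht.2.2.1, ht.2.2.2⟩

lemma Tri.cyc {a b c : V} (h : Tri G S a b c) : Cyc G {a, b, c} :=
  cyc_triangle h.2.2.2.1 h.2.2.2.2.1 h.2.2.2.2.2

lemma Tri.subset {a b c : V} (h : Tri G S a b c) : {a, b, c} ⊆ S :=
  triple_subset h.1 h.2.1 h.2.2.1

lemma TF.mono (h : S ⊆ T) (ht : TF G T) : TF G S := fun a b c hs => ht a b c (hs.mono h)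

lemma NT.mono (h : S ⊆ T) (ht : NT G T) : NT G S :=
  fun a b c d e f h1 h2 => ht a b c d e f (h1.mono h) (h2.mono h)

lemma TF.star (h : TF G S) (c : V) : Star G S c := fun x y z ht => absurd ht (h x y z)

lemma Star.nt {c : V} (h : Star G S c) : NT G S := by
  intro a b d e f g h1 h2
  have := h a b d h1
  have := h e f g h2
  grind

lemma NTBound.starBound (h : NTBound V k) : StarBound V k := fun G S _ hs => h G S hs.nt

lemma NT.tf_sdiff (h : NT G S) {a b c : V} (ht : Tri G S a b c) (hZ : {a, b, c} ⊆ Z) :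
    TF G (S \ Z) := by
  intro x y z hx
  have h1 := h a b c x y z ht (hx.mono sdiff_subset)
  have h2 : ∀ u ∈ S \ Z, u ≠ a ∧ u ≠ b ∧ u ≠ c := by
    intro u hu
    refine ⟨?_, ?_, ?_⟩ <;> rintro rfl <;> exact (mem_sdiff.1 hu).2 (hZ (by simp))
  have h3 := h2 x hx.1
  have h4 := h2 y hx.2.1
  have h5 := h2 z hx.2.2.1
  grind

lemma TF.star_con (h : TF G S) (x y : V) : Star (con G x y) (S.erase x) y := by
  intro a b c ⟨ha, hb, hc, h1, h2, h3⟩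
  by_contra hn
  push Not at hn
  rw [con_adj_of_ne hn.1 hn.2.1] at h1
  rw [con_adj_of_ne hn.1 hn.2.2] at h2
  rw [con_adj_of_ne hn.2.1 hn.2.2] at h3
  exact h a b c ⟨mem_of_mem_erase ha, mem_of_mem_erase hb, mem_of_mem_erase hc, h1, h2, h3⟩

lemma TF.no_common (h : TF G S) {x y : V} (hx : x ∈ S) (hy : y ∈ S) (hxy : G.Adj x y) :
    ∀ u ∈ S, G.Adj x u → ¬ G.Adj y u :=
  fun u hu h1 h2 => h x y u ⟨hx, hy, hu, hxy, h1, h2⟩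

lemma exists_triangle_of_complete {K : Finset V} (hc : 3 ≤ K.card)
    (hK : ∀ x ∈ K, ∀ y ∈ K, x ≠ y → G.Adj x y) : ∃ a b c, Tri G K a b c := by
  obtain ⟨a, b, c, ha, hb, hcK, h1, h2, h3⟩ := two_lt_card_iff.1 (by omega : 2 < K.card)
  exact ⟨a, b, c, ha, hb, hcK, hK a ha b hb h1, hK a ha c hcK h2, hK b hb c hcK h3⟩

lemma starBound_two : StarBound V 2 := by
  intro G S c hs hW
  by_contra hn
  have key : ∀ K ⊆ S, 3 ≤ K.card → (∀ x ∈ K, ∀ y ∈ K, x ≠ y → G.Adj x y) → c ∉ K → False := by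
    intro K hK h3 hadj hcK
    obtain ⟨x, y, z, ht⟩ := exists_triangle_of_complete h3 hadj
    rcases hs x y z (ht.mono hK) with rfl | rfl | rfl
    · exact hcK ht.1
    · exact hcK ht.2.1
    · exact hcK ht.2.2.1
  obtain ⟨K, hK, h5, p, hadj⟩ : ∃ K ⊆ S, K.card = 5 ∧ ∃ p, ∀ x ∈ K, ∀ y ∈ K, x ≠ y → x ≠ p →
      y ≠ p → G.Adj x y := by
    rcases (structure_of_not_dc_two hn (by exact_mod_cast hW)).1 with
      ⟨K, hK, h5, h⟩ | ⟨K, hK, h5, p, -, q, -, -, -, h⟩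
    · exact ⟨K, hK, h5, c, fun x hx y hy hne _ _ => h x hx y hy hne⟩
    · exact ⟨K, hK, h5, p, fun x hx y hy hne h1 h2 => h x hx y hy hne (fun h => h1 h.1)
        (fun h => h2 h.2)⟩
  refine key ((K.erase c).erase p) ((erase_subset _ _).trans ((erase_subset _ _).trans hK)) ?_ ?_ ?_
  · have h1 := pred_card_le_card_erase (s := K) (a := c)
    have h2 := pred_card_le_card_erase (s := K.erase c) (a := p)
    omega
  · intro x hx y hy hne
    simp only [mem_erase] at hx hy
    exact hadj x hx.2.2 y hy.2.2 hne hx.1 hy.1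
  · simp

lemma StarBound.of_tf (hA : StarBound V k) (h : TF G S) (hW : 2 * (k : ℤ) ≤ W G S k) :
    DC G k S := by
  rcases S.eq_empty_or_nonempty with rfl | ⟨c, -⟩
  · have : k = 0 := by
      have : W G ∅ k = 0 := rfl
      omega
    subst this
    trivial
  · exact hA G S c (h.star c) hW

lemma StarBound.of_two_mul_le (hA : StarBound V k) (h : TF G S) (hne : S.Nonempty)
    (hd : ∀ u ∈ S, 2 * k ≤ dg G S u) : DC G k S := by
  refine hA.of_tf h ?_
  have h1 : W G S k = S.card := by
    have : W G S k = ∑ v ∈ S, (1 : ℤ) := sum_congr rfl fun v hv => wt_eq_one (hd v hv)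
    simpa using this
  obtain ⟨s, hs⟩ := hne
  have h2 := dg_lt_card (G := G) hs
  have h3 := hd s hs
  omega

lemma StarBound.of_low (hA : StarBound V k) (hk : 2 ≤ k) (h : TF G S)
    (hW : 2 * (k : ℤ) - 1 ≤ W G S k) {v : V} (hv : v ∈ S) (hd : dg G S v + 2 ≤ 2 * k)
    (hd1 : dg G S v ≠ 1) : DC G k S := by
  by_cases h0 : dg G S v = 0
  · refine (hA.of_tf (h.mono (erase_subset v S)) ?_).mono (erase_subset v S)
    rw [W_erase_of_dg_zero hv h0 (by omega)]
    omega
  · obtain ⟨u, hu, hvu⟩ := dg_pos_iff.1 (by omega : 1 ≤ dg G S v)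
    refine DC.of_con_erase hv hvu (hA _ _ u (h.star_con v u) ?_)
    have h1 := W_con_ge hv hu hvu (h.no_common hv hu hvu) k (by omega)
    rw [wt_eq_neg hd] at h1
    omega

lemma StarBound.of_leaf (hA : StarBound V k) (hk : 2 ≤ k) (h : TF G S)
    (hW : 2 * (k : ℤ) - 1 ≤ W G S k) {v y : V} (hv : v ∈ S) (hd : dg G S v = 1) (hy : y ∈ S)
    (hvy : G.Adj v y) (hdy : 2 * k + 1 ≤ dg G S y ∨ dg G S y + 2 ≤ 2 * k) : DC G k S := by
  refine (hA.of_tf (h.mono (erase_subset v S)) ?_).mono (erase_subset v S)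
  rw [W_erase_of_dg_one hv hd hk hy hvy]
  have : wt k (dg G S y - 1) = wt k (dg G S y) := by
    rcases hdy with h | h
    · rw [wt_eq_one (by omega), wt_eq_one (by omega)]
    · rw [wt_eq_neg (by omega), wt_eq_neg (by omega)]
  omega

lemma StarBound.of_adj (hA : StarBound V k) (hk : 2 ≤ k) (h : TF G S)
    (hW : 2 * (k : ℤ) - 1 ≤ W G S k) {x y : V} (hx : x ∈ S) (hy : y ∈ S) (hxy : G.Adj x y)
    (hdx : dg G S x + 1 = 2 * k) (hdy : dg G S y + 1 = 2 * k) : DC G k S := by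
  refine DC.of_con_erase hx hxy (hA _ _ y (h.star_con x y) ?_)
  rw [W_con hx hy hxy (h.no_common hx hy hxy) k, wt_eq_zero hdx, wt_eq_zero hdy,
    wt_eq_one (by omega)]
  omega

lemma wt_succ_le {d d' : ℕ} (h : d ≤ d' + 2) : wt (k + 1) d ≤ wt k d' := by
  unfold wt; split_ifs <;> omega

lemma wt_succ_le_add_one {d d' : ℕ} (h : d ≤ d' + 3) : wt (k + 1) d ≤ wt k d' + 1 := by
  unfold wt; split_ifs <;> omega

lemma wt_add_two_le {d d' : ℕ} (h : d ≤ d' + 4) : wt (k + 2) d ≤ wt k d' := by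
  unfold wt; split_ifs <;> omega

/-- Removing a triangle: only common neighbours of its vertices lose weight. -/
lemma W_sdiff_tri_ge {a b c : V} (ht : Tri G S a b c) (N : Finset V) (hN : N ⊆ S \ {a, b, c})
    (hgain : ∀ g ∈ N, ¬ (G.Adj g a ∧ G.Adj g b ∧ G.Adj g c) ∧
      wt (k + 1) (dg G S g) + 1 ≤ wt k (dg G (S \ {a, b, c}) g)) :
    W G S (k + 1) - (wt (k + 1) (dg G S a) + wt (k + 1) (dg G S b) + wt (k + 1) (dg G S c))
      - ((S \ {a, b, c}).filter fun g => G.Adj g a ∧ G.Adj g b ∧ G.Adj g c).card + N.card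
      ≤ W G (S \ {a, b, c}) k := by
  have hZS := ht.subset
  obtain ⟨-, -, -, hab, hac, hbc⟩ := ht
  have h1 := W_sdiff_ge (G := G) (k := k + 1) (k' := k) hZS
    (fun g => (if G.Adj g a ∧ G.Adj g b ∧ G.Adj g c then 1 else 0) - (if g ∈ N then 1 else 0)) (by
      intro g hg
      have h2 := dg_sdiff (G := G) hZS g
      rw [dg_triple hab.ne hac.ne hbc.ne] at h2
      by_cases hgN : g ∈ N
      · obtain ⟨h3, h4⟩ := hgain g hgN
        rw [if_neg h3, if_pos hgN]
        omega
      · rw [if_neg hgN]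
        by_cases h5 : G.Adj g a ∧ G.Adj g b ∧ G.Adj g c
        · rw [if_pos h5]
          have := wt_succ_le_add_one (k := k) (d := dg G S g) (d' := dg G (S \ {a, b, c}) g)
            (by split_ifs at h2 <;> omega)
          omega
        · rw [if_neg h5]
          have := wt_succ_le (k := k) (d := dg G S g) (d' := dg G (S \ {a, b, c}) g)
            (by split_ifs at h2 <;> first | omega | exact absurd ⟨by assumption, by assumption, by assumption⟩ h5)
          omega)
  rw [sum_triple (fun g => wt (k + 1) (dg G S g)) hab.ne hac.ne hbc.ne, sum_sub_distrib] at h1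
  have h2 : ∑ g ∈ S \ {a, b, c}, (if G.Adj g a ∧ G.Adj g b ∧ G.Adj g c then (1 : ℤ) else 0) =
      ((S \ {a, b, c}).filter fun g => G.Adj g a ∧ G.Adj g b ∧ G.Adj g c).card := by
    rw [card_filter]; push_cast; rfl
  have h3 : ∑ g ∈ S \ {a, b, c}, (if g ∈ N then (1 : ℤ) else 0) = N.card := by
    rw [sum_ite_mem, inter_eq_right.2 hN]
    simp
  omega

lemma DC.of_tri {a b c : V} (ht : Tri G S a b c) (h : DC G k (S \ {a, b, c})) :
    DC G (k + 1) S := DC.succ ht.cyc ht.subset h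

/-- Removing a triangle of total cost two. -/
lemma StarBound.of_tri (hA : StarBound V k) (hNT : NT G S)
    (hW : 2 * ((k : ℤ) + 1) ≤ W G S (k + 1)) {a b c : V} (ht : Tri G S a b c)
    (hcost : wt (k + 1) (dg G S a) + wt (k + 1) (dg G S b) + wt (k + 1) (dg G S c) +
      ((S \ {a, b, c}).filter fun g => G.Adj g a ∧ G.Adj g b ∧ G.Adj g c).card ≤ 2) :
    DC G (k + 1) S := by
  refine DC.of_tri ht (hA.of_tf (hNT.tf_sdiff ht Subset.rfl) ?_)
  have := W_sdiff_tri_ge (k := k) ht ∅ (by simp) (by simp)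
  simp only [card_empty] at this
  omega

/-- Removing a triangle of total cost three, together with a vertex that gains weight. -/
lemma StarBound.of_tri_of_gain (hA : StarBound V k) (hNT : NT G S)
    (hW : 2 * ((k : ℤ) + 1) ≤ W G S (k + 1)) {a b c g : V} (ht : Tri G S a b c)
    (hcost : wt (k + 1) (dg G S a) + wt (k + 1) (dg G S b) + wt (k + 1) (dg G S c) +
      ((S \ {a, b, c}).filter fun g => G.Adj g a ∧ G.Adj g b ∧ G.Adj g c).card ≤ 3)
    (hg : g ∈ S \ {a, b, c}) (hga : ¬ (G.Adj g a ∧ G.Adj g b ∧ G.Adj g c))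
    (hgain : wt (k + 1) (dg G S g) + 1 ≤ wt k (dg G (S \ {a, b, c}) g)) :
    DC G (k + 1) S := by
  refine DC.of_tri ht (hA.of_tf (hNT.tf_sdiff ht Subset.rfl) ?_)
  have := W_sdiff_tri_ge (k := k) ht {g} (by simpa using hg) (by
    intro u hu
    rw [mem_singleton] at hu
    subst hu
    exact ⟨hga, hgain⟩)
  simp only [card_singleton] at this
  omega

lemma W_sdiff_tri_ge_of_cost
    (hW : 2 * ((k : ℤ) + 1) ≤ W G S (k + 1)) {a b c : V} (ht : Tri G S a b c)
    (hcost : wt (k + 1) (dg G S a) + wt (k + 1) (dg G S b) + wt (k + 1) (dg G S c) +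
      ((S \ {a, b, c}).filter fun g => G.Adj g a ∧ G.Adj g b ∧ G.Adj g c).card ≤ 3) :
    2 * (k : ℤ) - 1 ≤ W G (S \ {a, b, c}) k := by
  have := W_sdiff_tri_ge (k := k) ht ∅ (by simp) (by simp)
  simp only [card_empty] at this
  omega

/-- Removing a triangle of total cost three which keeps two neighbours of some low vertex. -/
lemma StarBound.of_tri_of_low (hA : StarBound V k) (hk : 2 ≤ k) (hNT : NT G S)
    (hW : 2 * ((k : ℤ) + 1) ≤ W G S (k + 1)) {a b c x : V} (ht : Tri G S a b c)
    (hcost : wt (k + 1) (dg G S a) + wt (k + 1) (dg G S b) + wt (k + 1) (dg G S c) +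
      ((S \ {a, b, c}).filter fun g => G.Adj g a ∧ G.Adj g b ∧ G.Adj g c).card ≤ 3)
    (hx : x ∈ S \ {a, b, c}) (hxa : ¬ (G.Adj x a ∧ G.Adj x b ∧ G.Adj x c))
    (hxl : dg G S x ≤ 2 * k) (hx1 : dg G (S \ {a, b, c}) x ≠ 1) :
    DC G (k + 1) S := by
  by_cases hd : dg G (S \ {a, b, c}) x + 2 ≤ 2 * k
  · exact DC.of_tri ht (hA.of_low hk (hNT.tf_sdiff ht Subset.rfl)
      (W_sdiff_tri_ge_of_cost hW ht hcost) hx hd hx1)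
  · refine hA.of_tri_of_gain hNT hW ht hcost hx hxa ?_
    rw [wt_eq_neg (by omega)]
    unfold wt; split_ifs <;> omega

/-- A complete graph on five vertices outside which all degrees are large. -/
lemma StarBound.of_complete (hA : StarBound V k) (hNT : NT G S) {K : Finset V} (hK : K ⊆ S)
    (h5 : K.card = 5) (hadj : ∀ x ∈ K, ∀ y ∈ K, x ≠ y → G.Adj x y) (hne : (S \ K).Nonempty)
    (hd : ∀ u ∈ S \ K, 2 * k ≤ dg G (S \ K) u) : DC G (k + 1) S := by
  obtain ⟨a, b, c, ht⟩ := exists_triangle_of_complete (by omega) hadj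
  have h1 : DC G k (S \ K) := hA.of_two_mul_le (hNT.tf_sdiff (ht.mono hK) ht.subset) hne hd
  exact DC.of_tri (ht.mono hK) (h1.mono (sdiff_subset_sdiff Subset.rfl ht.subset))

lemma NT.dg_complete_le_one (hNT : NT G S) {K : Finset V} (hK : K ⊆ S) (h5 : K.card = 5)
    (hadj : ∀ x ∈ K, ∀ y ∈ K, x ≠ y → G.Adj x y) {g : V} (hg : g ∈ S) (hgK : g ∉ K) :
    dg G K g ≤ 1 := by
  by_contra h
  obtain ⟨x, hx, y, hy, hxy, h1, h2⟩ := two_le_dg_iff.1 (by omega : 2 ≤ dg G K g)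
  have hyx : y ∈ K.erase x := mem_erase.2 ⟨hxy.symm, hy⟩
  have hs : (K.erase x).erase y ⊆ K := (erase_subset _ _).trans (erase_subset _ _)
  obtain ⟨a, b, c, ht⟩ := exists_triangle_of_complete (G := G) (K := (K.erase x).erase y)
    (by rw [card_erase_of_mem hyx, card_erase_of_mem hx]; omega)
    (fun u hu w hw hne => hadj u (hs hu) w (hs hw) hne)
  have h3 := hNT g x y a b c ⟨hg, hK hx, hK hy, h1, h2, hadj x hx y hy hxy⟩ (ht.mono (hs.trans hK))
  obtain ⟨ha, hb, hc, -⟩ := ht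
  simp only [mem_erase] at ha hb hc
  grind

/-- The statement of `NTBound` for sets with fewer than `n` elements. -/
def NTBoundBelow (V : Type*) (k n : ℕ) : Prop :=
  ∀ (G : SimpleGraph V) (S : Finset V), S.card < n → NT G S → 2 * (k : ℤ) ≤ W G S k → DC G k S

lemma NTBoundBelow.of_dg_le_one (ih : NTBoundBelow V k S.card) (hk : 2 ≤ k) (hNT : NT G S)
    (hW : 2 * (k : ℤ) ≤ W G S k) {v : V} (hv : v ∈ S) (hd : dg G S v ≤ 1) : DC G k S := by
  refine (ih G (S.erase v) (card_erase_lt_of_mem hv) (hNT.mono (erase_subset v S)) ?_).mono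
    (erase_subset v S)
  by_cases h0 : dg G S v = 0
  · rw [W_erase_of_dg_zero hv h0 (by omega)]
    omega
  · obtain ⟨y, hy, hvy⟩ := dg_pos_iff.1 (by omega : 1 ≤ dg G S v)
    rw [W_erase_of_dg_one hv (by omega) hk hy hvy]
    have : wt k (dg G S y) ≤ wt k (dg G S y - 1) + 1 := by unfold wt; split_ifs <;> omega
    omega

lemma NTBoundBelow.of_con (ih : NTBoundBelow V k S.card) {x y : V} (hx : x ∈ S)
    (hxy : G.Adj x y) (hNT : NT (con G x y) (S.erase x))
    (hW : 2 * (k : ℤ) ≤ W (con G x y) (S.erase x) k) : DC G k S :=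
  DC.of_con_erase hx hxy (ih _ _ (card_erase_lt_of_mem hx) hNT hW)

lemma NTBoundBelow.of_tf (ih : NTBoundBelow V k S.card) (hk : 2 ≤ k) (h : TF G S)
    (hW : 2 * (k : ℤ) ≤ W G S k) (hδ : ∀ v ∈ S, 2 ≤ dg G S v) : DC G k S := by
  have hcard := W_le_card (G := G) (S := S) (k := k)
  by_cases hH : ∀ v ∈ S, 2 * k ≤ dg G S v
  · obtain ⟨x, hx⟩ : S.Nonempty := card_pos.1 (by omega)
    obtain ⟨y, hy, hxy⟩ := dg_pos_iff.1 ((by omega : 1 ≤ 2).trans (hδ x hx))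
    refine ih.of_con hx hxy (h.star_con x y).nt ?_
    have h1 : W G S k = S.card := by
      have : W G S k = ∑ v ∈ S, (1 : ℤ) := sum_congr rfl fun v hv => wt_eq_one (hH v hv)
      simpa using this
    have h2 := dg_lt_card (G := G) hx
    have h3 := W_con_ge hx hy hxy (h.no_common hx hy hxy) k (hδ x hx)
    rw [wt_eq_one (hH x hx)] at h3
    have := hH x hx
    omega
  · push Not at hH
    obtain ⟨x, hx, hd⟩ := hH
    obtain ⟨y, hy, hxy⟩ := dg_pos_iff.1 ((by omega : 1 ≤ 2).trans (hδ x hx))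
    refine ih.of_con hx hxy (h.star_con x y).nt ?_
    have h3 := W_con_ge hx hy hxy (h.no_common hx hy hxy) k (hδ x hx)
    have h4 : wt k (dg G S x) ≤ 0 := by unfold wt; split_ifs <;> omega
    omega

lemma StarBound.of_hasKFive (hA : StarBound V k) (hk : 2 ≤ k) (hNT : NT G S)
    (hL : ∀ u ∈ S, 2 * k + 1 ≤ dg G S u) (h : HasKFive G S) : DC G (k + 1) S := by
  obtain ⟨K, hK, h5, hadj⟩ := h
  have hout : ∀ u ∈ S \ K, 2 * k ≤ dg G (S \ K) u := by
    intro u hu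
    obtain ⟨huS, huK⟩ := mem_sdiff.1 hu
    have := hNT.dg_complete_le_one hK h5 hadj huS huK
    have := dg_sdiff (G := G) hK u
    have := hL u huS
    omega
  refine hA.of_complete hNT hK h5 hadj ?_ hout
  obtain ⟨x, hx⟩ : K.Nonempty := card_pos.1 (by omega)
  have h1 := hL x (hK hx)
  have h2 := dg_lt_card (G := G) hx
  have h3 := dg_sdiff (G := G) hK x
  obtain ⟨u, hu, -⟩ := dg_pos_iff.1 (by omega : 1 ≤ dg G (S \ K) x)
  exact ⟨u, hu⟩

/-- The vertices outside `C` with at least two neighbours in `C`. -/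
def closeTo (G : SimpleGraph V) (S C : Finset V) : Finset V :=
  S.filter fun u => u ∉ C ∧ 2 ≤ dg G C u

/-- The vertices outside `C` with at most one neighbour in `C`. -/
def farFrom (G : SimpleGraph V) (S C : Finset V) : Finset V :=
  S.filter fun u => u ∉ C ∧ dg G C u ≤ 1

lemma mem_closeTo {C : Finset V} {u : V} :
    u ∈ closeTo G S C ↔ u ∈ S ∧ u ∉ C ∧ 2 ≤ dg G C u := mem_filter

lemma mem_farFrom {C : Finset V} {u : V} :
    u ∈ farFrom G S C ↔ u ∈ S ∧ u ∉ C ∧ dg G C u ≤ 1 := mem_filter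

/-- If a triangle `C` has two common neighbours and there is no complete graph on five vertices,
then every triangle contains two vertices of `C`. -/
lemma NT.no_triangle_two_outside (hNT : NT G S) (hK5 : ¬ HasKFive G S) {r s t v₁ v₂ : V}
    (hC : Tri G S r s t) (hv₁ : v₁ ∈ S) (hv₂ : v₂ ∈ S) (hne : v₁ ≠ v₂)
    (h₁ : G.Adj v₁ r ∧ G.Adj v₁ s ∧ G.Adj v₁ t) (h₂ : G.Adj v₂ r ∧ G.Adj v₂ s ∧ G.Adj v₂ t)
    {x y z : V} (h : Tri G S x y z) (hx : x ∉ ({r, s, t} : Finset V))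
    (hy : y ∉ ({r, s, t} : Finset V)) : False := by
  obtain ⟨hr, hs, ht, hrs, hrt, hst⟩ := hC
  obtain ⟨hxS, hyS, hzS, hxy, hxz, hyz⟩ := id h
  simp only [mem_insert, mem_singleton, not_or] at hx hy
  have := h₁.1.ne
  have := h₁.2.1.ne
  have := h₁.2.2.ne
  have := h₂.1.ne
  have := h₂.2.1.ne
  have := h₂.2.2.ne
  have := hxz.ne
  have := hyz.ne
  have := hrs.ne
  have := hrt.ne
  have := hst.ne
  have hK : ¬ G.Adj v₁ v₂ := by
    intro hvv
    have := hvv.ne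
    refine hK5 ⟨{r, s, t, v₁, v₂}, ?_, ?_, ?_⟩
    · intro u hu
      simp only [mem_insert, mem_singleton] at hu
      rcases hu with rfl | rfl | rfl | rfl | rfl <;> assumption
    · rw [card_insert_of_notMem, card_insert_of_notMem, card_insert_of_notMem, card_pair] <;>
        grind
    · intro a ha b hb hab
      simp only [mem_insert, mem_singleton] at ha hb
      rcases ha with rfl | rfl | rfl | rfl | rfl <;> rcases hb with rfl | rfl | rfl | rfl | rfl <;>
        first
        | exact absurd rfl hab
        | tauto
  have key : ∀ v, v ∈ S → G.Adj v r → G.Adj v s → G.Adj v t → v ≠ x → v ≠ y → False := by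
    intro v hv h1 h2 h3 h4 h5
    have := h1.ne
    have := h2.ne
    have := h3.ne
    by_cases hzr : z = r
    · have := hNT x y z s t v h ⟨hs, ht, hv, hst, h2.symm, h3.symm⟩
      grind
    by_cases hzs : z = s
    · have := hNT x y z r t v h ⟨hr, ht, hv, hrt, h1.symm, h3.symm⟩
      grind
    by_cases hzt : z = t
    · have := hNT x y z r s v h ⟨hr, hs, hv, hrs, h1.symm, h2.symm⟩
      grind
    have := hNT x y z r s t h ⟨hr, hs, ht, hrs, hrt, hst⟩
    grind
  by_cases h1 : v₁ = x ∨ v₁ = y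
  · by_cases h2 : v₂ = x ∨ v₂ = y
    · have := hxy.symm
      grind
    · push Not at h2
      exact key v₂ hv₂ h₂.1 h₂.2.1 h₂.2.2 h2.1 h2.2
  · push Not at h1
    exact key v₁ hv₁ h₁.1 h₁.2.1 h₁.2.2 h1.1 h1.2

lemma not_adj_of_mem_closeTo {r s t x y : V} (hrs : r ≠ s) (hrt : r ≠ t) (hst : s ≠ t)
    (hr : r ∈ S) (hs : s ∈ S) (ht : t ∈ S)
    (hF : ∀ x y z, Tri G S x y z → x ∉ ({r, s, t} : Finset V) → y ∉ ({r, s, t} : Finset V) → False)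
    (hx : x ∈ closeTo G S {r, s, t}) (hy : y ∈ closeTo G S {r, s, t}) : ¬ G.Adj x y := by
  intro hxy
  obtain ⟨hxS, hxC, hx2⟩ := mem_closeTo.1 hx
  obtain ⟨hyS, hyC, hy2⟩ := mem_closeTo.1 hy
  have key : ∀ z ∈ S, ¬ (G.Adj x z ∧ G.Adj y z) := fun z hz h =>
    hF x y z ⟨hxS, hyS, hz, hxy, h.1, h.2⟩ hxC hyC
  have h1 := key r hr
  have h2 := key s hs
  have h3 := key t ht
  rw [dg_triple hrs hrt hst] at hx2 hy2
  split_ifs at hx2 hy2 <;> first | omega | tauto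

lemma dg_le_of_mem_closeTo {r s t y : V} (hrs : r ≠ s) (hrt : r ≠ t) (hst : s ≠ t)
    (hr : r ∈ S) (hs : s ∈ S) (ht : t ∈ S)
    (hF : ∀ x y z, Tri G S x y z → x ∉ ({r, s, t} : Finset V) → y ∉ ({r, s, t} : Finset V) → False)
    (hy : y ∈ closeTo G S {r, s, t}) :
    dg G S y ≤ dg G {r, s, t} y + (farFrom G S {r, s, t}).card := by
  rw [dg_sdiff (triple_subset hr hs ht), add_comm]
  gcongr
  refine card_le_card fun u hu => ?_
  rw [mem_filter, mem_sdiff] at hu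
  refine mem_farFrom.2 ⟨hu.1.1, hu.1.2, ?_⟩
  by_contra hd
  exact not_adj_of_mem_closeTo hrs hrt hst hr hs ht hF hy
    (mem_closeTo.2 ⟨hu.1.1, hu.1.2, by omega⟩) hu.2

lemma W_sdiff_core_ge {r s t v : V} (hC : Tri G S r s t) (hL : ∀ u ∈ S, 2 * k + 1 ≤ dg G S u)
    (hF : ∀ x y z, Tri G S x y z → x ∉ ({r, s, t} : Finset V) → y ∉ ({r, s, t} : Finset V) → False)
    (hv : v ∈ S) (hvC : v ∉ ({r, s, t} : Finset V)) (hvr : G.Adj v r) (hvs : G.Adj v s)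
    (hvt : G.Adj v t) :
    ((farFrom G S {r, s, t}).card : ℤ) +
      (((closeTo G S {r, s, t}).erase v).filter fun u => 2 * (k + 1) ≤ dg G S u).card +
      wt k (dg G (S \ {r, s, v}) t) ≤ W G (S \ {r, s, v}) k := by
  obtain ⟨hr, hs, ht, hrs, hrt, hst⟩ := hC
  set C : Finset V := {r, s, t} with hCdef
  have hCd : ∀ u, dg G C u = (if G.Adj u r then 1 else 0) + (if G.Adj u s then 1 else 0) +
      (if G.Adj u t then 1 else 0) := fun u => dg_triple hrs.ne hrt.ne hst.ne u
  have hvI : v ∈ closeTo G S C := mem_closeTo.2 ⟨hv, hvC, by rw [hCd]; simp [*]⟩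
  have hZd : ∀ u, dg G S u = dg G (S \ {r, s, v}) u + ((if G.Adj u r then 1 else 0) +
      (if G.Adj u s then 1 else 0) + (if G.Adj u v then 1 else 0)) := fun u => by
    rw [dg_sdiff (triple_subset hr hs hv), dg_triple hrs.ne hvr.ne' hvs.ne']
  have hJ : S \ {r, s, v} = insert t (farFrom G S C ∪ (closeTo G S C).erase v) := by
    ext u
    simp only [mem_sdiff, mem_insert, mem_singleton, mem_union, mem_farFrom, mem_erase,
      mem_closeTo]
    have : u ∈ C ↔ u = r ∨ u = s ∨ u = t := by simp [hCdef]
    have := hvt.ne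
    have := hrt.ne
    have := hst.ne
    by_cases hd : dg G C u ≤ 1
    · have : ¬ 2 ≤ dg G C u := by omega
      grind [mem_closeTo]
    · have : 2 ≤ dg G C u := by omega
      grind
  have ht' : t ∉ farFrom G S C ∪ (closeTo G S C).erase v := by
    intro h
    rw [mem_union, mem_erase, mem_farFrom, mem_closeTo] at h
    have : t ∈ C := by simp [hCdef]
    tauto
  have hdisj : Disjoint (farFrom G S C) ((closeTo G S C).erase v) := by
    rw [disjoint_left]
    intro u h1 h2
    rw [mem_erase, mem_closeTo] at h2
    rw [mem_farFrom] at h1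
    omega
  have hsum : W G (S \ {r, s, v}) k = wt k (dg G (S \ {r, s, v}) t) +
      (∑ u ∈ farFrom G S C, wt k (dg G (S \ {r, s, v}) u) +
        ∑ u ∈ (closeTo G S C).erase v, wt k (dg G (S \ {r, s, v}) u)) := by
    rw [← sum_union hdisj, ← sum_insert (f := fun u => wt k (dg G (S \ {r, s, v}) u)) ht',
      ← hJ]
    rfl
  have h1 : ∑ u ∈ farFrom G S C, wt k (dg G (S \ {r, s, v}) u) = (farFrom G S C).card := by
    have : ∑ u ∈ farFrom G S C, wt k (dg G (S \ {r, s, v}) u) = ∑ u ∈ farFrom G S C, (1 : ℤ) := by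
      refine sum_congr rfl fun u hu => wt_eq_one ?_
      obtain ⟨huS, huC, hu1⟩ := mem_farFrom.1 hu
      have h2 := hL u huS
      have h3 := hZd u
      rw [hCd] at hu1
      have h4 : G.Adj u v → ¬ G.Adj u r := fun h5 h6 => hF u v r ⟨huS, hv, hr, h5, h6, hvr⟩ huC hvC
      have h5 : G.Adj u v → ¬ G.Adj u s := fun h5 h6 => hF u v s ⟨huS, hv, hs, h5, h6, hvs⟩ huC hvC
      split_ifs at h3 hu1 <;> first | omega | tauto
    simpa using this
  have h2 : ((((closeTo G S C).erase v).filter fun u => 2 * (k + 1) ≤ dg G S u).card : ℤ) ≤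
      ∑ u ∈ (closeTo G S C).erase v, wt k (dg G (S \ {r, s, v}) u) := by
    rw [card_filter]
    push_cast
    refine sum_le_sum fun u hu => ?_
    rw [mem_erase] at hu
    have h3 := hZd u
    have h4 := not_adj_of_mem_closeTo hrs.ne hrt.ne hst.ne hr hs ht hF hu.2 hvI
    have h5 := hL u (mem_closeTo.1 hu.2).1
    rw [if_neg h4] at h3
    unfold wt
    split_ifs at h3 ⊢ <;> omega
  omega

lemma W_le_core {C : Finset V} (hL : ∀ u ∈ S, 2 * k + 1 ≤ dg G S u) :
    W G S (k + 1) ≤ (farFrom G S C).card +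
      ((closeTo G S C).filter fun u => 2 * (k + 1) ≤ dg G S u).card +
      (C.filter fun u => 2 * (k + 1) ≤ dg G S u).card := by
  have h1 : W G S (k + 1) = (S.filter fun u => 2 * (k + 1) ≤ dg G S u).card := by
    rw [card_filter]
    push_cast
    refine sum_congr rfl fun u hu => ?_
    have := hL u hu
    unfold wt
    split_ifs <;> omega
  have h2 : (S.filter fun u => 2 * (k + 1) ≤ dg G S u) ⊆ farFrom G S C ∪
      ((closeTo G S C).filter fun u => 2 * (k + 1) ≤ dg G S u) ∪
      (C.filter fun u => 2 * (k + 1) ≤ dg G S u) := by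
    intro u hu
    rw [mem_filter] at hu
    simp only [mem_union, mem_filter, mem_farFrom, mem_closeTo]
    by_cases hd : dg G C u ≤ 1
    · tauto
    · have : 2 ≤ dg G C u := by omega
      tauto
  have h3 := card_le_card h2
  have h4 := card_union_le (farFrom G S C ∪
      ((closeTo G S C).filter fun u => 2 * (k + 1) ≤ dg G S u))
      (C.filter fun u => 2 * (k + 1) ≤ dg G S u)
  have h5 := card_union_le (farFrom G S C)
      ((closeTo G S C).filter fun u => 2 * (k + 1) ≤ dg G S u)
  omega

lemma StarBound.of_core_aux (hA : StarBound V k) (hk : 2 ≤ k) (hNT : NT G S)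
    (hW : 2 * ((k : ℤ) + 1) ≤ W G S (k + 1)) (hL : ∀ u ∈ S, 2 * k + 1 ≤ dg G S u)
    (hK5 : ¬ HasKFive G S) {r s t v₁ v₂ : V}
    (hC : Tri G S r s t) (hv₁ : v₁ ∈ S) (hv₂ : v₂ ∈ S) (hne : v₁ ≠ v₂)
    (h₁ : G.Adj v₁ r ∧ G.Adj v₁ s ∧ G.Adj v₁ t) (h₂ : G.Adj v₂ r ∧ G.Adj v₂ s ∧ G.Adj v₂ t)
    (hH : 2 * k + 2 ≤ dg G S t ∨
      dg G S r ≤ 2 * k + 1 ∧ dg G S s ≤ 2 * k + 1 ∧ dg G S t ≤ 2 * k + 1) :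
    DC G (k + 1) S := by
  have hF : ∀ x y z, Tri G S x y z → x ∉ ({r, s, t} : Finset V) → y ∉ ({r, s, t} : Finset V) →
      False := fun x y z => hNT.no_triangle_two_outside hK5 hC hv₁ hv₂ hne h₁ h₂
  obtain ⟨hr, hs, ht, hrs, hrt, hst⟩ := id hC
  have hnotC : ∀ v, G.Adj v r ∧ G.Adj v s ∧ G.Adj v t → v ∉ ({r, s, t} : Finset V) := by
    intro v h
    simp only [mem_insert, mem_singleton, not_or]
    exact ⟨h.1.ne, h.2.1.ne, h.2.2.ne⟩
  have hclose : ∀ v ∈ S, G.Adj v r ∧ G.Adj v s ∧ G.Adj v t → v ∈ closeTo G S {r, s, t} := by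
    intro v hv h
    refine mem_closeTo.2 ⟨hv, hnotC v h, ?_⟩
    rw [dg_triple hrs.ne hrt.ne hst.ne]
    simp [h]
  have hrem : ∀ v ∈ S, G.Adj v r ∧ G.Adj v s ∧ G.Adj v t → Tri G S r s v := fun v hv h =>
    ⟨hr, hs, hv, hrs, h.1.symm, h.2.1.symm⟩
  have hcore : ∀ v, v ∈ S → (h : G.Adj v r ∧ G.Adj v s ∧ G.Adj v t) → _ := fun v hv h =>
    W_sdiff_core_ge hC hL hF hv (hnotC v h) h.1 h.2.1 h.2.2
  have hfin : ∀ v ∈ S, G.Adj v r ∧ G.Adj v s ∧ G.Adj v t →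
      2 * (k : ℤ) ≤ W G (S \ {r, s, v}) k → DC G (k + 1) S := fun v hv h hW' =>
    DC.of_tri (hrem v hv h) (hA.of_tf (hNT.tf_sdiff (hrem v hv h) Subset.rfl) hW')
  have hwt : ∀ v, dg G S t ≤ dg G (S \ {r, s, v}) t + 3 := by
    intro v
    have h1 : dg G S t ≤ dg G (S \ {r, s, v}) t + dg G {r, s, v} t := by
      rw [← dg_union sdiff_disjoint]
      refine dg_mono (fun u hu => ?_) t
      by_cases h : u ∈ ({r, s, v} : Finset V)
      · exact mem_union_right _ h
      · exact mem_union_left _ (mem_sdiff.2 ⟨hu, h⟩)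
    have h2 : dg G {r, s, v} t ≤ ({r, s, v} : Finset V).card := dg_le_card ..
    have h3 : ({r, s, v} : Finset V).card ≤ 3 := card_le_three
    omega
  have hwt' : ∀ v, wt (k + 1) (dg G S t) ≤ wt k (dg G (S \ {r, s, v}) t) + 1 := fun v =>
    wt_succ_le_add_one (hwt v)
  have htot := W_le_core (C := {r, s, t}) hL
  have hC3 : (({r, s, t} : Finset V).filter fun u => 2 * (k + 1) ≤ dg G S u).card ≤ 3 :=
    (card_filter_le _ _).trans card_le_three
  have hC0 : dg G S t ≤ 2 * k + 1 →
      (({r, s, t} : Finset V).filter fun u => 2 * (k + 1) ≤ dg G S u).card = 0 := by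
    intro h
    rw [card_eq_zero, filter_eq_empty_iff]
    intro u hu
    simp only [mem_insert, mem_singleton] at hu
    rcases hu with rfl | rfl | rfl <;> omega
  have hdt := hL t ht
  have hwtt : 0 ≤ wt (k + 1) (dg G S t) := by unfold wt; split_ifs <;> omega
  by_cases hn : ∃ y ∈ closeTo G S {r, s, t}, 2 * (k + 1) ≤ dg G S y
  · obtain ⟨y, hy, hyH⟩ := hn
    have hβ := dg_le_of_mem_closeTo hrs.ne hrt.ne hst.ne hr hs ht hF hy
    have hcount : ∀ v, y ≠ v → 1 ≤ (((closeTo G S {r, s, t}).erase v).filter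
        fun u => 2 * (k + 1) ≤ dg G S u).card := fun v hv =>
      card_pos.2 ⟨y, mem_filter.2 ⟨mem_erase.2 ⟨hv, hy⟩, hyH⟩⟩
    by_cases hyA : 3 ≤ dg G {r, s, t} y
    · have hyA3 : dg G {r, s, t} y ≤ 3 := (dg_le_card ..).trans card_le_three
      obtain ⟨v, hv, hvA, hyv⟩ : ∃ v ∈ S, (G.Adj v r ∧ G.Adj v s ∧ G.Adj v t) ∧ y ≠ v := by
        by_cases h : y = v₁
        · exact ⟨v₂, hv₂, h₂, h ▸ hne⟩
        · exact ⟨v₁, hv₁, h₁, h⟩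
      refine hfin v hv hvA ?_
      have h1 := hcore v hv hvA
      have h2 := hcount v hyv
      have h3 := hwt' v
      by_cases h4 : 2 * k + 2 ≤ dg G S t
      · rw [wt_eq_one (by omega)] at h3
        omega
      · have h5 := hC0 (by omega)
        rw [filter_erase] at h1
        have h6 := pred_card_le_card_erase (a := v)
          (s := (closeTo G S {r, s, t}).filter fun u => 2 * (k + 1) ≤ dg G S u)
        omega
    · refine hfin v₁ hv₁ h₁ ?_
      have h1 := hcore v₁ hv₁ h₁
      have h3 := hwt' v₁
      have h2 := hcount v₁ (by
        rintro rfl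
        apply hyA
        rw [dg_triple hrs.ne hrt.ne hst.ne]
        simp [h₁])
      omega
  · push Not at hn
    have hn0 : ((closeTo G S {r, s, t}).filter fun u => 2 * (k + 1) ≤ dg G S u).card = 0 := by
      rw [card_eq_zero, filter_eq_empty_iff]
      intro u hu
      have := hn u hu
      omega
    have h1 := hcore v₁ hv₁ h₁
    have h3 := hwt' v₁
    by_cases h4 : 2 * k + 2 ≤ dg G S t
    · have h5 := hwt v₁
      by_cases h6 : 2 * k ≤ dg G (S \ {r, s, v₁}) t
      · rw [wt_eq_one h6] at h1
        exact hfin v₁ hv₁ h₁ (by omega)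
      · rw [wt_eq_zero (by omega)] at h1
        have h7 := not_adj_of_mem_closeTo hrs.ne hrt.ne hst.ne hr hs ht hF (hclose v₂ hv₂ h₂)
          (hclose v₁ hv₁ h₁)
        have h8 := dg_sdiff (G := G) (triple_subset hr hs hv₁) v₂
        rw [dg_triple hrs.ne h₁.1.ne' h₁.2.1.ne', if_pos h₂.1, if_pos h₂.2.1, if_neg h7] at h8
        have h9 := hn v₂ (hclose v₂ hv₂ h₂)
        have h10 := hL v₂ hv₂
        have h11 := h₁.2.2.ne
        have h12 := h₂.1.ne
        have h13 := h₂.2.1.ne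
        refine DC.of_tri (hrem v₁ hv₁ h₁) (hA.of_adj hk
          (hNT.tf_sdiff (hrem v₁ hv₁ h₁) Subset.rfl) ?_ (x := t) (y := v₂) ?_ ?_ h₂.2.2.symm
          (by omega) (by omega))
        · omega
        · simp [ht, hrt.ne', hst.ne', h11.symm]
        · simp [hv₂, h12, h13, hne.symm]
    · have h5 := hC0 (by omega)
      exact hfin v₁ hv₁ h₁ (by omega)

lemma StarBound.of_core (hA : StarBound V k) (hk : 2 ≤ k) (hNT : NT G S)
    (hW : 2 * ((k : ℤ) + 1) ≤ W G S (k + 1)) (hL : ∀ u ∈ S, 2 * k + 1 ≤ dg G S u)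
    (hK5 : ¬ HasKFive G S) {r s t v₁ v₂ : V}
    (hC : Tri G S r s t) (hv₁ : v₁ ∈ S) (hv₂ : v₂ ∈ S) (hne : v₁ ≠ v₂)
    (h₁ : G.Adj v₁ r ∧ G.Adj v₁ s ∧ G.Adj v₁ t) (h₂ : G.Adj v₂ r ∧ G.Adj v₂ s ∧ G.Adj v₂ t) :
    DC G (k + 1) S := by
  obtain ⟨hr, hs, ht, hrs, hrt, hst⟩ := id hC
  by_cases h1 : 2 * k + 2 ≤ dg G S r
  · exact hA.of_core_aux hk hNT hW hL hK5 ⟨ht, hs, hr, hst.symm, hrt.symm, hrs.symm⟩ hv₁ hv₂ hne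
      ⟨h₁.2.2, h₁.2.1, h₁.1⟩ ⟨h₂.2.2, h₂.2.1, h₂.1⟩ (Or.inl h1)
  by_cases h2 : 2 * k + 2 ≤ dg G S s
  · exact hA.of_core_aux hk hNT hW hL hK5 ⟨hr, ht, hs, hrt, hrs, hst.symm⟩ hv₁ hv₂ hne
      ⟨h₁.1, h₁.2.2, h₁.2.1⟩ ⟨h₂.1, h₂.2.2, h₂.2.1⟩ (Or.inl h2)
  exact hA.of_core_aux hk hNT hW hL hK5 hC hv₁ hv₂ hne h₁ h₂ (by omega)

lemma W_eq_card (hL : ∀ u ∈ S, 2 * k + 1 ≤ dg G S u) :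
    W G S (k + 1) = (S.filter fun u => 2 * (k + 1) ≤ dg G S u).card := by
  rw [card_filter]
  push_cast
  refine sum_congr rfl fun u hu => ?_
  have := hL u hu
  unfold wt
  split_ifs <;> omega

lemma add_four_le_card (hk : 2 ≤ k) (hW : 2 * ((k : ℤ) + 1) ≤ W G S (k + 1))
    (hL : ∀ u ∈ S, 2 * k + 1 ≤ dg G S u) (hK5 : ¬ HasKFive G S) : 2 * k + 4 ≤ S.card := by
  by_contra hcon
  rw [W_eq_card hL] at hW
  obtain ⟨K, hK, h5⟩ := exists_subset_card_eq
    (show 5 ≤ (S.filter fun u => 2 * (k + 1) ≤ dg G S u).card by omega)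
  refine hK5 ⟨K, hK.trans (filter_subset _ _), h5, fun x hx y hy hxy => ?_⟩
  obtain ⟨hxS, hxH⟩ := mem_filter.1 (hK hx)
  obtain ⟨hyS, -⟩ := mem_filter.1 (hK hy)
  by_contra hadj
  have h1 : S.filter (fun u => G.Adj x u) ⊆ (S.erase x).erase y := by
    intro u hu
    rw [mem_filter] at hu
    refine mem_erase.2 ⟨?_, mem_erase.2 ⟨hu.2.ne', hu.1⟩⟩
    rintro rfl
    exact hadj hu.2
  have h2 := card_le_card h1
  rw [card_erase_of_mem (mem_erase.2 ⟨hxy.symm, hyS⟩), card_erase_of_mem hxS] at h2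
  have h3 : dg G S x = (S.filter (fun u => G.Adj x u)).card := rfl
  omega

lemma StarBound.of_high (hA : StarBound V k) (hk : 2 ≤ k) (hNT : NT G S)
    (hW : 2 * ((k : ℤ) + 1) ≤ W G S (k + 1)) (hL : ∀ u ∈ S, 2 * k + 1 ≤ dg G S u)
    (hTF : ¬ TF G S) : DC G (k + 1) S := by
  by_contra hn
  have hK5 : ¬ HasKFive G S := fun h => hn (hA.of_hasKFive hk hNT hL h)
  have hcard := add_four_le_card hk hW hL hK5
  have hone : ∀ a b c, Tri G S a b c → ∀ u ∈ S, ∀ v ∈ S, G.Adj u a ∧ G.Adj u b ∧ G.Adj u c →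
      G.Adj v a ∧ G.Adj v b ∧ G.Adj v c → u = v := by
    intro a b c ht u hu v hv h1 h2
    by_contra hne
    exact hn (hA.of_core hk hNT hW hL hK5 ht hu hv hne h1 h2)
  have hcom : ∀ a b c, Tri G S a b c →
      ((S \ {a, b, c}).filter fun g => G.Adj g a ∧ G.Adj g b ∧ G.Adj g c).card ≤ 1 := by
    intro a b c ht
    rw [card_le_one]
    intro u hu v hv
    rw [mem_filter, mem_sdiff] at hu hv
    exact hone a b c ht u hu.1.1 v hv.1.1 hu.2 hv.2
  have hWle : ∀ a b c, Tri G S a b c → ¬ 2 * (k : ℤ) ≤ W G (S \ {a, b, c}) k := fun a b c ht h =>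
    hn (DC.of_tri ht (hA.of_tf (hNT.tf_sdiff ht Subset.rfl) h))
  by_cases hM : ∀ a b c, Tri G S a b c → dg G S a ≠ 2 * k + 1
  · have : ∃ a b c, Tri G S a b c := by simpa [TF] using hTF
    obtain ⟨a, b, c, ht⟩ := this
    obtain ⟨ha, hb, hc, hab, hac, hbc⟩ := id ht
    have hMb := hM b a c ⟨hb, ha, hc, hab.symm, hbc, hac⟩
    have hMc := hM c a b ⟨hc, ha, hb, hac.symm, hbc.symm, hab⟩
    have hMa := hM a b c ht
    have h1 := W_sdiff_tri_ge (k := k) ht (S.filter fun u => dg G S u = 2 * k + 1) (by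
        intro u hu
        rw [mem_filter] at hu
        rw [mem_sdiff]
        refine ⟨hu.1, ?_⟩
        simp only [mem_insert, mem_singleton]
        rintro (rfl | rfl | rfl) <;> omega) (by
      intro u hu
      rw [mem_filter] at hu
      have h1 := dg_sdiff (G := G) ht.subset u
      rw [dg_triple hab.ne hac.ne hbc.ne] at h1
      have h2 : ¬ (G.Adj u a ∧ G.Adj u b) := fun h => hM u a b ⟨hu.1, ha, hb, h.1, h.2, hab⟩ hu.2
      have h3 : ¬ (G.Adj u a ∧ G.Adj u c) := fun h => hM u a c ⟨hu.1, ha, hc, h.1, h.2, hac⟩ hu.2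
      have h4 : ¬ (G.Adj u b ∧ G.Adj u c) := fun h => hM u b c ⟨hu.1, hb, hc, h.1, h.2, hbc⟩ hu.2
      refine ⟨fun h => h2 ⟨h.1, h.2.1⟩, ?_⟩
      rw [wt_eq_zero (by omega), wt_eq_one]
      · omega
      · split_ifs at h1 <;> first | omega | tauto)
    have h2 := hcom a b c ht
    have h3 := hWle a b c ht
    have h4 : S.card = (S.filter fun u => 2 * (k + 1) ≤ dg G S u).card +
        (S.filter fun u => dg G S u = 2 * k + 1).card := by
      rw [← card_filter_add_card_filter_not (p := fun u => 2 * (k + 1) ≤ dg G S u)]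
      congr 2
      refine filter_congr fun u hu => ?_
      have := hL u hu
      omega
    have h5 := W_eq_card hL
    have h6 := wt_le_one (k + 1) (dg G S a)
    have h7 := wt_le_one (k + 1) (dg G S b)
    have h8 := wt_le_one (k + 1) (dg G S c)
    omega
  · push Not at hM
    obtain ⟨a, b, c, ht, hda⟩ := hM
    have hcost : ∀ a b c, Tri G S a b c → dg G S a = 2 * k + 1 →
        wt (k + 1) (dg G S a) + wt (k + 1) (dg G S b) + wt (k + 1) (dg G S c) +
          ((S \ {a, b, c}).filter fun g => G.Adj g a ∧ G.Adj g b ∧ G.Adj g c).card ≤ 3 := by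
      intro a b c ht hda
      have h2 := hcom a b c ht
      have h6 := wt_eq_zero (k := k + 1) (d := dg G S a) (by omega)
      have h7 := wt_le_one (k + 1) (dg G S b)
      have h8 := wt_le_one (k + 1) (dg G S c)
      omega
    have hprop : ∀ a b c, Tri G S a b c → dg G S a = 2 * k + 1 →
        dg G S b ≠ 2 * k + 1 ∧ dg G S c ≠ 2 * k + 1 ∧
        (∃ z ∈ S, G.Adj z a ∧ G.Adj z b ∧ G.Adj z c) ∧
        ∀ y ∈ S, dg G S y = 2 * k + 1 → y ≠ a → (G.Adj y a ∧ G.Adj y b) ∨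
          (G.Adj y a ∧ G.Adj y c) ∨ (G.Adj y b ∧ G.Adj y c) := by
      intro a b c ht hda
      have h2 := hcom a b c ht
      have h5 := hcost a b c ht hda
      have h6 := wt_eq_zero (k := k + 1) (d := dg G S a) (by omega)
      have h7 := wt_le_one (k + 1) (dg G S b)
      have h8 := wt_le_one (k + 1) (dg G S c)
      have h9 : ¬ _ := fun h => hn (hA.of_tri hNT hW ht h)
      have hb' : dg G S b ≠ 2 * k + 1 := by
        intro h
        rw [wt_eq_zero (d := dg G S b) (by omega)] at h9
        omega
      have hc' : dg G S c ≠ 2 * k + 1 := by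
        intro h
        rw [wt_eq_zero (d := dg G S c) (by omega)] at h9
        omega
      refine ⟨hb', hc', ?_, ?_⟩
      · obtain ⟨z, hz⟩ := card_pos.1 (show 0 < ((S \ {a, b, c}).filter
          fun g => G.Adj g a ∧ G.Adj g b ∧ G.Adj g c).card by omega)
        rw [mem_filter, mem_sdiff] at hz
        exact ⟨z, hz.1.1, hz.2⟩
      · intro y hy hdy hya
        by_contra hno
        obtain ⟨ha, hb, hc, hab, hac, hbc⟩ := id ht
        have h1 := dg_sdiff (G := G) ht.subset y
        rw [dg_triple hab.ne hac.ne hbc.ne] at h1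
        refine hn (hA.of_tri_of_gain hNT hW ht h5 (g := y) ?_ ?_ ?_)
        · rw [mem_sdiff]
          refine ⟨hy, ?_⟩
          simp only [mem_insert, mem_singleton]
          rintro (rfl | rfl | rfl) <;> first | omega | exact hya rfl
        · tauto
        · rw [wt_eq_zero (by omega), wt_eq_one]
          · omega
          · split_ifs at h1 <;> first | omega | tauto
    obtain ⟨hdb, hdc, ⟨z, hz, hza, hzb, hzc⟩, hy1⟩ := hprop a b c ht hda
    obtain ⟨ha, hb, hc, hab, hac, hbc⟩ := id ht
    have ht2 : Tri G S a b z := ⟨ha, hb, hz, hab, hza.symm, hzb.symm⟩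
    have ht3 : Tri G S a c z := ⟨ha, hc, hz, hac, hza.symm, hzc.symm⟩
    obtain ⟨-, hdz, -, hy2⟩ := hprop a b z ht2 hda
    obtain ⟨-, -, -, hy3⟩ := hprop a c z ht3 hda
    have hm : 1 < (S.filter fun u => dg G S u = 2 * k + 1).card := by
      have h1 := W_sdiff_tri_ge (k := k) ht ∅ (by simp) (by simp)
      have h2 := hcost a b c ht hda
      have h3 := hWle a b c ht
      have h4 : S.card = (S.filter fun u => 2 * (k + 1) ≤ dg G S u).card +
          (S.filter fun u => dg G S u = 2 * k + 1).card := by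
        rw [← card_filter_add_card_filter_not (p := fun u => 2 * (k + 1) ≤ dg G S u)]
        congr 2
        refine filter_congr fun u hu => ?_
        have := hL u hu
        omega
      have h5 := W_eq_card hL
      simp only [card_empty] at h1
      omega
    obtain ⟨y, hy, hya⟩ := exists_mem_ne hm a
    rw [mem_filter] at hy
    have h1 := hy1 y hy.1 hy.2 hya
    have h2 := hy2 y hy.1 hy.2 hya
    have h3 := hy3 y hy.1 hy.2 hya
    have hyb : y ≠ b := by rintro rfl; exact hdb hy.2
    have hyc : y ≠ c := by rintro rfl; exact hdc hy.2
    have hyz : y ≠ z := by rintro rfl; exact hdz hy.2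
    by_cases h4 : G.Adj y a
    · by_cases h5 : G.Adj y b
      · by_cases h6 : G.Adj y c
        · exact hyz (hone a b c ht y hy.1 z hz ⟨h4, h5, h6⟩ ⟨hza, hzb, hzc⟩)
        · exact hyc (hone a b z ht2 y hy.1 c hc ⟨h4, h5, by tauto⟩
            ⟨hac.symm, hbc.symm, hzc.symm⟩)
      · exact hyb (hone a c z ht3 y hy.1 b hb ⟨h4, by tauto, by tauto⟩
          ⟨hab.symm, hbc, hzb.symm⟩)
    · have h5 := (h1.resolve_left fun h => h4 h.1).resolve_left fun h => h4 h.1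
      have h6 := (h2.resolve_left fun h => h4 h.1).resolve_left fun h => h4 h.1
      exact hya (hone b c z ⟨hb, hc, hz, hbc, hzb.symm, hzc.symm⟩ y hy.1 a ha
        ⟨h5.1, h5.2, h6.2⟩ ⟨hab, hac, hza.symm⟩)

lemma StarBound.of_low_mem_complete (hA : StarBound V k) (hk : 2 ≤ k) (hNT : NT G S)
    (hW : 2 * ((k : ℤ) + 1) ≤ W G S (k + 1))
    {K : Finset V} (hK : K ⊆ S) (h5 : K.card = 5)
    (hadj : ∀ x ∈ K, ∀ y ∈ K, x ≠ y → G.Adj x y) {x : V} (hx : x ∈ K)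
    (hdx : dg G S x ≤ 2 * k) : DC G (k + 1) S := by
  by_contra hn
  have hKd : ∀ g ∈ S, g ∉ K → dg G K g ≤ 1 := fun g => hNT.dg_complete_le_one hK h5 hadj
  have hwx : wt (k + 1) (dg G S x) = -1 := wt_eq_neg (by omega)
  have htri : ∀ p ∈ K, ∀ q ∈ K, p ≠ x → q ≠ x → p ≠ q → Tri G S x p q ∧ {x, p, q} ⊆ K ∧
      ((S \ {x, p, q}).filter fun g => G.Adj g x ∧ G.Adj g p ∧ G.Adj g q).card ≤ 2 := by
    intro p hp q hq hpx hqx hpq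
    have hT : {x, p, q} ⊆ K := triple_subset hx hp hq
    refine ⟨⟨hK hx, hK hp, hK hq, hadj x hx p hp hpx.symm, hadj x hx q hq hqx.symm,
      hadj p hp q hq hpq⟩, hT, ?_⟩
    have h1 : (S \ {x, p, q}).filter (fun g => G.Adj g x ∧ G.Adj g p ∧ G.Adj g q) ⊆
        K \ {x, p, q} := by
      intro g hg
      rw [mem_filter, mem_sdiff] at hg
      refine mem_sdiff.2 ⟨?_, hg.1.2⟩
      by_contra hgK
      have := dg_le_one_iff.1 (hKd g hg.1.1 hgK) x hx p hp hg.2.1 hg.2.2.1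
      exact hpx this.symm
    have h2 := card_le_card h1
    rw [card_sdiff_of_subset hT, h5, card_eq_three.2 ⟨x, p, q, hpx.symm, hqx.symm, hpq, rfl⟩] at h2
    exact h2
  have hpick : ∀ p ∈ K, p ≠ x → ∃ q ∈ K, q ≠ x ∧ q ≠ p := by
    intro p hp hpx
    obtain ⟨q, hq⟩ : ((K.erase x).erase p).Nonempty := by
      rw [← card_pos, card_erase_of_mem (mem_erase.2 ⟨hpx, hp⟩), card_erase_of_mem hx]
      omega
    simp only [mem_erase] at hq
    exact ⟨q, hq.2.2, hq.2.1, hq.1⟩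
  obtain ⟨p₀, hp₀, hp₀x⟩ : ∃ p ∈ K, p ≠ x := exists_mem_ne (by omega) x
  have hwle := fun u => wt_le_one (k + 1) (dg G S u)
  have hH : ∀ p ∈ K, p ≠ x → 2 * k + 2 ≤ dg G S p := by
    intro p hp hpx
    by_contra hcon
    obtain ⟨q, hq, hqx, hqp⟩ := hpick p hp hpx
    obtain ⟨h1, -, h2⟩ := htri p hp q hq hpx hqx hqp.symm
    refine hn (hA.of_tri hNT hW h1 ?_)
    have h3 : wt (k + 1) (dg G S p) ≤ 0 := by unfold wt; split_ifs <;> omega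
    have := hwle q
    omega
  have hcost : ∀ p ∈ K, ∀ q ∈ K, p ≠ x → q ≠ x → p ≠ q →
      wt (k + 1) (dg G S x) + wt (k + 1) (dg G S p) + wt (k + 1) (dg G S q) +
      ((S \ {x, p, q}).filter fun g => G.Adj g x ∧ G.Adj g p ∧ G.Adj g q).card ≤ 3 := by
    intro p hp q hq hpx hqx hpq
    have := (htri p hp q hq hpx hqx hpq).2.2
    have := hwle p
    have := hwle q
    omega
  have hJ : ∀ p ∈ K, ∀ q ∈ K, p ≠ x → q ≠ x → p ≠ q → ∀ g ∈ S, g ∉ K →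
      g ∈ S \ {x, p, q} ∧ ¬ (G.Adj g x ∧ G.Adj g p ∧ G.Adj g q) ∧
      dg G S g ≤ dg G (S \ {x, p, q}) g + 1 := by
    intro p hp q hq hpx hqx hpq g hg hgK
    obtain ⟨h1, h2, -⟩ := htri p hp q hq hpx hqx hpq
    refine ⟨mem_sdiff.2 ⟨hg, fun h => hgK (h2 h)⟩, ?_, ?_⟩
    · intro h
      exact hpx (dg_le_one_iff.1 (hKd g hg hgK) x hx p hp h.1 h.2.1).symm
    · have h3 := dg_sdiff (G := G) h1.subset g
      have h4 := dg_mono (G := G) h2 g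
      have := hKd g hg hgK
      omega
  have hM : ∀ g ∈ S, g ∉ K → dg G S g ≠ 2 * k + 1 := by
    intro g hg hgK hdg
    obtain ⟨q₀, hq₀, hq₀x, hqp⟩ := hpick p₀ hp₀ hp₀x
    obtain ⟨h1, h2, h3⟩ := hJ p₀ hp₀ q₀ hq₀ hp₀x hq₀x hqp.symm g hg hgK
    refine hn (hA.of_tri_of_gain hNT hW (htri p₀ hp₀ q₀ hq₀ hp₀x hq₀x hqp.symm).1
      (hcost p₀ hp₀ q₀ hq₀ hp₀x hq₀x hqp.symm) h1 h2 ?_)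
    rw [wt_eq_zero (by omega), wt_eq_one (by omega)]
    omega
  have hLow : ∀ v ∈ S, v ∉ K → 2 * k < dg G S v := by
    intro v hv hvK
    by_contra hdv
    obtain ⟨p, hp, hpx, hvp⟩ : ∃ p ∈ K, p ≠ x ∧ ∀ u ∈ K, G.Adj v u → u = x ∨ u = p := by
      by_cases h : ∃ p ∈ K, p ≠ x ∧ G.Adj v p
      · obtain ⟨p, hp, hpx, hvp⟩ := h
        exact ⟨p, hp, hpx, fun u hu hvu =>
          Or.inr (dg_le_one_iff.1 (hKd v hv hvK) u hu p hp hvu hvp)⟩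
      · refine ⟨p₀, hp₀, hp₀x, fun u hu hvu => ?_⟩
        by_contra hne
        exact h ⟨u, hu, fun h => hne (Or.inl h), hvu⟩
    obtain ⟨q, hq, hqx, hqp⟩ := hpick p hp hpx
    obtain ⟨ht, hTK, -⟩ := htri p hp q hq hpx hqx hqp.symm
    have hc := hcost p hp q hq hpx hqx hqp.symm
    obtain ⟨h1, h2, h3⟩ := hJ p hp q hq hpx hqx hqp.symm v hv hvK
    have h4 : dg G (S \ {x, p, q}) v = 1 := by
      by_contra h4
      exact hn (hA.of_tri_of_low hk hNT hW ht hc h1 h2 (by omega) h4)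
    obtain ⟨g, hg, hvg⟩ := dg_pos_iff.1 h4.ge
    obtain ⟨hgS, hgT⟩ := mem_sdiff.1 hg
    have hgK : g ∉ K := by
      intro hgK
      rcases hvp g hgK hvg with rfl | rfl <;> simp at hgT
    obtain ⟨-, h5, h6⟩ := hJ p hp q hq hpx hqx hqp.symm g hgS hgK
    have h7 := hM g hgS hgK
    have hTF := hNT.tf_sdiff ht Subset.rfl
    have hW' := W_sdiff_tri_ge_of_cost hW ht hc
    by_cases h8 : dg G S g ≤ 2 * k
    · by_cases h9 : dg G (S \ {x, p, q}) g + 2 ≤ 2 * k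
      · exact hn (DC.of_tri ht (hA.of_leaf hk hTF hW' h1 h4 hg hvg (Or.inr h9)))
      · refine hn (hA.of_tri_of_gain hNT hW ht hc hg h5 ?_)
        rw [wt_eq_neg (by omega)]
        unfold wt; split_ifs <;> omega
    · exact hn (DC.of_tri ht (hA.of_leaf hk hTF hW' h1 h4 hg hvg (Or.inl (by omega))))
  refine hn (hA.of_complete hNT hK h5 hadj ?_ ?_)
  · have h1 := hH p₀ hp₀ hp₀x
    have h2 := dg_sdiff (G := G) hK p₀
    have h3 := dg_lt_card (G := G) hp₀
    obtain ⟨u, hu, -⟩ := dg_pos_iff.1 (by omega : 1 ≤ dg G (S \ K) p₀)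
    exact ⟨u, hu⟩
  · intro u hu
    obtain ⟨huS, huK⟩ := mem_sdiff.1 hu
    have h1 := hLow u huS huK
    have h2 := hM u huS huK
    have h3 := hKd u huS huK
    have h4 := dg_sdiff (G := G) hK u
    omega

lemma StarBound.of_low_tri (hA : StarBound V k) (hk : 2 ≤ k) (hNT : NT G S)
    (hW : 2 * ((k : ℤ) + 1) ≤ W G S (k + 1)) {x y z : V}
    (ht : Tri G S x y z) (hdx : dg G S x ≤ 2 * k) : DC G (k + 1) S := by
  obtain ⟨hx, hy, hz, hxy, hxz, hyz⟩ := id ht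
  have hwx : wt (k + 1) (dg G S x) = -1 := wt_eq_neg (by omega)
  have hwle := fun u => wt_le_one (k + 1) (dg G S u)
  by_cases hA1 : ((S \ {x, y, z}).filter fun g => G.Adj g x ∧ G.Adj g y ∧ G.Adj g z).card ≤ 1
  · refine hA.of_tri hNT hW ht ?_
    have := hwle y
    have := hwle z
    omega
  · obtain ⟨v, hv, w, hw, hvw⟩ := one_lt_card.1 (not_le.1 hA1)
    rw [mem_filter, mem_sdiff] at hv hw
    obtain ⟨⟨hvS, hvT⟩, hvx, hvy, hvz⟩ := hv
    obtain ⟨⟨hwS, hwT⟩, hwx', hwy, hwz⟩ := hw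
    simp only [mem_insert, mem_singleton, not_or] at hvT hwT
    by_cases hadj : G.Adj v w
    · have := hxy.ne
      have := hxz.ne
      have := hyz.ne
      refine hA.of_low_mem_complete hk hNT hW (K := {x, y, z, v, w}) (x := x) ?_ ?_ ?_
        (by simp) hdx
      · intro u hu
        simp only [mem_insert, mem_singleton] at hu
        rcases hu with rfl | rfl | rfl | rfl | rfl <;> assumption
      · rw [card_insert_of_notMem, card_insert_of_notMem, card_insert_of_notMem, card_pair] <;>
          grind
      · intro a ha b hb hab
        simp only [mem_insert, mem_singleton] at ha hb
        rcases ha with rfl | rfl | rfl | rfl | rfl <;> rcases hb with rfl | rfl | rfl | rfl | rfl <;>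
          first
          | exact absurd rfl hab
          | assumption
          | (apply SimpleGraph.Adj.symm; assumption)
    · refine hA.of_tri hNT hW (a := x) (b := y) (c := v)
        ⟨hx, hy, hvS, hxy, hvx.symm, hvy.symm⟩ ?_
      have : ((S \ {x, y, v}).filter fun g => G.Adj g x ∧ G.Adj g y ∧ G.Adj g v) ⊆ {z} := by
        intro u hu
        rw [mem_filter, mem_sdiff] at hu
        obtain ⟨⟨hu, -⟩, h1, h2, h3⟩ := hu
        rw [mem_singleton]
        have h4 := hNT u x v y z w ⟨hu, hx, hvS, h1, h3, hvx.symm⟩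
          ⟨hy, hz, hwS, hyz, hwy.symm, hwz.symm⟩
        have := h2.ne
        have := hxy.ne
        have := hxz.ne
        have : u ≠ w := by
          rintro rfl
          exact hadj h3.symm
        grind
      have h1 := card_le_card this
      rw [card_singleton] at h1
      have := hwle y
      have := hwle v
      omega

/-- `x y z w` is an induced cycle of length four inside `S`. -/
def Sq (G : SimpleGraph V) (S : Finset V) (x y z w : V) : Prop :=
  (x ∈ S ∧ y ∈ S ∧ z ∈ S ∧ w ∈ S) ∧ (G.Adj x y ∧ G.Adj y z ∧ G.Adj z w ∧ G.Adj w x) ∧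
    x ≠ z ∧ y ≠ w ∧ ¬ G.Adj x z ∧ ¬ G.Adj y w

lemma Sq.cyc {x y z w : V} (h : Sq G S x y z w) : Cyc G {x, y, z, w} :=
  cyc_square h.2.1.1 h.2.1.2.1 h.2.1.2.2.1 h.2.1.2.2.2 h.2.2.1 h.2.2.2.1

lemma Sq.subset {x y z w : V} (h : Sq G S x y z w) : {x, y, z, w} ⊆ S :=
  quad_subset h.1.1 h.1.2.1 h.1.2.2.1 h.1.2.2.2

lemma Sq.dg_eq {x y z w : V} (h : Sq G S x y z w) (v : V) : dg G {x, y, z, w} v =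
    (if G.Adj v x then 1 else 0) + (if G.Adj v y then 1 else 0) +
      (if G.Adj v z then 1 else 0) + (if G.Adj v w then 1 else 0) :=
  dg_quad h.2.1.1.ne h.2.2.1 h.2.1.2.2.2.ne' h.2.1.2.1.ne h.2.2.2.1 h.2.1.2.2.1.ne v

lemma Sq.sum_eq {M : Type*} [AddCommMonoid M] (f : V → M) {x y z w : V} (h : Sq G S x y z w) :
    ∑ v ∈ ({x, y, z, w} : Finset V), f v = f x + f y + f z + f w :=
  sum_quad f h.2.1.1.ne h.2.2.1 h.2.1.2.2.2.ne' h.2.1.2.1.ne h.2.2.2.1 h.2.1.2.2.1.ne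

/-- If contracting `x y` creates disjoint triangles, then `x y` lies in a four-cycle disjoint from
a triangle. -/
lemma NT.exists_square (hNT : NT G S) {x y : V} (hx : x ∈ S) (hy : y ∈ S) (hxy : G.Adj x y)
    (hxt : ¬ InTri G S x) (h : ¬ NT (con G x y) (S.erase x)) :
    ∃ z w, Sq G S x y z w ∧ ∃ d e f, Tri G (S \ {x, y, z, w}) d e f := by
  have hG : ∀ a b c, Tri (con G x y) (S.erase x) a b c → a ≠ y → b ≠ y → c ≠ y →
      Tri G S a b c := by
    intro a b c ⟨ha, hb, hc, hab, hac, hbc⟩ h1 h2 h3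
    rw [con_adj_of_ne h1 h2] at hab
    rw [con_adj_of_ne h1 h3] at hac
    rw [con_adj_of_ne h2 h3] at hbc
    exact ⟨mem_of_mem_erase ha, mem_of_mem_erase hb, mem_of_mem_erase hc, hab, hac, hbc⟩
  have hy1 : ∀ a, a ≠ y → (con G x y).Adj y a → G.Adj y a ∨ G.Adj x a := by
    intro a ha hya
    rw [con_adj] at hya
    grind [G.adj_comm]
  have key : ∀ b c d e f, Tri (con G x y) (S.erase x) y b c → Tri (con G x y) (S.erase x) d e f →
      y ≠ d → y ≠ e → y ≠ f → b ≠ d → b ≠ e → b ≠ f → c ≠ d → c ≠ e → c ≠ f →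
      ∃ z w, Sq G S x y z w ∧ ∃ d e f, Tri G (S \ {x, y, z, w}) d e f := by
    intro b c d e f h1 h2 hyd hye hyf hbd hbe hbf hcd hce hcf
    have hdef := hG d e f h2 hyd.symm hye.symm hyf.symm
    obtain ⟨-, hb, hc, hyb, hyc, hbc⟩ := h1
    have hby := hyb.ne'
    have hcy := hyc.ne'
    rw [con_adj_of_ne hby hcy] at hbc
    obtain ⟨hbx, hb⟩ := mem_erase.1 hb
    obtain ⟨hcx, hc⟩ := mem_erase.1 hc
    obtain ⟨hd, he, hf, -⟩ := h2
    rw [mem_erase] at hd he hf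
    have hno := no_common_of_not_inTri hxt hy hxy
    have fin : ∀ z w, z ∈ S → w ∈ S → G.Adj y z → G.Adj x w → G.Adj z w →
        z ≠ x → w ≠ y → z ≠ d → z ≠ e → z ≠ f → w ≠ d → w ≠ e → w ≠ f →
        ∃ z w, Sq G S x y z w ∧ ∃ d e f, Tri G (S \ {x, y, z, w}) d e f := by
      intro z w hz hw hyz hxw hzw hzx hwy _ _ _ _ _ _
      refine ⟨z, w, ⟨⟨hx, hy, hz, hw⟩, ⟨hxy, hyz, hzw, hxw.symm⟩, hzx.symm, hwy.symm,
        fun h => hno z hz h hyz, hno w hw hxw⟩, d, e, f, ?_, ?_, ?_, hdef.2.2.2⟩ <;>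
      · simp only [mem_sdiff, mem_insert, mem_singleton, not_or]
        refine ⟨by tauto, by tauto, ?_, ?_, ?_⟩ <;> apply Ne.symm <;> assumption
    rcases hy1 b hby hyb with h3 | h3 <;> rcases hy1 c hcy hyc with h4 | h4
    · have := hNT y b c d e f ⟨hy, hb, hc, h3, h4, hbc⟩ hdef
      tauto
    · exact fin b c hb hc h3 h4 hbc hbx hcy hbd hbe hbf hcd hce hcf
    · exact fin c b hc hb h4 h3 hbc.symm hcx hby hcd hce hcf hbd hbe hbf
    · exact absurd ⟨b, hb, c, hc, h3, h4, hbc⟩ hxt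
  unfold NT at h
  push Not at h
  obtain ⟨a, b, c, d, e, f, h1, h2, h3, h4, h5, h6, h7, h8, h9, h10, h11⟩ := h
  have rot : ∀ {a b c}, Tri (con G x y) (S.erase x) a b c →
      Tri (con G x y) (S.erase x) b a c ∧ Tri (con G x y) (S.erase x) c a b := by
    rintro a b c ⟨ha, hb, hc, hab, hac, hbc⟩
    exact ⟨⟨hb, ha, hc, hab.symm, hbc, hac⟩, ⟨hc, ha, hb, hac.symm, hbc.symm, hab⟩⟩
  by_cases hay : a = y
  · subst hay; exact key b c d e f h1 h2 h3 h4 h5 h6 h7 h8 h9 h10 h11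
  by_cases hby : b = y
  · subst hby; exact key a c d e f (rot h1).1 h2 h6 h7 h8 h3 h4 h5 h9 h10 h11
  by_cases hcy : c = y
  · subst hcy; exact key a b d e f (rot h1).2 h2 h9 h10 h11 h3 h4 h5 h6 h7 h8
  by_cases hdy : d = y
  · subst hdy
    exact key e f a b c h2 h1 (by tauto) (by tauto) (by tauto) (Ne.symm h4) (Ne.symm h7)
      (Ne.symm h10) (Ne.symm h5) (Ne.symm h8) (Ne.symm h11)
  by_cases hey : e = y
  · subst hey
    exact key d f a b c (rot h2).1 h1 (by tauto) (by tauto) (by tauto) (Ne.symm h3) (Ne.symm h6)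
      (Ne.symm h9) (Ne.symm h5) (Ne.symm h8) (Ne.symm h11)
  by_cases hfy : f = y
  · subst hfy
    exact key d e a b c (rot h2).2 h1 (by tauto) (by tauto) (by tauto) (Ne.symm h3) (Ne.symm h6)
      (Ne.symm h9) (Ne.symm h4) (Ne.symm h7) (Ne.symm h10)
  have := hNT a b c d e f (hG a b c h1 hay hby hcy) (hG d e f h2 hdy hey hfy)
  tauto

lemma Sq.le_W_sdiff {x y z w : V} (h : Sq G S x y z w)
    (hgood : ∀ u ∈ S \ {x, y, z, w}, dg G {x, y, z, w} u ≤ 2) :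
    W G S (k + 1) - (wt (k + 1) (dg G S x) + wt (k + 1) (dg G S y) + wt (k + 1) (dg G S z) +
      wt (k + 1) (dg G S w)) ≤ W G (S \ {x, y, z, w}) k := by
  have h1 := W_sdiff_ge (G := G) (k := k + 1) (k' := k) h.subset (fun _ => 0) (by
    intro u hu
    have h2 := dg_sdiff (G := G) h.subset u
    have h3 := hgood u hu
    have := wt_succ_le (k := k) (d := dg G S u) (d' := dg G (S \ {x, y, z, w}) u) (by omega)
    omega)
  rw [h.sum_eq, sum_const_zero] at h1
  omega

/-- A four-cycle of weight at most two with no outside vertex having three neighbours on it. -/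
lemma NTBound.of_square (hB : NTBound V k) (hNT : NT G S) (hW : 2 * ((k : ℤ) + 1) ≤ W G S (k + 1))
    {x y z w : V} (h : Sq G S x y z w)
    (hgood : ∀ u ∈ S \ {x, y, z, w}, dg G {x, y, z, w} u ≤ 2) (hdx : dg G S x ≤ 2 * k) :
    DC G (k + 1) S := by
  refine DC.succ h.cyc h.subset (hB _ _ (hNT.mono sdiff_subset) ?_)
  have h1 := h.le_W_sdiff (k := k) hgood
  rw [wt_eq_neg (d := dg G S x) (by omega)] at h1
  have := wt_le_one (k + 1) (dg G S y)
  have := wt_le_one (k + 1) (dg G S z)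
  have := wt_le_one (k + 1) (dg G S w)
  omega

/-- A weight bound on forests in terms of the number of isolated and nonisolated vertices. -/
lemma Acyc.sum_le (hF : Acyc G F) (f p : V → ℤ) (hp : ∀ v ∈ F, 0 ≤ p v)
    (h0 : ∀ v ∈ F, dg G F v = 0 → f v ≤ -1)
    (h1 : ∀ v ∈ F, 1 ≤ dg G F v → f v ≤ dg G F v - 2 + p v) :
    ∃ n i : ℕ, n + i = F.card ∧ (n = 0 → ee G F F = 0 ∧ ∑ v ∈ F, f v ≤ -i) ∧
      (1 ≤ n → ee G F F + 2 ≤ 2 * n ∧ ∑ v ∈ F, f v ≤ ee G F F - 2 * n + ∑ v ∈ F, p v - i) := by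
  set N := F.filter fun v => 1 ≤ dg G F v with hN
  set I := F.filter fun v => ¬ 1 ≤ dg G F v with hI
  have hd0 : ∀ v ∈ I, dg G F v = 0 := by
    intro v hv
    have := (mem_filter.1 hv).2
    omega
  have hs : ∀ g : V → ℤ, ∑ v ∈ F, g v = ∑ v ∈ N, g v + ∑ v ∈ I, g v := fun g =>
    (sum_filter_add_sum_filter_not F _ g).symm
  have hfI : ∑ v ∈ I, f v ≤ -(I.card : ℤ) := by
    have : ∑ v ∈ I, f v ≤ ∑ v ∈ I, (-1 : ℤ) :=
      sum_le_sum fun v hv => h0 v (mem_filter.1 hv).1 (hd0 v hv)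
    simpa using this
  have hNF : N ⊆ F := filter_subset _ _
  have hee : (ee G F F : ℤ) = ∑ v ∈ N, (dg G F v : ℤ) := by
    have h2 := hs (fun v => (dg G F v : ℤ))
    have h3 : ∑ v ∈ I, (dg G F v : ℤ) = 0 := sum_eq_zero fun v hv => by simp [hd0 v hv]
    rw [h3, add_zero] at h2
    rw [← h2]
    simp [ee]
  have hdN : ∀ v ∈ N, dg G F v = dg G N v := by
    intro v hv
    unfold dg
    congr 1
    ext u
    simp only [mem_filter, hN]
    refine ⟨fun h => ⟨⟨h.1, dg_pos_iff.2 ⟨v, hNF hv, h.2.symm⟩⟩, h.2⟩, fun h => ⟨h.1.1, h.2⟩⟩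
  refine ⟨N.card, I.card, card_filter_add_card_filter_not (s := F) _, fun hn => ?_, fun hn => ?_⟩
  · rw [card_eq_zero] at hn
    rw [hn, sum_empty] at hee
    have := hs f
    rw [hn, sum_empty] at this
    omega
  · have hle := (hF.subset hNF).ee_le (card_pos.1 hn)
    have h2 : (ee G N N : ℤ) = ∑ v ∈ N, (dg G F v : ℤ) := by
      simp only [ee]
      push_cast
      exact sum_congr rfl fun v hv => by rw [hdN v hv]
    refine ⟨by omega, ?_⟩
    have h3 : ∑ v ∈ N, f v ≤ ∑ v ∈ N, ((dg G F v : ℤ) - 2 + p v) :=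
      sum_le_sum fun v hv => h1 v (hNF hv) (mem_filter.1 hv).2
    rw [sum_add_distrib, sum_sub_distrib, sum_const, nsmul_eq_mul] at h3
    have h4 : ∑ v ∈ N, p v ≤ ∑ v ∈ F, p v :=
      sum_le_sum_of_subset_of_nonneg hNF fun v hv _ => hp v hv
    have := hs f
    linarith

lemma Sq.not_hasKFive (hn : ¬ DC G 3 S) (hNT : NT G S) (hW : 6 ≤ W G S 3) {x y z w : V}
    (h : Sq G S x y z w) (hgood : ∀ u ∈ S \ {x, y, z, w}, dg G {x, y, z, w} u ≤ 2)
    (hC2 : wt 3 (dg G S x) + wt 3 (dg G S y) + wt 3 (dg G S z) + wt 3 (dg G S w) ≤ 2) :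
    ¬ HasKFive G (S \ {x, y, z, w}) := by
  rintro ⟨K, hK, h5, hadj⟩
  set C : Finset V := {x, y, z, w} with hC
  set F := (S \ C) \ K with hFdef
  have hn2 : ¬ DC G 2 (S \ C) := fun h2 => hn (DC.succ h.cyc h.subset h2)
  have hKS : K ⊆ S := hK.trans sdiff_subset
  obtain ⟨a, b, c, ht⟩ := exists_triangle_of_complete (by omega : 3 ≤ K.card) hadj
  have hF : Acyc G F := (acyc_sdiff hn2 (ht.mono hK).subset ht.cyc).subset
    (sdiff_subset_sdiff Subset.rfl ht.subset)
  have hsplit : ∀ v, dg G S v = dg G F v + dg G K v + dg G C v := fun v => by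
    rw [dg_sdiff h.subset, dg_sdiff hK]
  have hsum : W G S 3 = ∑ v ∈ F, wt 3 (dg G S v) + ∑ v ∈ K, wt 3 (dg G S v) +
      ∑ v ∈ C, wt 3 (dg G S v) := by
    rw [sum_sdiff hK, sum_sdiff h.subset]
    rfl
  have hKd : ∀ v ∈ S, v ∉ K → dg G K v ≤ 1 := fun v => hNT.dg_complete_le_one hKS h5 hadj
  have hsumK : ∑ v ∈ K, wt 3 (dg G S v) ≤ 5 := by
    have : ∑ v ∈ K, wt 3 (dg G S v) ≤ ∑ v ∈ K, (1 : ℤ) := sum_le_sum fun v _ => wt_le_one 3 _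
    simpa [h5] using this
  rw [h.sum_eq] at hsum
  have hFd : ∀ v ∈ F, dg G S v ≤ dg G F v + 3 := by
    intro v hv
    obtain ⟨hvJ, hvK⟩ := mem_sdiff.1 hv
    have h1 := hKd v (mem_sdiff.1 hvJ).1 hvK
    have h2 := hgood v hvJ
    have h3 := hsplit v
    omega
  obtain ⟨n, i, hni, hn0, hn1⟩ := hF.sum_le (fun v => wt 3 (dg G S v)) (fun _ => 0)
    (fun _ _ => le_rfl)
    (fun v hv hd => by
      have := hFd v hv
      rw [wt_eq_neg (by omega)])
    (fun v hv hd => by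
      have := hFd v hv
      unfold wt
      split_ifs <;> omega)
  rw [sum_const_zero] at hn1
  have hcard : F.card ≤ 1 := by omega
  have hlow : ∀ v ∈ C, dg G C v ≤ 2 → wt 3 (dg G S v) = -1 := by
    intro v hv hd
    have hvK : v ∉ K := fun h => (mem_sdiff.1 (hK h)).2 hv
    have h1 := hKd v (h.subset hv) hvK
    have h2 := hsplit v
    have h3 : dg G F v ≤ F.card := dg_le_card ..
    exact wt_eq_neg (by omega)
  obtain ⟨-, -, -, -, hxz, hyw⟩ := id h
  have hzx : ¬ G.Adj z x := fun h => hxz h.symm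
  have hwy : ¬ G.Adj w y := fun h => hyw h.symm
  have h1 := hlow x (by simp [hC]) (by rw [h.dg_eq]; simp [hxz]; split_ifs <;> omega)
  have h2 := hlow y (by simp [hC]) (by rw [h.dg_eq]; simp [hyw]; split_ifs <;> omega)
  have h3 := hlow z (by simp [hC]) (by rw [h.dg_eq]; simp [hzx]; split_ifs <;> omega)
  have h4 := hlow w (by simp [hC]) (by rw [h.dg_eq]; simp [hwy]; split_ifs <;> omega)
  omega

lemma NT.elim (hNT : NT G S) {a b c d e f : V} (h : Tri G S a b c) (h' : Tri G S d e f)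
    (had : a ≠ d) (hae : a ≠ e) (haf : a ≠ f) (hbd : b ≠ d) (hbe : b ≠ e) (hbf : b ≠ f)
    (hcd : c ≠ d) (hce : c ≠ e) (hcf : c ≠ f) : False := by
  rcases hNT a b c d e f h h' with h | h | h | h | h | h | h | h | h <;>
    first | exact had h | exact hae h | exact haf h | exact hbd h | exact hbe h | exact hbf h |
      exact hcd h | exact hce h | exact hcf h

lemma ite_add_ite_le_one {P Q : Prop} (h : ¬ (P ∧ Q)) :
    (if P then 1 else 0) + (if Q then 1 else 0) ≤ 1 := by
  split_ifs <;> simp_all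

/-- `p q r s t` with `u` induce a complete graph on five vertices with the edge `p q` subdivided
by `u`, and `F` is disjoint from `p q r s t`. -/
structure SubKFive (G : SimpleGraph V) (J F : Finset V) (p q r s t u : V) : Prop where
  p_mem : p ∈ J
  q_mem : q ∈ J
  r_mem : r ∈ J
  s_mem : s ∈ J
  t_mem : t ∈ J
  u_mem : u ∈ F
  sub : F ⊆ J
  pr : G.Adj p r
  ps : G.Adj p s
  pt : G.Adj p t
  qr : G.Adj q r
  qs : G.Adj q s
  qt : G.Adj q t
  rs : G.Adj r s
  rt : G.Adj r t
  st : G.Adj s t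
  up : G.Adj u p
  uq : G.Adj u q
  pq : p ≠ q
  ne : ∀ v ∈ F, v ≠ p ∧ v ≠ q ∧ v ≠ r ∧ v ≠ s ∧ v ≠ t

namespace SubKFive

variable {J : Finset V} {p q r s t u : V}

lemma swap (H : SubKFive G J F p q r s t u) : SubKFive G J F q p r s t u := by
  obtain ⟨h1, h2, h3, h4, h5, h6, h7, h8, h9, h10, h11, h12, h13, h14, h15, h16, h17, h18, h19,
    h20⟩ := H
  exact ⟨h2, h1, h3, h4, h5, h6, h7, h11, h12, h13, h8, h9, h10, h14, h15, h16, h18, h17, h19.symm,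
    fun v hv => ⟨(h20 v hv).2.1, (h20 v hv).1, (h20 v hv).2.2⟩⟩

lemma rot (H : SubKFive G J F p q r s t u) : SubKFive G J F p q s t r u := by
  obtain ⟨h1, h2, h3, h4, h5, h6, h7, h8, h9, h10, h11, h12, h13, h14, h15, h16, h17, h18, h19,
    h20⟩ := H
  exact ⟨h1, h2, h4, h5, h3, h6, h7, h9, h10, h8, h12, h13, h11, h16, h14.symm, h15.symm, h17, h18,
    h19, fun v hv => ⟨(h20 v hv).1, (h20 v hv).2.1, (h20 v hv).2.2.2.1, (h20 v hv).2.2.2.2,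
      (h20 v hv).2.2.1⟩⟩

lemma dg_eq (H : SubKFive G J F p q r s t u) (v : V) : dg G {p, q, r, s, t} v =
    (if G.Adj v p then 1 else 0) + ((if G.Adj v q then 1 else 0) +
      ((if G.Adj v r then 1 else 0) + (if G.Adj v s then 1 else 0) +
        (if G.Adj v t then 1 else 0))) := by
  have h1 := H.pr.ne
  have h2 := H.ps.ne
  have h3 := H.pt.ne
  have h4 := H.qr.ne
  have h5 := H.qs.ne
  have h6 := H.qt.ne
  have h7 := H.pq
  rw [dg_insert (by simp [*]), dg_insert (by simp [*]), dg_triple H.rs.ne H.rt.ne H.st.ne]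

lemma tri_qst (H : SubKFive G J F p q r s t u) : Tri G J q s t :=
  ⟨H.q_mem, H.s_mem, H.t_mem, H.qs, H.qt, H.st⟩

lemma tri_rst (H : SubKFive G J F p q r s t u) : Tri G J r s t :=
  ⟨H.r_mem, H.s_mem, H.t_mem, H.rs, H.rt, H.st⟩

lemma acyc_rst (H : SubKFive G J F p q r s t u) (hn : ¬ DC G 2 J) : Acyc G (J \ {r, s, t}) :=
  acyc_sdiff hn H.tri_rst.subset H.tri_rst.cyc

lemma acyc_qst (H : SubKFive G J F p q r s t u) (hn : ¬ DC G 2 J) : Acyc G (J \ {q, s, t}) :=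
  acyc_sdiff hn H.tri_qst.subset H.tri_qst.cyc

lemma insert_subset_rst (H : SubKFive G J F p q r s t u) : insert p F ⊆ J \ {r, s, t} := by
  intro v hv
  simp only [mem_sdiff, mem_insert, mem_singleton, not_or] at hv ⊢
  rcases hv with rfl | hv
  · exact ⟨H.p_mem, H.pr.ne, H.ps.ne, H.pt.ne⟩
  · exact ⟨H.sub hv, (H.ne v hv).2.2⟩

lemma insert_subset_qst (H : SubKFive G J F p q r s t u) :
    insert r (insert p F) ⊆ J \ {q, s, t} := by
  intro v hv
  simp only [mem_sdiff, mem_insert, mem_singleton, not_or] at hv ⊢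
  rcases hv with rfl | rfl | hv
  · exact ⟨H.r_mem, H.qr.ne', H.rs.ne, H.rt.ne⟩
  · exact ⟨H.p_mem, H.pq, H.ps.ne, H.pt.ne⟩
  · exact ⟨H.sub hv, (H.ne v hv).2.1, (H.ne v hv).2.2.2⟩

lemma not_adj_pr (H : SubKFive G J F p q r s t u) (hNT : NT G S) (hJ : J ⊆ S) {v : V}
    (hv : v ∈ S) (hvq : v ≠ q) (hvs : v ≠ s) (hvt : v ≠ t) : ¬ (G.Adj v p ∧ G.Adj v r) := by
  rintro ⟨h1, h2⟩
  exact hNT.elim ⟨hv, hJ H.p_mem, hJ H.r_mem, h1, h2, H.pr⟩ (H.tri_qst.mono hJ)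
    hvq hvs hvt H.pq H.ps.ne H.pt.ne H.qr.ne' H.rs.ne H.rt.ne

lemma not_adj_rs (H : SubKFive G J F p q r s t u) (hn : ¬ DC G 2 J) {v : V} (hv : v ∈ F)
    (hvu : v ≠ u) : ¬ (G.Adj v r ∧ G.Adj v s) := by
  rintro ⟨h1, h2⟩
  obtain ⟨n1, n2, n3, n4, n5⟩ := H.ne v hv
  obtain ⟨-, -, m3, m4, m5⟩ := H.ne u H.u_mem
  refine hn (DC.two (cyc_triangle h1 h2 H.rs) (cyc_square H.pt.symm H.up.symm H.uq H.qt m5.symm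
    H.pq) (triple_subset (H.sub hv) H.r_mem H.s_mem)
    (quad_subset H.t_mem H.p_mem (H.sub H.u_mem) H.q_mem) ?_)
  simp only [disjoint_insert_left, disjoint_singleton_left, mem_insert, mem_singleton, not_or]
  exact ⟨⟨n5, n1, hvu, n2⟩, ⟨H.rt.ne, H.pr.ne', m3.symm, H.qr.ne'⟩, H.st.ne, H.ps.ne', m4.symm,
    H.qs.ne'⟩

lemma not_adj_pq (H : SubKFive G J F p q r s t u) (hn : ¬ DC G 2 J) {v : V} (hv : v ∈ F)
    (hvu : v ≠ u) : ¬ (G.Adj v p ∧ G.Adj v q) := by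
  rintro ⟨h1, h2⟩
  have hsub : insert q (insert p F) ⊆ J \ {r, s, t} :=
    insert_subset (H.swap.insert_subset_rst (mem_insert_self ..)) H.insert_subset_rst
  refine H.acyc_rst hn _ (Subset.trans ?_ hsub) (cyc_square h1 H.up.symm H.uq h2.symm hvu H.pq)
  intro a ha
  simp only [mem_insert, mem_singleton] at ha ⊢
  rcases ha with rfl | rfl | rfl | rfl
  · exact .inr (.inr hv)
  · simp
  · exact .inr (.inr H.u_mem)
  · simp

lemma dg_le_one (H : SubKFive G J F p q r s t u) (hn : ¬ DC G 2 J) (hNT : NT G S) (hJ : J ⊆ S)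
    {v : V} (hv : v ∈ F) (hvu : v ≠ u) : dg G {p, q, r, s, t} v ≤ 1 := by
  obtain ⟨n1, n2, n3, n4, n5⟩ := H.ne v hv
  have hvS := hJ (H.sub hv)
  have h1 := ite_add_ite_le_one (H.not_adj_pr hNT hJ hvS n2 n4 n5)
  have h2 := ite_add_ite_le_one (H.rot.not_adj_pr hNT hJ hvS n2 n5 n3)
  have h3 := ite_add_ite_le_one (H.rot.rot.not_adj_pr hNT hJ hvS n2 n3 n4)
  have h4 := ite_add_ite_le_one (H.swap.not_adj_pr hNT hJ hvS n1 n4 n5)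
  have h5 := ite_add_ite_le_one (H.swap.rot.not_adj_pr hNT hJ hvS n1 n5 n3)
  have h6 := ite_add_ite_le_one (H.swap.rot.rot.not_adj_pr hNT hJ hvS n1 n3 n4)
  have h7 := ite_add_ite_le_one (H.not_adj_rs hn hv hvu)
  have h8 := ite_add_ite_le_one (H.rot.not_adj_rs hn hv hvu)
  have h9 := ite_add_ite_le_one (H.rot.rot.not_adj_rs hn hv hvu)
  have h10 := ite_add_ite_le_one (H.not_adj_pq hn hv hvu)
  rw [H.dg_eq]
  omega

lemma dg_le_two (H : SubKFive G J F p q r s t u) (hNT : NT G S) (hJ : J ⊆ S) :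
    dg G {p, q, r, s, t} u ≤ 2 := by
  obtain ⟨n1, n2, n3, n4, n5⟩ := H.ne u H.u_mem
  have huS := hJ (H.sub H.u_mem)
  have h1 := fun h => H.not_adj_pr hNT hJ huS n2 n4 n5 ⟨H.up, h⟩
  have h2 := fun h => H.rot.not_adj_pr hNT hJ huS n2 n5 n3 ⟨H.up, h⟩
  have h3 := fun h => H.rot.rot.not_adj_pr hNT hJ huS n2 n3 n4 ⟨H.up, h⟩
  rw [H.dg_eq, if_neg h1, if_neg h2, if_neg h3]
  split_ifs <;> omega

end SubKFive

lemma Acyc.dg_le_one_of_tight {v : V} (h : Acyc G (insert v F)) (hv : v ∉ F)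
    (ht : 2 * F.card ≤ ee G F F + 2) : dg G F v ≤ 1 := by
  have h1 := h.ee_le (insert_nonempty ..)
  rw [ee_insert_self hv, card_insert_of_notMem hv] at h1
  omega

namespace SubKFive

variable {J : Finset V} {p q r s t u : V}

lemma dg_p_eq (H : SubKFive G J F p q r s t u) (hn : ¬ DC G 2 J)
    (ht : 2 * F.card ≤ ee G F F + 2) : dg G F p = 1 := by
  have h1 := Acyc.dg_le_one_of_tight ((H.acyc_rst hn).subset H.insert_subset_rst)
    (fun h => (H.ne p h).1 rfl) ht
  have h2 : 1 ≤ dg G F p := dg_pos_iff.2 ⟨u, H.u_mem, H.up.symm⟩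
  omega

lemma dg_r_eq (H : SubKFive G J F p q r s t u) (hn : ¬ DC G 2 J)
    (ht : 2 * F.card ≤ ee G F F + 2) : dg G F r = 0 := by
  have hpF : p ∉ F := fun h => (H.ne p h).1 rfl
  have hrF : r ∉ insert p F := by
    rw [mem_insert, not_or]
    exact ⟨H.pr.ne', fun h => (H.ne r h).2.2.1 rfl⟩
  have h1 := H.dg_p_eq hn ht
  have h2 := Acyc.dg_le_one_of_tight ((H.acyc_qst hn).subset H.insert_subset_qst) hrF (by
    rw [ee_insert_self hpF, card_insert_of_notMem hpF]
    omega)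
  rw [dg_insert hpF, if_pos H.pr.symm] at h2
  omega

end SubKFive

/-- A vertex off an induced four-cycle, avoiding a triangle off the four-cycle, is joined to
opposite vertices of the four-cycle. -/
lemma Sq.opposite (hNT : NT G S) {x y z w : V} (h : Sq G S x y z w) (hxt : ¬ InTri G S x)
    {v a b c : V} (hv : v ∈ S \ {x, y, z, w}) (ht : Tri G (S \ {x, y, z, w}) a b c)
    (hva : v ≠ a) (hvb : v ≠ b) (hvc : v ≠ c) (hd : 2 ≤ dg G {x, y, z, w} v) :
    (G.Adj v x ∧ G.Adj v z ∧ ¬ G.Adj v y ∧ ¬ G.Adj v w) ∨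
      (G.Adj v y ∧ G.Adj v w ∧ ¬ G.Adj v x ∧ ¬ G.Adj v z) := by
  obtain ⟨⟨hx, hy, hz, hw⟩, ⟨hxy, hyz, hzw, hwx⟩, -⟩ := id h
  have hvS := (mem_sdiff.1 hv).1
  have hC : ∀ g ∈ ({x, y, z, w} : Finset V), g ≠ a ∧ g ≠ b ∧ g ≠ c := by
    intro g hg
    refine ⟨?_, ?_, ?_⟩ <;> rintro rfl
    · exact (mem_sdiff.1 ht.1).2 hg
    · exact (mem_sdiff.1 ht.2.1).2 hg
    · exact (mem_sdiff.1 ht.2.2.1).2 hg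
  obtain ⟨y1, y2, y3⟩ := hC y (by simp)
  obtain ⟨z1, z2, z3⟩ := hC z (by simp)
  obtain ⟨w1, w2, w3⟩ := hC w (by simp)
  have ht' := ht.mono (sdiff_subset (s := S))
  have h1 : ¬ (G.Adj v x ∧ G.Adj v y) := fun ⟨e1, e2⟩ => hxt ⟨v, hvS, y, hy, e1.symm, hxy, e2⟩
  have h2 : ¬ (G.Adj v x ∧ G.Adj v w) := fun ⟨e1, e2⟩ => hxt ⟨v, hvS, w, hw, e1.symm, hwx.symm, e2⟩
  have h3 : ¬ (G.Adj v y ∧ G.Adj v z) := fun ⟨e1, e2⟩ =>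
    hNT.elim ⟨hvS, hy, hz, e1, e2, hyz⟩ ht' hva hvb hvc y1 y2 y3 z1 z2 z3
  have h4 : ¬ (G.Adj v z ∧ G.Adj v w) := fun ⟨e1, e2⟩ =>
    hNT.elim ⟨hvS, hz, hw, e1, e2, hzw⟩ ht' hva hvb hvc z1 z2 z3 w1 w2 w3
  rw [h.dg_eq] at hd
  clear * - hd h1 h2 h3 h4
  split_ifs at hd <;> first | omega | tauto

lemma HasSubdividedKFive.exists_subKFive (h : HasSubdividedKFive G S) (hn : ¬ HasKFive G S) :
    ∃ p q r s t u, {p, q, r, s, t} ⊆ S ∧ ¬ G.Adj p q ∧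
      SubKFive G S (S \ {p, q, r, s, t}) p q r s t u := by
  obtain ⟨K, hK, h5, p, hp, q, hq, hpq, ⟨u, hu, huK, hup, huq⟩, hadj⟩ := h
  obtain ⟨r, s, t, hrs, hrt, hst, hR⟩ : ∃ r s t, r ≠ s ∧ r ≠ t ∧ s ≠ t ∧
      (K.erase p).erase q = {r, s, t} := by
    rw [← card_eq_three, card_erase_of_mem (mem_erase.2 ⟨hpq.symm, hq⟩), card_erase_of_mem hp, h5]
  have hRm : ∀ v, v ∈ ({r, s, t} : Finset V) → v ≠ q ∧ v ≠ p ∧ v ∈ K := by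
    intro v hv
    rw [← hR, mem_erase, mem_erase] at hv
    exact hv
  obtain ⟨hrq, hrp, hr⟩ := hRm r (by simp)
  obtain ⟨hsq, hsp, hs⟩ := hRm s (by simp)
  obtain ⟨htq, htp, ht⟩ := hRm t (by simp)
  have hKeq : K = {p, q, r, s, t} := by
    rw [← insert_erase hp, ← insert_erase (mem_erase.2 ⟨hpq.symm, hq⟩), hR]
  refine ⟨p, q, r, s, t, u, hKeq ▸ hK, fun hpq' => hn ⟨K, hK, h5, fun a ha b hb hab => ?_⟩, ?_⟩
  · by_cases h1 : a = p ∧ b = q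
    · rw [h1.1, h1.2]
      exact hpq'
    by_cases h2 : a = q ∧ b = p
    · rw [h2.1, h2.2]
      exact hpq'.symm
    exact hadj a ha b hb hab h1 h2
  · rw [← hKeq]
    exact {
      p_mem := hK hp
      q_mem := hK hq
      r_mem := hK hr
      s_mem := hK hs
      t_mem := hK ht
      u_mem := mem_sdiff.2 ⟨hu, huK⟩
      sub := sdiff_subset
      pr := hadj p hp r hr hrp.symm (fun h => hrq h.2) (fun h => hpq h.1)
      ps := hadj p hp s hs hsp.symm (fun h => hsq h.2) (fun h => hpq h.1)
      pt := hadj p hp t ht htp.symm (fun h => htq h.2) (fun h => hpq h.1)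
      qr := hadj q hq r hr hrq.symm (fun h => hpq h.1.symm) (fun h => hrp h.2)
      qs := hadj q hq s hs hsq.symm (fun h => hpq h.1.symm) (fun h => hsp h.2)
      qt := hadj q hq t ht htq.symm (fun h => hpq h.1.symm) (fun h => htp h.2)
      rs := hadj r hr s hs hrs (fun h => hrp h.1) (fun h => hrq h.1)
      rt := hadj r hr t ht hrt (fun h => hrp h.1) (fun h => hrq h.1)
      st := hadj s hs t ht hst (fun h => hsp h.1) (fun h => hsq h.1)
      up := hup
      uq := huq
      pq := hpq
      ne := fun v hv => by
        have := (mem_sdiff.1 hv).2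
        rw [hKeq] at this
        simpa [not_or] using this }

namespace SubKFive

variable {p q r s t u x y z w : V}

/-- Vertices of the subdivided graph with two neighbours on the four-cycle are attached to it in
one way. -/
lemma attached (H : SubKFive G (S \ {x, y, z, w}) F p q r s t u) (hNT : NT G S)
    (h : Sq G S x y z w) (hxt : ¬ InTri G S x) (hp : 2 ≤ dg G {x, y, z, w} p)
    (hr : 2 ≤ dg G {x, y, z, w} r) (hs : 2 ≤ dg G {x, y, z, w} s) :
    G.Adj p x ∧ G.Adj r y ∧ G.Adj r w ∧ ¬ G.Adj r z := by
  have hC : ∀ g ∈ S \ {x, y, z, w}, y ≠ g := by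
    rintro g hg rfl
    exact (mem_sdiff.1 hg).2 (by simp)
  have hJ : S \ {x, y, z, w} ⊆ S := sdiff_subset
  have op := h.opposite hNT hxt H.p_mem H.tri_qst H.pq H.ps.ne H.pt.ne hp
  have or' := h.opposite hNT hxt H.r_mem H.tri_qst H.qr.ne' H.rs.ne H.rt.ne hr
  have os := h.opposite hNT hxt H.s_mem H.rot.tri_qst H.qs.ne' H.st.ne H.rs.ne' hs
  have nx : ∀ a ∈ S \ {x, y, z, w}, ∀ b ∈ S \ {x, y, z, w}, G.Adj a b → G.Adj a x → ¬ G.Adj b x :=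
    fun a ha b hb hab hax hbx => hxt ⟨a, hJ ha, b, hJ hb, hax.symm, hbx.symm, hab⟩
  have nrp := nx r H.r_mem p H.p_mem H.pr.symm
  have nrs := nx r H.r_mem s H.s_mem H.rs
  have n1 := H.not_adj_pr hNT hJ h.1.2.1 (hC q H.q_mem) (hC s H.s_mem) (hC t H.t_mem)
  have n2 := H.rot.not_adj_pr hNT hJ h.1.2.1 (hC q H.q_mem) (hC t H.t_mem) (hC r H.r_mem)
  rw [G.adj_comm, G.adj_comm y] at n1 n2
  clear * - op or' os nrp nrs n1 n2
  tauto

/-- The remaining forest and the four-cycle, with the triangle-free part of the subdivided graph,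
contain three cycles. -/
lemma dc_three (H : SubKFive G (S \ {x, y, z, w}) F p q r s t u) (h : Sq G S x y z w)
    (hpx : G.Adj p x) (hry : G.Adj r y) (hsy : G.Adj s y) (htw : G.Adj t w)
    (hz : ¬ Acyc G (insert z F)) : DC G 3 S := by
  obtain ⟨⟨hx, hy, hzS, hw⟩, ⟨hxy, hyz, hzw, hwx⟩, hxz, hyw, -⟩ := id h
  have hC : ∀ g ∈ S \ {x, y, z, w}, g ≠ x ∧ g ≠ y ∧ g ≠ z ∧ g ≠ w := by
    intro g hg
    simpa [not_or] using (mem_sdiff.1 hg).2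
  have hJ : S \ {x, y, z, w} ⊆ S := sdiff_subset
  obtain ⟨Z, hZ, hcyc⟩ : ∃ Z ⊆ insert z F, Cyc G Z := by
    unfold Acyc at hz
    push Not at hz
    exact hz
  have cp := hC p H.p_mem
  have cr := hC r H.r_mem
  have cs := hC s H.s_mem
  have ct := hC t H.t_mem
  refine DC.three (cyc_triangle hry.symm hsy.symm H.rs)
    (cyc_square H.pt htw hwx hpx.symm cp.2.2.2 ct.1) hcyc
    (triple_subset hy (hJ H.r_mem) (hJ H.s_mem)) (quad_subset (hJ H.p_mem) (hJ H.t_mem) hw hx)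
    (hZ.trans (insert_subset hzS (H.sub.trans hJ))) ?_ (disjoint_of_subset_right hZ ?_)
    (disjoint_of_subset_right hZ ?_)
  · simp only [disjoint_insert_left, disjoint_singleton_left, mem_insert, mem_singleton, not_or]
    exact ⟨⟨cp.2.1.symm, ct.2.1.symm, hyw, hxy.ne'⟩, ⟨H.pr.ne', H.rt.ne, cr.2.2.2, cr.1⟩,
      H.ps.ne', H.st.ne, cs.2.2.2, cs.1⟩
  · rw [disjoint_right]
    intro v hv
    simp only [mem_insert, mem_singleton, not_or] at hv ⊢
    rcases hv with rfl | hv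
    · exact ⟨hyz.ne', cr.2.2.1.symm, cs.2.2.1.symm⟩
    · exact ⟨(hC v (H.sub hv)).2.1, (H.ne v hv).2.2.1, (H.ne v hv).2.2.2.1⟩
  · rw [disjoint_right]
    intro v hv
    simp only [mem_insert, mem_singleton, not_or] at hv ⊢
    rcases hv with rfl | hv
    · exact ⟨cp.2.2.1.symm, ct.2.2.1.symm, hzw.ne, hxz.symm⟩
    · exact ⟨(H.ne v hv).1, (H.ne v hv).2.2.2.2, (hC v (H.sub hv)).2.2.2, (hC v (H.sub hv)).1⟩

end SubKFive

lemma Sq.not_hasSubdividedKFive (hn : ¬ DC G 3 S) (hNT : NT G S) (hW : 6 ≤ W G S 3) {x y z w : V}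
    (h : Sq G S x y z w) (hgood : ∀ u ∈ S \ {x, y, z, w}, dg G {x, y, z, w} u ≤ 2)
    (hdx : dg G S x ≤ 4) (hxt : ¬ InTri G S x) : ¬ HasSubdividedKFive G (S \ {x, y, z, w}) := by
  intro hsub
  have hwle := fun v => wt_le_one 3 (dg G S v)
  have hwx : wt 3 (dg G S x) = -1 := wt_eq_neg (by omega)
  have hnK5 := h.not_hasKFive hn hNT hW hgood (by
    have := hwle y
    have := hwle z
    have := hwle w
    omega)
  obtain ⟨p, q, r, s, t, u, hK, hpq, H⟩ := hsub.exists_subKFive hnK5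
  set J := S \ {x, y, z, w} with hJdef
  set K : Finset V := {p, q, r, s, t} with hKdef
  set F := J \ K with hFdef
  have hn2 : ¬ DC G 2 J := fun h2 => hn (DC.succ h.cyc h.subset h2)
  have hJS : J ⊆ S := sdiff_subset
  have hsplit : ∀ v, dg G S v = dg G F v + dg G K v + dg G {x, y, z, w} v := fun v => by
    rw [dg_sdiff h.subset, dg_sdiff hK]
  have hFK : F ⊆ J \ {r, s, t} := (subset_insert _ _).trans H.insert_subset_rst
  have hF : Acyc G F := (H.acyc_rst hn2).subset hFK
  have hFu : ∀ v ∈ F, dg G S v ≤ dg G F v + 3 + if v = u then 1 else 0 := by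
    intro v hv
    have h1 := hgood v (H.sub hv)
    have h2 := hsplit v
    split_ifs with hvu
    · have h3 : dg G K v ≤ 2 := hvu ▸ H.dg_le_two hNT hJS
      omega
    · have h3 : dg G K v ≤ 1 := H.dg_le_one hn2 hNT hJS hv hvu
      omega
  have hsum : W G S 3 = ∑ v ∈ F, wt 3 (dg G S v) + ∑ v ∈ K, wt 3 (dg G S v) +
      ∑ v ∈ {x, y, z, w}, wt 3 (dg G S v) := by
    rw [sum_sdiff hK, sum_sdiff h.subset]
    rfl
  have hsumK : ∑ v ∈ K, wt 3 (dg G S v) = wt 3 (dg G S p) + wt 3 (dg G S q) + wt 3 (dg G S r) +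
      wt 3 (dg G S s) + wt 3 (dg G S t) :=
    sum_quint _ H.pq H.pr.ne H.ps.ne H.pt.ne H.qr.ne H.qs.ne H.qt.ne H.rs.ne H.rt.ne H.st.ne
  rw [h.sum_eq, hsumK, hwx] at hsum
  obtain ⟨n, i, hni, hn0, hn1⟩ := hF.sum_le (fun v => wt 3 (dg G S v))
    (fun v => if v = u then 1 else 0) (fun v _ => by split_ifs <;> omega)
    (fun v hv hd => by
      have := hFu v hv
      rw [wt_eq_neg (by split_ifs at this <;> omega)])
    (fun v hv hd => by
      have := hFu v hv
      unfold wt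
      split_ifs at this ⊢ <;> omega)
  rw [sum_ite_eq' F u, if_pos H.u_mem] at hn1
  have hFc : 1 ≤ F.card := card_pos.2 ⟨u, H.u_mem⟩
  have wp := hwle p
  have wq := hwle q
  have wr := hwle r
  have ws := hwle s
  have wtt := hwle t
  have wy := hwle y
  have wz := hwle z
  have ww := hwle w
  have hFle : ∑ v ∈ F, wt 3 (dg G S v) ≤ -1 := by
    rcases Nat.eq_zero_or_pos n with h0 | h0
    · have := (hn0 h0).2
      omega
    · have := hn1 h0
      omega
  have htight : 2 * F.card ≤ ee G F F + 2 := by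
    rcases Nat.eq_zero_or_pos n with h0 | h0
    · have := hn0 h0
      omega
    · have := hn1 h0
      omega
  have h6 : ∀ v, wt 3 (dg G S v) = 1 → 6 ≤ dg G S v := by
    intro v hv
    unfold wt at hv
    split_ifs at hv <;> omega
  have kp : dg G K p ≤ 3 := by
    rw [H.dg_eq, if_neg G.irrefl, if_neg hpq]
    split_ifs <;> omega
  have kr : ∀ v ∈ K, dg G K v ≤ 4 := by
    intro v hv
    have h1 := dg_lt_card (G := G) hv
    have h2 : K.card ≤ 5 := card_le_five
    omega
  have fp := H.dg_p_eq hn2 htight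
  have fr := H.dg_r_eq hn2 htight
  have fs := H.rot.dg_r_eq hn2 htight
  have ft := H.rot.rot.dg_r_eq hn2 htight
  have cp : 2 ≤ dg G {x, y, z, w} p := by
    have := hsplit p
    have := h6 p (by omega)
    omega
  have cr : 2 ≤ dg G {x, y, z, w} r := by
    have := hsplit r
    have := h6 r (by omega)
    have := kr r (by simp [hKdef])
    omega
  have cs : 2 ≤ dg G {x, y, z, w} s := by
    have := hsplit s
    have := h6 s (by omega)
    have := kr s (by simp [hKdef])
    omega
  have ct : 2 ≤ dg G {x, y, z, w} t := by
    have := hsplit t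
    have := h6 t (by omega)
    have := kr t (by simp [hKdef])
    omega
  obtain ⟨apx, ary, -, arz⟩ := H.attached hNT h hxt cp cr cs
  obtain ⟨-, asy, -, asz⟩ := H.rot.attached hNT h hxt cp cs ct
  obtain ⟨-, -, atw, atz⟩ := H.rot.rot.attached hNT h hxt cp ct cr
  refine hn (H.dc_three h apx ary asy atw fun hz => ?_)
  have hzF : z ∉ F := fun hzF => (mem_sdiff.1 (H.sub hzF)).2 (by simp)
  have z1 := hz.dg_le_one_of_tight hzF htight
  have z2 : dg G K z ≤ 2 := by
    rw [H.dg_eq, if_neg (fun hh : G.Adj z r => arz hh.symm),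
      if_neg (fun hh : G.Adj z s => asz hh.symm), if_neg (fun hh : G.Adj z t => atz hh.symm)]
    split_ifs <;> omega
  have z3 : dg G {x, y, z, w} z ≤ 2 := by
    rw [h.dg_eq, if_neg (fun hh => h.2.2.2.2.1 hh.symm), if_neg (G.irrefl (v := z))]
    split_ifs <;> omega
  have := hsplit z
  have := h6 z (by omega)
  omega

lemma DC.of_good_square (hk : 2 ≤ k) (hB : 3 ≤ k → NTBound V k) (hNT : NT G S)
    (hW : 2 * ((k : ℤ) + 1) ≤ W G S (k + 1)) {x y z w : V} (h : Sq G S x y z w)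
    (hgood : ∀ u ∈ S \ {x, y, z, w}, dg G {x, y, z, w} u ≤ 2) (hdx : dg G S x ≤ 2 * k)
    (hxt : ¬ InTri G S x) : DC G (k + 1) S := by
  by_cases hk3 : 3 ≤ k
  · exact (hB hk3).of_square hNT hW h hgood hdx
  obtain rfl : k = 2 := by omega
  by_contra hn
  have hW' : 6 ≤ W G S 3 := by
    norm_num at hW
    exact hW
  have hwle := fun v => wt_le_one 3 (dg G S v)
  have hwx : wt 3 (dg G S x) = -1 := wt_eq_neg (by omega)
  have hC : wt 3 (dg G S x) + wt 3 (dg G S y) + wt 3 (dg G S z) + wt 3 (dg G S w) ≤ 2 := by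
    have := hwle y
    have := hwle z
    have := hwle w
    omega
  have h4 := h.le_W_sdiff (k := 2) hgood
  norm_num at h4
  rcases (structure_of_not_dc_two (fun h2 => hn (DC.succ h.cyc h.subset h2)) (by omega)).1 with
    h5 | h5
  · exact h.not_hasKFive hn hNT hW' hgood hC h5
  · exact h.not_hasSubdividedKFive hn hNT hW' hgood (by omega) hxt h5

/-- An induced four-cycle `x y z w`, with `x` of low degree, and a disjoint triangle `v e f` such
that `v` is adjacent to `y`, `z` and `w`. -/
structure BadSq (G : SimpleGraph V) (S : Finset V) (k : ℕ) (x y z w v e f : V) : Prop where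
  sq : Sq G S x y z w
  tri : Tri G (S \ {x, y, z, w}) v e f
  vy : G.Adj v y
  vz : G.Adj v z
  vw : G.Adj v w
  low : dg G S x ≤ 2 * k
  not_inTri : ∀ u ∈ S, dg G S u ≤ 2 * k → ¬ InTri G S u

namespace BadSq

variable {x y z w v e f : V}

lemma not_tri (H : BadSq G S k x y z w v e f) {a b : V} (ha : a ∈ S) (hb : b ∈ S)
    (hax : G.Adj a x) (hbx : G.Adj b x) : ¬ G.Adj a b :=
  fun hab => H.not_inTri x H.sq.1.1 H.low ⟨a, ha, b, hb, hax.symm, hbx.symm, hab⟩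

lemma ne_square (H : BadSq G S k x y z w v e f) :
    ∀ g ∈ ({v, e, f} : Finset V), g ≠ x ∧ g ≠ y ∧ g ≠ z ∧ g ≠ w := by
  intro g hg
  simpa [not_or] using (mem_sdiff.1 (H.tri.subset hg)).2

lemma vx (H : BadSq G S k x y z w v e f) : ¬ G.Adj v x := fun h =>
  H.not_tri (mem_sdiff.1 H.tri.1).1 H.sq.1.2.1 h H.sq.2.1.1.symm H.vy

lemma tri' (H : BadSq G S k x y z w v e f) : Tri G S v e f := H.tri.mono sdiff_subset

lemma tri_yzv (H : BadSq G S k x y z w v e f) : Tri G S y z v :=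
  ⟨H.sq.1.2.1, H.sq.1.2.2.1, H.tri'.1, H.sq.2.1.2.1, H.vy.symm, H.vz.symm⟩

lemma tri_wzv (H : BadSq G S k x y z w v e f) : Tri G S w z v :=
  ⟨H.sq.1.2.2.2, H.sq.1.2.2.1, H.tri'.1, H.sq.2.1.2.2.1.symm, H.vw.symm, H.vz.symm⟩

/-- The only possible common neighbour of `e` and `f` other than `v` is `z`. -/
lemma eq_z (H : BadSq G S k x y z w v e f) (hNT : NT G S) {u : V} (hu : u ∈ S) (huv : u ≠ v)
    (hue : G.Adj u e) (huf : G.Adj u f) : u = z := by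
  by_contra huz
  obtain ⟨-, -, -, hve, hvf, hef⟩ := H.tri
  have ce := H.ne_square e (by simp)
  have cf := H.ne_square f (by simp)
  have ht : Tri G S u e f := ⟨hu, H.tri'.2.1, H.tri'.2.2.1, hue, huf, hef⟩
  by_cases huy : u = y
  · subst huy
    exact hNT.elim ht H.tri_wzv H.sq.2.2.2.1 huz huv ce.2.2.2 ce.2.2.1 hve.ne' cf.2.2.2 cf.2.2.1
      hvf.ne'
  · exact hNT.elim ht H.tri_yzv huy huz huv ce.2.1 ce.2.2.1 hve.ne' cf.2.1 cf.2.2.1 hvf.ne'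

lemma two_le_dg (H : BadSq G S k x y z w v e f) {T : Finset V} (hy : y ∈ T) (hw : w ∈ T) :
    2 ≤ dg G T x :=
  two_le_dg_iff.2 ⟨y, hy, w, hw, H.sq.2.2.2.1, H.sq.2.1.1, H.sq.2.1.2.2.2.symm⟩

lemma dc_of_not_adj (H : BadSq G S k x y z w v e f) (hA : StarBound V k) (hk : 2 ≤ k)
    (hNT : NT G S) (hW : 2 * ((k : ℤ) + 1) ≤ W G S (k + 1)) (hz : ¬ (G.Adj z e ∧ G.Adj z f)) :
    DC G (k + 1) S := by
  have hA0 : ((S \ {v, e, f}).filter fun g => G.Adj g v ∧ G.Adj g e ∧ G.Adj g f) = ∅ := by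
    refine filter_eq_empty_iff.2 fun g hg ⟨h1, h2, h3⟩ => hz ?_
    obtain rfl := H.eq_z hNT (mem_sdiff.1 hg).1 h1.ne h2 h3
    exact ⟨h2, h3⟩
  have hmem : ∀ g ∈ ({x, y, z, w} : Finset V), g ∈ S \ {v, e, f} := fun g hg =>
    mem_sdiff.2 ⟨H.sq.subset hg, fun hg' => (mem_sdiff.1 (H.tri.subset hg')).2 hg⟩
  refine hA.of_tri_of_low (x := x) hk hNT hW H.tri' ?_ (hmem x (by simp)) (fun h => H.vx h.1.symm)
    H.low ?_
  · rw [hA0, card_empty]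
    have := wt_le_one (k + 1) (dg G S v)
    have := wt_le_one (k + 1) (dg G S e)
    have := wt_le_one (k + 1) (dg G S f)
    omega
  · have := H.two_le_dg (hmem y (by simp)) (hmem w (by simp))
    omega

/-- Bounds on the numbers of neighbours on the four-cycle and on the triangle. -/
lemma loss (H : BadSq G S k x y z w v e f) (hNT : NT G S) (hze : G.Adj z e) (hzf : G.Adj z f)
    {g : V} (hg : g ∈ (S \ {x, y, z, w}) \ {v, e, f}) :
    dg G {x, y, z, w} g + dg G {v, e, f} g ≤ 3 ∨
      dg G {x, y, z, w} g + dg G {v, e, f} g = 4 ∧ dg G {v, e, f} g = 2 ∧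
        G.Adj g x ∧ G.Adj g z ∧ G.Adj g v := by
  obtain ⟨hgJ, hgT⟩ := mem_sdiff.1 hg
  obtain ⟨hgS, hgC⟩ := mem_sdiff.1 hgJ
  simp only [mem_insert, mem_singleton, not_or] at hgT hgC
  obtain ⟨gv, ge, gf⟩ := hgT
  obtain ⟨gx, gy, gz, gw⟩ := hgC
  obtain ⟨⟨hx, hy, hz, hw⟩, ⟨hxy, hyz, hzw, hwx⟩, hxz, hyw, -⟩ := id H.sq
  obtain ⟨hv, he, hf, hve, hvf, hef⟩ := id H.tri'
  have cv := H.ne_square v (by simp)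
  have ce := H.ne_square e (by simp)
  have cf := H.ne_square f (by simp)
  have h1 : ¬ (G.Adj g x ∧ G.Adj g y) := fun h => H.not_tri hgS hy h.1 hxy.symm h.2
  have h2 : ¬ (G.Adj g x ∧ G.Adj g w) := fun h => H.not_tri hgS hw h.1 hwx h.2
  have h3 : ¬ (G.Adj g y ∧ G.Adj g z) := fun h => hNT.elim ⟨hgS, hy, hz, h.1, h.2, hyz⟩ H.tri'
    gv ge gf cv.2.1.symm ce.2.1.symm cf.2.1.symm cv.2.2.1.symm ce.2.2.1.symm cf.2.2.1.symm
  have h4 : ¬ (G.Adj g w ∧ G.Adj g z) := fun h => hNT.elim ⟨hgS, hw, hz, h.1, h.2, hzw.symm⟩ H.tri'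
    gv ge gf cv.2.2.2.symm ce.2.2.2.symm cf.2.2.2.symm cv.2.2.1.symm ce.2.2.1.symm cf.2.2.1.symm
  have h5 : ¬ (G.Adj g e ∧ G.Adj g f) := fun h => gz (H.eq_z hNT hgS gv h.1 h.2)
  have h6 : ¬ (G.Adj g y ∧ G.Adj g v) := fun h => hNT.elim (d := z) (e := e) (f := f)
    ⟨hgS, hy, hv, h.1, h.2, H.vy.symm⟩ ⟨hz, he, hf, hze, hzf, hef⟩ gz ge gf hyz.ne ce.2.1.symm
    cf.2.1.symm cv.2.2.1 hve.ne hvf.ne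
  rw [H.sq.dg_eq, dg_triple hve.ne hvf.ne hef.ne]
  clear * - h1 h2 h3 h4 h5 h6
  by_cases a1 : G.Adj g x <;> by_cases a2 : G.Adj g y <;> by_cases a3 : G.Adj g z <;>
    by_cases a4 : G.Adj g w <;> by_cases a5 : G.Adj g v <;> by_cases a6 : G.Adj g e <;>
    by_cases a7 : G.Adj g f <;> simp_all

end BadSq

namespace BadSq

variable {x y z w v e f : V}

lemma sum_le (H : BadSq G S (k + 1) x y z w v e f) :
    W G S (k + 2) - ∑ g ∈ (S \ {x, y, z, w}) \ {v, e, f}, wt (k + 2) (dg G S g) ≤ 5 := by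
  have h1 : W G S (k + 2) = ∑ g ∈ (S \ {x, y, z, w}) \ {v, e, f}, wt (k + 2) (dg G S g) +
      ∑ g ∈ {v, e, f}, wt (k + 2) (dg G S g) + ∑ g ∈ {x, y, z, w}, wt (k + 2) (dg G S g) := by
    rw [sum_sdiff H.tri.subset, sum_sdiff H.sq.subset]
    rfl
  obtain ⟨-, -, -, hve, hvf, hef⟩ := H.tri
  have hx := H.low
  rw [H.sq.sum_eq, sum_triple _ hve.ne hvf.ne hef.ne,
    wt_eq_neg (d := dg G S x) (by omega)] at h1
  have := wt_le_one (k + 2) (dg G S y)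
  have := wt_le_one (k + 2) (dg G S z)
  have := wt_le_one (k + 2) (dg G S w)
  have := wt_le_one (k + 2) (dg G S v)
  have := wt_le_one (k + 2) (dg G S e)
  have := wt_le_one (k + 2) (dg G S f)
  omega

lemma dg_split (H : BadSq G S k x y z w v e f) (g : V) :
    dg G S g = dg G ((S \ {x, y, z, w}) \ {v, e, f}) g + dg G {v, e, f} g +
      dg G {x, y, z, w} g := by
  rw [dg_sdiff H.sq.subset, dg_sdiff H.tri.subset]

lemma dg_le_add_four (H : BadSq G S k x y z w v e f) (hNT : NT G S) (hze : G.Adj z e)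
    (hzf : G.Adj z f) {g : V} (hg : g ∈ (S \ {x, y, z, w}) \ {v, e, f}) :
    dg G S g ≤ dg G ((S \ {x, y, z, w}) \ {v, e, f}) g + 4 := by
  have h1 := H.dg_split g
  have h2 := H.loss hNT hze hzf hg
  omega

lemma W_ge (H : BadSq G S (k + 1) x y z w v e f) (hNT : NT G S) (hze : G.Adj z e)
    (hzf : G.Adj z f) (N : Finset V)
    (hN : N ⊆ (S \ {x, y, z, w}) \ {v, e, f})
    (hgain : ∀ g ∈ N, wt (k + 2) (dg G S g) + 1 ≤
      wt k (dg G ((S \ {x, y, z, w}) \ {v, e, f}) g)) :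
    W G S (k + 2) - 5 + N.card ≤ W G ((S \ {x, y, z, w}) \ {v, e, f}) k := by
  have h1 : ∑ g ∈ (S \ {x, y, z, w}) \ {v, e, f}, (wt (k + 2) (dg G S g) + if g ∈ N then 1 else 0) ≤
      W G ((S \ {x, y, z, w}) \ {v, e, f}) k := by
    refine sum_le_sum fun g hg => ?_
    split_ifs with hgN
    · exact hgain g hgN
    · have := wt_add_two_le (k := k) (H.dg_le_add_four hNT hze hzf hg)
      omega
  rw [sum_add_distrib, sum_ite_mem, inter_eq_right.2 hN, sum_const, nsmul_one] at h1
  have := H.sum_le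
  omega

lemma dc_three (H : BadSq G S 2 x y z w v e f) (hNT : NT G S) (hW : 6 ≤ W G S 3)
    (hze : G.Adj z e) (hzf : G.Adj z f) : DC G 3 S := by
  by_contra hn
  obtain ⟨F, hFdef⟩ : ∃ F, F = (S \ {x, y, z, w}) \ {v, e, f} := ⟨_, rfl⟩
  have hF : Acyc G F := fun Z hZ hcyc => hn (DC.succ H.sq.cyc H.sq.subset
    (DC.succ H.tri.cyc H.tri.subset (DC.one hcyc (hFdef ▸ hZ))))
  have hFd : ∀ g ∈ F, dg G S g ≤ dg G F g + 3 + if G.Adj x g then 1 else 0 := by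
    intro g hg
    have h1 := H.dg_split g
    rw [← hFdef] at h1
    rcases H.loss hNT hze hzf (hFdef ▸ hg) with h2 | ⟨h2, -, h3, -⟩
    · split_ifs <;> omega
    · rw [if_pos h3.symm]
      omega
  obtain ⟨n, i, hni, hn0, hn1⟩ := hF.sum_le (fun g => wt 3 (dg G S g))
    (fun g => if G.Adj x g then 1 else 0) (fun g _ => by split_ifs <;> omega)
    (fun g hg hd => by
      have := hFd g hg
      rw [wt_eq_neg (by split_ifs at this <;> omega)])
    (fun g hg hd => by
      have := hFd g hg
      unfold wt
      split_ifs at this ⊢ <;> omega)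
  have hp : (∑ g ∈ F, if G.Adj x g then (1 : ℤ) else 0) = dg G F x := by
    rw [sum_boole]
    rfl
  have h1 := H.sum_le
  have h2 := H.dg_split x
  have h3 := H.two_le_dg (T := {x, y, z, w}) (by simp) (by simp)
  have h4 := H.low
  rw [hp] at hn1
  norm_num at h1
  rw [← hFdef] at h1 h2
  rcases Nat.eq_zero_or_pos n with h0 | h0
  · have := (hn0 h0).2
    omega
  · have := (hn1 h0).2
    omega

end BadSq

namespace BadSq

variable {x y z w v e f g : V}

lemma dc_of_loss_four (H : BadSq G S k x y z w v e f) (hA : StarBound V k) (hk : 2 ≤ k)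
    (hNT : NT G S) (hW : 2 * ((k : ℤ) + 1) ≤ W G S (k + 1)) (hze : G.Adj z e) (hzf : G.Adj z f)
    (hg : g ∈ (S \ {x, y, z, w}) \ {v, e, f})
    (hloss : dg G {x, y, z, w} g + dg G {v, e, f} g = 4) (hgd : dg G S g ≤ 2 * k + 1) :
    DC G (k + 1) S := by
  obtain ⟨hT2, hgx, hgz, hgv⟩ : dg G {v, e, f} g = 2 ∧ G.Adj g x ∧ G.Adj g z ∧ G.Adj g v := by
    rcases H.loss hNT hze hzf hg with h | h
    · omega
    · exact h.2
  obtain ⟨hgJ, hgT⟩ := mem_sdiff.1 hg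
  obtain ⟨hgS, hgC⟩ := mem_sdiff.1 hgJ
  simp only [mem_insert, mem_singleton, not_or] at hgT hgC
  obtain ⟨hv, he, hf, hve, hvf, hef⟩ := id H.tri'
  have hz := H.sq.1.2.2.1
  have cv := H.ne_square v (by simp)
  have ce := H.ne_square e (by simp)
  have cf := H.ne_square f (by simp)
  have ht : Tri G S g z v := ⟨hgS, hz, hv, hgz, hgv, H.vz.symm⟩
  have hsub : ((S \ {g, z, v}).filter fun u => G.Adj u g ∧ G.Adj u z ∧ G.Adj u v) ⊆
      ({e, f} : Finset V).filter (G.Adj g) := by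
    intro u hu
    obtain ⟨huS, hug, huz, huv⟩ := mem_filter.1 hu
    refine mem_filter.2 ⟨?_, hug.symm⟩
    by_contra hne
    simp only [mem_insert, mem_singleton, not_or] at hne
    exact hNT.elim ⟨(mem_sdiff.1 huS).1, hgS, hz, hug, huz, hgz⟩ H.tri' huv.ne hne.1 hne.2
      hgT.1 hgT.2.1 hgT.2.2 cv.2.2.1.symm ce.2.2.1.symm cf.2.2.1.symm
  have hcard := card_le_card hsub
  have hdg := dg_insert (G := G) (a := v) (S := {e, f}) (by simp [hve.ne, hvf.ne]) g
  rw [if_pos hgv, hT2] at hdg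
  change _ ≤ dg G {e, f} g at hcard
  have hx : ∀ u ∈ ({x, y, w} : Finset V), u ∈ S \ {g, z, v} := by
    intro u hu
    obtain ⟨⟨hx, hy, hz, hw⟩, ⟨hxy, hyz, hzw, hwx⟩, hxz, hyw, -⟩ := id H.sq
    simp only [mem_insert, mem_singleton, mem_sdiff, not_or] at hu ⊢
    rcases hu with rfl | rfl | rfl
    · exact ⟨hx, Ne.symm hgC.1, hxz, cv.1.symm⟩
    · exact ⟨hy, Ne.symm hgC.2.1, hyz.ne, cv.2.1.symm⟩
    · exact ⟨hw, Ne.symm hgC.2.2.2, hzw.ne', cv.2.2.2.symm⟩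
  refine hA.of_tri_of_low (x := x) hk hNT hW ht ?_ (hx x (by simp)) (fun h => H.vx h.2.2.symm)
    H.low ?_
  · have h1 : wt (k + 1) (dg G S g) ≤ 0 := by
      unfold wt
      split_ifs <;> omega
    have := wt_le_one (k + 1) (dg G S z)
    have := wt_le_one (k + 1) (dg G S v)
    omega
  · have := H.two_le_dg (hx y (by simp)) (hx w (by simp))
    omega

/-- A low vertex of the remaining set whose only neighbour there is adjacent to `x`. -/
lemma dc_of_leaf (H : BadSq G S k x y z w v e f) (hk : 2 ≤ k) (hB : 3 ≤ k → NTBound V k)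
    (hNT : NT G S) (hW : 2 * ((k : ℤ) + 1) ≤ W G S (k + 1)) {u : V}
    (hu : u ∈ (S \ {x, y, z, w}) \ {v, e, f}) (hul : dg G S u ≤ 2 * k)
    (hxu : dg G S x ≤ dg G S u) (hd : dg G ((S \ {x, y, z, w}) \ {v, e, f}) u = 1)
    (hg : g ∈ (S \ {x, y, z, w}) \ {v, e, f}) (hug : G.Adj u g) (hgx : G.Adj g x)
    (hgz : G.Adj g z) (hgv : G.Adj g v) : DC G (k + 1) S := by
  obtain ⟨hgJ, hgT⟩ := mem_sdiff.1 hg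
  obtain ⟨hgS, hgC⟩ := mem_sdiff.1 hgJ
  obtain ⟨huS, huC⟩ := mem_sdiff.1 (mem_sdiff.1 hu).1
  simp only [mem_insert, mem_singleton, not_or] at hgC huC
  obtain ⟨⟨hx, hy, hz, hw⟩, ⟨hxy, hyz, hzw, hwx⟩, hxz, hyw, -⟩ := id H.sq
  obtain ⟨hv, he, hf, hve, hvf, hef⟩ := id H.tri'
  have hut := H.not_inTri u huS hul
  have h3 : 3 ≤ dg G S x := by
    have h1 : 3 ≤ dg G {y, w, g} x := by
      rw [dg_triple hyw (Ne.symm hgC.2.1) (Ne.symm hgC.2.2.2), if_pos hxy, if_pos hwx.symm,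
        if_pos hgx.symm]
    exact h1.trans (dg_mono (triple_subset hy hw hgS) x)
  have hsplit := H.dg_split u
  rw [hd, H.sq.dg_eq, dg_triple hve.ne hvf.ne hef.ne] at hsplit
  have n1 : ¬ G.Adj u x := fun h => hut ⟨g, hgS, x, hx, hug, h, hgx⟩
  have n2 : ¬ G.Adj u z := fun h => hut ⟨g, hgS, z, hz, hug, h, hgz⟩
  have n3 : ¬ G.Adj u v := fun h => hut ⟨g, hgS, v, hv, hug, h, hgv⟩
  have n4 : ¬ (G.Adj u e ∧ G.Adj u f) := fun h => hut ⟨e, he, f, hf, h.1, h.2, hef⟩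
  rw [if_neg n1, if_neg n2, if_neg n3] at hsplit
  obtain ⟨y', hy', hxy', huy', hgy'⟩ : ∃ y' ∈ S, G.Adj x y' ∧ G.Adj u y' ∧ y' ≠ g := by
    by_cases h1 : G.Adj u y
    · exact ⟨y, hy, hxy, h1, Ne.symm hgC.2.1⟩
    by_cases h2 : G.Adj u w
    · exact ⟨w, hw, hwx.symm, h2, Ne.symm hgC.2.2.2⟩
    rw [if_neg h1, if_neg h2] at hsplit
    have := ite_add_ite_le_one n4
    omega
  have hsq : Sq G S x y' u g := ⟨⟨hx, hy', huS, hgS⟩, ⟨hxy', huy'.symm, hug, hgx⟩,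
    Ne.symm huC.1, hgy', fun h => n1 h.symm,
    fun h => H.not_tri hy' hgS hxy'.symm hgx h⟩
  refine DC.of_good_square hk hB hNT hW hsq (fun a ha => ?_) H.low (H.not_inTri x hx H.low)
  have haS := (mem_sdiff.1 ha).1
  have m1 := ite_add_ite_le_one fun h : G.Adj a x ∧ G.Adj a y' =>
    H.not_tri haS hy' h.1 hxy'.symm h.2
  have m2 := ite_add_ite_le_one fun h : G.Adj a u ∧ G.Adj a g =>
    hut ⟨a, haS, g, hgS, h.1.symm, hug, h.2⟩
  rw [hsq.dg_eq]
  omega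

lemma dc (H : BadSq G S (k + 1) x y z w v e f) (hk : 2 ≤ k) (hA : StarBound V (k + 1))
    (hA' : StarBound V k) (hB : NTBound V (k + 1)) (hNT : NT G S)
    (hW : 2 * (((k + 1 : ℕ) : ℤ) + 1) ≤ W G S (k + 1 + 1)) (hze : G.Adj z e) (hzf : G.Adj z f)
    (hmin : ∀ u ∈ S, dg G S u ≤ 2 * (k + 1) → dg G S x ≤ dg G S u) : DC G (k + 1 + 1) S := by
  obtain ⟨F, hF⟩ : ∃ F, F = (S \ {x, y, z, w}) \ {v, e, f} := ⟨_, rfl⟩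
  by_contra hn
  have hTF : TF G F := hF ▸ (hNT.mono sdiff_subset).tf_sdiff H.tri Subset.rfl
  have hn' : ¬ DC G k F := fun h =>
    hn (DC.succ H.sq.cyc H.sq.subset (DC.succ H.tri.cyc H.tri.subset (hF ▸ h)))
  have hFS : F ⊆ S := hF ▸ sdiff_subset.trans sdiff_subset
  have hW1 := H.W_ge hNT hze hzf ∅ (by simp) (by simp)
  rw [← hF, card_empty] at hW1
  push_cast at hW hW1
  change _ ≤ W G S (k + 2) at hW
  have hgain : ∀ g ∈ F, wt k (dg G F g) ≤ wt (k + 2) (dg G S g) := by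
    intro g hg
    by_contra hlt
    have h1 := H.W_ge hNT hze hzf {g} (by simpa [hF] using hg) (fun a ha => by
      obtain rfl := mem_singleton.1 ha
      rw [← hF]
      omega)
    rw [← hF, card_singleton] at h1
    push_cast at h1
    exact hn' (hA'.of_tf hTF (by omega))
  have hloss : ∀ g ∈ F, dg G S g ≤ dg G F g + 3 ∨
      (2 * k + 4 ≤ dg G S g ∧ dg G S g = dg G F g + 4 ∧ G.Adj g x ∧ G.Adj g z ∧ G.Adj g v) := by
    intro g hg
    have h1 := H.dg_split g
    rw [← hF] at h1
    rcases H.loss hNT hze hzf (hF ▸ hg) with h2 | ⟨h2, -, h3⟩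
    · left
      omega
    · right
      refine ⟨?_, by omega, h3⟩
      by_contra hgd
      exact hn (H.dc_of_loss_four hA (by omega) hNT (by push_cast; omega) hze hzf (hF ▸ hg) h2
        (by omega))
  have hhigh : ∀ g ∈ F, 2 * k + 4 ≤ dg G S g := by
    intro u hu
    by_contra hud
    have hlu : dg G S u ≤ dg G F u + 3 := (hloss u hu).resolve_right fun h => hud h.1
    have hug := hgain u hu
    have hul : dg G S u ≤ 2 * (k + 1) := by
      unfold wt at hug
      split_ifs at hug <;> omega
    have hul' : dg G F u + 2 ≤ 2 * k := by
      unfold wt at hug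
      split_ifs at hug <;> omega
    by_cases hd1 : dg G F u = 1
    · obtain ⟨g, hg, hadj⟩ := dg_pos_iff.1 (by omega : 1 ≤ dg G F u)
      refine hn' (hA'.of_leaf hk hTF (by omega) hu hd1 hg hadj ?_)
      have hgg := hgain g hg
      rcases hloss g hg with h1 | ⟨-, -, h1, h2, h3⟩
      · unfold wt at hgg
        split_ifs at hgg <;> omega
      · exact absurd (H.dc_of_leaf (by omega) (fun _ => hB) hNT (by push_cast; omega) (hF ▸ hu) hul
          (hmin u (hFS hu) hul) (hF ▸ hd1) (hF ▸ hg) hadj h1 h2 h3) hn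
    · exact hn' (hA'.of_low hk hTF (by omega) hu hul' hd1)
  refine hn' (hA'.of_two_mul_le hTF ?_ fun u hu => ?_)
  · by_contra hne
    rw [not_nonempty_iff_eq_empty] at hne
    rw [hne] at hW1
    have : W G ∅ k = 0 := rfl
    omega
  · have := hhigh u hu
    rcases hloss u hu with h | h <;> omega

end BadSq

lemma starBound_of_ntBound (hB : ∀ j, 3 ≤ j → j ≤ k → NTBound V j) {j : ℕ} (hj : 2 ≤ j)
    (hjk : j ≤ k) : StarBound V j := by
  rcases hj.eq_or_lt with rfl | hj
  · exact starBound_two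
  · exact (hB j hj hjk).starBound

lemma BadSq.dc_succ {x y z w v e f : V} (H : BadSq G S k x y z w v e f) (hk : 2 ≤ k)
    (hB : ∀ j, 3 ≤ j → j ≤ k → NTBound V j) (hNT : NT G S)
    (hW : 2 * ((k : ℤ) + 1) ≤ W G S (k + 1))
    (hmin : ∀ u ∈ S, dg G S u ≤ 2 * k → dg G S x ≤ dg G S u) : DC G (k + 1) S := by
  by_cases hz : G.Adj z e ∧ G.Adj z f
  · rcases hk.eq_or_lt with rfl | hk3
    · exact H.dc_three hNT (by norm_num at hW; exact hW) hz.1 hz.2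
    · obtain ⟨m, rfl⟩ : ∃ m, k = m + 1 := ⟨k - 1, by omega⟩
      exact H.dc (by omega) (hB _ hk3 le_rfl).starBound (starBound_of_ntBound hB (by omega) (by omega))
        (hB _ hk3 le_rfl) hNT hW hz.1 hz.2 hmin
  · exact H.dc_of_not_adj (starBound_of_ntBound hB hk le_rfl) hk hNT hW hz

lemma Sq.dc_succ {x y z w d e f : V} (h : Sq G S x y z w) (ht : Tri G (S \ {x, y, z, w}) d e f)
    (hk : 2 ≤ k) (hB : ∀ j, 3 ≤ j → j ≤ k → NTBound V j) (hNT : NT G S)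
    (hW : 2 * ((k : ℤ) + 1) ≤ W G S (k + 1)) (hlow : dg G S x ≤ 2 * k)
    (hL : ∀ u ∈ S, dg G S u ≤ 2 * k → ¬ InTri G S u)
    (hmin : ∀ u ∈ S, dg G S u ≤ 2 * k → dg G S x ≤ dg G S u) : DC G (k + 1) S := by
  obtain ⟨⟨hx, hy, hz, hw⟩, ⟨hxy, hyz, hzw, hwx⟩, -⟩ := id h
  by_cases hgood : ∀ u ∈ S \ {x, y, z, w}, dg G {x, y, z, w} u ≤ 2
  · exact DC.of_good_square hk (fun h3 => hB k h3 le_rfl) hNT hW h hgood hlow (hL x hx hlow)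
  push Not at hgood
  obtain ⟨v, hv, hvd⟩ := hgood
  have hvS := (mem_sdiff.1 hv).1
  have h1 : ¬ (G.Adj v x ∧ G.Adj v y) := fun hh => hL x hx hlow ⟨v, hvS, y, hy, hh.1.symm, hxy, hh.2⟩
  have h2 : ¬ (G.Adj v x ∧ G.Adj v w) := fun hh =>
    hL x hx hlow ⟨v, hvS, w, hw, hh.1.symm, hwx.symm, hh.2⟩
  obtain ⟨hvy, hvz, hvw⟩ : G.Adj v y ∧ G.Adj v z ∧ G.Adj v w := by
    rw [h.dg_eq] at hvd
    clear * - hvd h1 h2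
    split_ifs at hvd <;> first | omega | tauto
  have key : ∀ e f, Tri G (S \ {x, y, z, w}) v e f → DC G (k + 1) S := fun e f ht =>
    BadSq.dc_succ ⟨h, ht, hvy, hvz, hvw, hlow, hL⟩ hk hB hNT hW hmin
  obtain ⟨hd, he, hf, hde, hdf, hef⟩ := id ht
  by_cases hvd : v = d
  · subst hvd
    exact key e f ht
  by_cases hve : v = e
  · subst hve
    exact key d f ⟨he, hd, hf, hde.symm, hef, hdf⟩
  by_cases hvf : v = f
  · subst hvf
    exact key d e ⟨hf, hd, he, hdf.symm, hef.symm, hde⟩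
  have hC : ∀ g ∈ ({x, y, z, w} : Finset V), g ≠ d ∧ g ≠ e ∧ g ≠ f := by
    intro g hg
    refine ⟨?_, ?_, ?_⟩ <;> rintro rfl <;> exact (mem_sdiff.1 ‹_›).2 hg
  obtain ⟨y1, y2, y3⟩ := hC y (by simp)
  obtain ⟨z1, z2, z3⟩ := hC z (by simp)
  exact (hNT.elim ⟨hvS, hy, hz, hvy, hvz, hyz⟩ (ht.mono sdiff_subset) hvd hve hvf y1 y2 y3
    z1 z2 z3).elim

lemma NTBoundBelow.dc (ih : NTBoundBelow V (k + 1) S.card) (hk : 2 ≤ k)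
    (hB : ∀ j, 3 ≤ j → j ≤ k → NTBound V j) (hNT : NT G S)
    (hW : 2 * ((k : ℤ) + 1) ≤ W G S (k + 1)) : DC G (k + 1) S := by
  have hA := starBound_of_ntBound hB hk le_rfl
  have hW' : 2 * ((k + 1 : ℕ) : ℤ) ≤ W G S (k + 1) := by
    push_cast
    exact hW
  by_contra hn
  have hδ : ∀ v ∈ S, 2 ≤ dg G S v := by
    intro v hv
    by_contra hd
    exact hn (ih.of_dg_le_one (by omega) hNT hW' hv (by omega))
  have hTF : ¬ TF G S := fun h => hn (ih.of_tf (by omega) h hW' hδ)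
  have hL : ∀ u ∈ S, dg G S u ≤ 2 * k → ¬ InTri G S u := by
    rintro u hu hul ⟨a, ha, b, hb, hua, hub, hab⟩
    exact hn (hA.of_low_tri hk hNT hW ⟨hu, ha, hb, hua, hub, hab⟩ hul)
  have hne : (S.filter fun u => dg G S u ≤ 2 * k).Nonempty := by
    by_contra hne
    rw [not_nonempty_iff_eq_empty, filter_eq_empty_iff] at hne
    exact hn (hA.of_high hk hNT hW (fun u hu => by have := hne hu; omega) hTF)
  obtain ⟨x, hx, hmin⟩ := exists_min_image _ (dg G S) hne
  obtain ⟨hxS, hlow⟩ := mem_filter.1 hx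
  obtain ⟨y, hy, hxy⟩ := dg_pos_iff.1 ((by omega : 1 ≤ 2).trans (hδ x hxS))
  have hxt := hL x hxS hlow
  by_cases hcon : NT (con G x y) (S.erase x)
  · have h1 := W_con_ge hxS hy hxy (no_common_of_not_inTri hxt hy hxy) (k + 1) (hδ x hxS)
    rw [wt_eq_neg (by omega)] at h1
    exact hn (ih.of_con hxS hxy hcon (by omega))
  · obtain ⟨z, w, hsq, d, e, f, ht⟩ := hNT.exists_square hxS hy hxy hxt hcon
    exact hn (hsq.dc_succ ht hk hB hNT hW hlow hL
      fun u hu hul => hmin u (mem_filter.2 ⟨hu, hul⟩))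

lemma ntBound (hk : 3 ≤ k) : NTBound V k := by
  induction k using Nat.strong_induction_on with
  | _ k ihk =>
    obtain ⟨m, rfl⟩ : ∃ m, k = m + 1 := ⟨k - 1, by omega⟩
    have hB : ∀ j, 3 ≤ j → j ≤ m → NTBound V j := fun j hj hjm => ihk j (by omega) hj
    have below : ∀ n, NTBoundBelow V (m + 1) n := by
      intro n
      induction n with
      | zero => exact fun G S h => absurd h (Nat.not_lt_zero _)
      | succ n ih =>
        intro G S hS hNT hW
        rcases (Nat.lt_succ_iff.1 hS).lt_or_eq with h | rfl
        · exact ih G S h hNT hW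
        · exact ih.dc (by omega) hB hNT (by push_cast at hW; exact hW)
    exact fun G S => below (S.card + 1) G S (Nat.lt_succ_self _)

lemma dg_univ [Fintype V] [DecidableRel G.Adj] (v : V) : dg G univ v = G.degree v := by
  rw [← G.card_neighborFinset_eq_degree, dg]
  congr 1
  ext u
  simp

lemma le_W_univ [Fintype V] [DecidableRel G.Adj] (hk : 1 ≤ k) :
    ((highSet G k).card : ℤ) - (lowSet G k).card ≤ W G univ k := by
  have h1 : ∀ v, (if 2 * k ≤ G.degree v then 1 else 0) - (if G.degree v ≤ 2 * k - 2 then 1 else 0) ≤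
      wt k (dg G univ v) := by
    intro v
    rw [dg_univ]
    unfold wt
    split_ifs <;> omega
  have h2 := sum_le_sum fun v (_ : v ∈ (univ : Finset V)) => h1 v
  rw [sum_sub_distrib, sum_boole, sum_boole] at h2
  exact h2

end

end DisjointCycles

/-- If `G` has no two vertex-disjoint triangles and `|H_k(G)| - |L_k(G)| ≥ 2k` (`k ≥ 3`),
then `G` contains `k` disjoint cycles. -/
theorem kkm_no_two_triangles {V : Type*} [Fintype V] [DecidableEq V] (G : SimpleGraph V)
    [DecidableRel G.Adj] (k : ℕ) (hk : 3 ≤ k)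
    (htri : ∀ t₁ t₂ : Finset V, IsTriangle G t₁ → IsTriangle G t₂ → ¬ Disjoint t₁ t₂)
    (h : (lowSet G k).card + 2 * k ≤ (highSet G k).card) :
    HasDisjointCycles G k := by
  refine (DisjointCycles.ntBound hk G Finset.univ ?_ ?_).hasDisjointCycles
  · rintro a b c d e f ⟨-, -, -, hab, hac, hbc⟩ ⟨-, -, -, hde, hdf, hef⟩
    have := htri _ _ ⟨a, b, c, rfl, hab, hac, hbc⟩ ⟨d, e, f, rfl, hde, hdf, hef⟩
    contrapose! this
    simp only [Finset.disjoint_insert_left, Finset.disjoint_singleton_left, Finset.mem_insert,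
      Finset.mem_singleton, not_or]
    obtain ⟨h1, h2, h3, h4, h5, h6, h7, h8, h9⟩ := this
    exact ⟨⟨h1, h2, h3⟩, ⟨h4, h5, h6⟩, h7, h8, h9⟩
  · have := DisjointCycles.le_W_univ (G := G) (k := k) (by omega)
    omega
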